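/- Let ξ > 0 be sufficiently small and assume that the primes have level of distribution ϑ for some fixed ϑ > 1/2 + ξ (so that one may take R = N^{(1+2ξ)/(4(1+⌈1/ξ⌉^{−4}))} in Proposition 2). Then there is a constant c₆(ξ) > 0 such that for every fixed η with 0 < η ≤ ξ⁴/5, as N → ∞, #{j : N < p_j ≤ 2N, p_{j+1} − p_j ≤ η log N} ≥ (1 − o(1))·c₆(ξ)·η^{4ξ^{−2} + 14ξ^{−1} + 11}·N/log N. -/

import Mathlib

open Finset

/-- The `n`-th prime number (`nthPrime 0 = 2`). -/
noncomputable def nthPrime (n : ℕ) : ℕ := Nat.nth Nat.Prime n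

/-- The prime counting function `π(x)` at a real argument: the number of primes `≤ x`. -/
noncomputable def primePi (x : ℝ) : ℕ := Nat.primeCounting ⌊x⌋₊

/-- `P_H(n) = ∏_{h ∈ H} (n + h)`. -/
def tuplePoly (H : Finset ℕ) (n : ℕ) : ℕ := ∏ h ∈ H, (n + h)

/-- `ν_p(H)`: the number of distinct residue classes modulo `p` occupied by `H`. -/
def nuP (p : ℕ) (H : Finset ℕ) : ℕ := (H.image (· % p)).card

/-- `H` is admissible: for every prime `p`, the elements of `H` miss a residue class mod `p`. -/
def Admissible (H : Finset ℕ) : Prop := ∀ p : ℕ, p.Prime → nuP p H < p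

/-- The singular series `𝔖(H) = ∏_p (1 - 1/p)^{-|H|} (1 - ν_p(H)/p)`. -/
noncomputable def singularSeries (H : Finset ℕ) : ℝ :=
  ∏' p : Nat.Primes, ((1 - 1/((p : ℕ) : ℝ)) ^ (-(H.card : ℤ)) * (1 - (nuP p H : ℝ)/((p : ℕ) : ℝ)))

/-- `Λ_R(n; H, ℓ) = (1/(|H|+ℓ)!) ∑_{d ∣ P_H(n), d ≤ R} μ(d) (log (R/d))^{|H|+ℓ}`. -/
noncomputable def LambdaR (R : ℝ) (n : ℕ) (H : Finset ℕ) (ℓ : ℕ) : ℝ :=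
  (1 / (H.card + ℓ).factorial : ℝ) *
    ∑ d ∈ (tuplePoly H n).divisors.filter (fun d : ℕ => (d : ℝ) ≤ R),
      (ArithmeticFunction.moebius d : ℝ) * (Real.log (R / d)) ^ (H.card + ℓ)

/-- `𝒫(x)`: the product of all primes `≤ x`. -/
noncomputable def primorialReal (x : ℝ) : ℕ :=
  ∏ p ∈ (Finset.range (⌊x⌋₊ + 1)).filter Nat.Prime, p

/-- `θ(n) = log n` if `n` is prime, and `0` otherwise. -/
noncomputable def theta (n : ℕ) : ℝ := if n.Prime then Real.log n else 0

/-- `∑_{p ≤ N, p prime, p ≡ a (mod q)} log p`. -/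
noncomputable def primeSumAP (N q a : ℕ) : ℝ :=
  ∑ p ∈ (Finset.range (N+1)).filter (fun p => p.Prime ∧ p % q = a % q), Real.log p

/-- The primes have level of distribution `ϑ`: for every `A > 0` and `ε > 0`,
`∑_{q ≤ N^{ϑ-ε}} max_{(a,q)=1} |∑_{p ≤ N, p ≡ a (q)} log p - N/φ(q)| ≪_{A,ε} N (log N)^{-A}`
(the max over `a` is expressed via an arbitrary coprime choice function `a : ℕ → ℕ`). -/
def HasLevelOfDistribution (ϑ : ℝ) : Prop :=
  ∀ A : ℝ, 0 < A → ∀ ε : ℝ, 0 < ε → ∃ C : ℝ, 0 < C ∧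
    ∀ N : ℕ, 2 ≤ N → ∀ a : ℕ → ℕ, (∀ q : ℕ, Nat.Coprime (a q) q) →
      ∑ q ∈ Finset.Icc 1 ⌊(N : ℝ) ^ (ϑ - ε)⌋₊,
        |primeSumAP N q (a q) - (N : ℝ) / (Nat.totient q)| ≤ C * N / (Real.log N) ^ A

/-- The number of `j` with `N < p_j ≤ 2N` and `p_{j+1} - p_j ≤ h`. -/
noncomputable def gapCount (N : ℕ) (h : ℝ) : ℕ :=
  ((Finset.range (2*N+1)).filter (fun j =>
    N < nthPrime j ∧ nthPrime j ≤ 2*N ∧ ((nthPrime (j+1) : ℝ) - nthPrime j) ≤ h)).card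

/-- The number of `j` with `N < p_j ≤ 2N` and `p_{j+2} - p_j ≤ h`. -/
noncomputable def gapCount2 (N : ℕ) (h : ℝ) : ℕ :=
  ((Finset.range (2*N+1)).filter (fun j =>
    N < nthPrime j ∧ nthPrime j ≤ 2*N ∧ ((nthPrime (j+2) : ℝ) - nthPrime j) ≤ h)).card

namespace GPY

section Abstract
variable {ι α : Type*} [Fintype ι] [DecidableEq ι] [Fintype α] [DecidableEq α]

/-- A tensor-product quadratic form. -/
noncomputable def qf (γ : ι → α → α → ℝ) (lam : (ι → α) → ℝ) : ℝ :=
  ∑ d : ι → α, ∑ e : ι → α, lam d * lam e * ∏ p, γ p (d p) (e p)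

/-- A tensor-product linear transformation. -/
noncomputable def tr (T : ι → α → α → ℝ) (c : (ι → α) → ℝ) (d : ι → α) : ℝ :=
  ∑ s : ι → α, c s * ∏ p, T p (s p) (d p)

lemma prod_sum_pi (f : ι → α → ℝ) : ∏ p, ∑ x, f p x = ∑ d : ι → α, ∏ p, f p (d p) := by
  rw [Finset.prod_univ_sum, Fintype.piFinset_univ]

lemma qf_tr (γ T : ι → α → α → ℝ) (c : (ι → α) → ℝ) :
    qf γ (tr T c) = qf (fun p a b => ∑ x, ∑ y, γ p x y * T p a x * T p b y) c := by
  unfold qf tr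
  have h : ∀ s t : ι → α, ∏ p, (∑ x, ∑ y, γ p x y * T p (s p) x * T p (t p) y)
      = ∑ d : ι → α, ∑ e : ι → α, (∏ p, γ p (d p) (e p)) * (∏ p, T p (s p) (d p))
        * ∏ p, T p (t p) (e p) := by
    intro s t
    rw [prod_sum_pi]
    refine sum_congr rfl fun d _ => ?_
    rw [prod_sum_pi]
    refine sum_congr rfl fun e _ => ?_
    rw [← prod_mul_distrib, ← prod_mul_distrib]
  simp_rw [h]
  simp_rw [sum_mul_sum, sum_mul, mul_sum]
  have e1 : ∀ f : (ι → α) → (ι → α) → (ι → α) → (ι → α) → ℝ,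
      ∑ d, ∑ e, ∑ s, ∑ t, f d e s t = ∑ s, ∑ t, ∑ d, ∑ e, f d e s t := by
    intro f
    calc _ = ∑ d, ∑ s, ∑ e, ∑ t, f d e s t := sum_congr rfl fun d _ => sum_comm
      _ = ∑ s, ∑ d, ∑ e, ∑ t, f d e s t := sum_comm
      _ = ∑ s, ∑ d, ∑ t, ∑ e, f d e s t :=
          sum_congr rfl fun d _ => sum_congr rfl fun s _ => sum_comm
      _ = _ := sum_congr rfl fun s _ => sum_comm
  rw [e1]
  refine sum_congr rfl fun s _ => sum_congr rfl fun t _ => sum_congr rfl fun d _ =>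
    sum_congr rfl fun e _ => ?_
  ring

/-- Positive semidefinite real kernels. -/
def PSD {β : Type*} [Fintype β] (M : β → β → ℝ) : Prop :=
  (∀ a b, M a b = M b a) ∧ ∀ x : β → ℝ, 0 ≤ ∑ a, ∑ b, x a * x b * M a b

lemma psd_iff {β : Type*} [Fintype β] (M : β → β → ℝ) :
    PSD M ↔ (Matrix.of M).PosSemidef := by
  rw [Matrix.posSemidef_iff_dotProduct_mulVec]
  unfold PSD
  refine and_congr ?_ ?_
  · rw [Matrix.IsHermitian.ext_iff]
    simp only [Matrix.of_apply, star_trivial]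
    exact ⟨fun h i j => h j i, fun h i j => h j i⟩
  · refine forall_congr' fun x => ?_
    have : ∑ a, ∑ b, x a * x b * M a b = star x ⬝ᵥ (Matrix.of M).mulVec x := by
      simp only [dotProduct, Matrix.mulVec, star_trivial, Matrix.of_apply, mul_sum]
      refine sum_congr rfl fun a _ => sum_congr rfl fun b _ => by ring
    rw [this]

lemma PSD.mul {β : Type*} [Fintype β] {M N : β → β → ℝ} (hM : PSD M) (hN : PSD N) :
    PSD (fun a b => M a b * N a b) := by
  rw [psd_iff] at *
  exact hM.hadamard hN

lemma PSD.add {β : Type*} [Fintype β] {M N : β → β → ℝ} (hM : PSD M) (hN : PSD N) :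
    PSD (fun a b => M a b + N a b) := by
  refine ⟨fun a b => by simp only [hM.1 a b, hN.1 a b], fun x => ?_⟩
  simp_rw [mul_add, sum_add_distrib]
  exact add_nonneg (hM.2 x) (hN.2 x)

lemma PSD.comap {β δ : Type*} [Fintype β] [Fintype δ] {M : β → β → ℝ} (hM : PSD M) (f : δ → β) :
    PSD (fun a b => M (f a) (f b)) := by
  rw [psd_iff] at *
  exact hM.submatrix f

lemma PSD.one {β : Type*} [Fintype β] : PSD (fun _ _ : β => (1 : ℝ)) := by
  refine ⟨fun _ _ => rfl, fun x => ?_⟩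
  have : ∑ a, ∑ b, x a * x b * (1 : ℝ) = (∑ a, x a) ^ 2 := by
    simp only [mul_one, sq, sum_mul_sum]
  rw [this]; positivity

lemma psd_prod (G : ι → α → α → ℝ) (hG : ∀ p, PSD (G p)) (s : Finset ι) :
    PSD (fun d e : ι → α => ∏ p ∈ s, G p (d p) (e p)) := by
  induction s using Finset.induction_on with
  | empty => simpa using PSD.one
  | insert a s ha ih =>
    simp_rw [prod_insert ha]
    exact ((hG a).comap (fun d : ι → α => d a)).mul ih

lemma psd_prod_sub (G H : ι → α → α → ℝ) (hG : ∀ p, PSD (G p))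
    (hGH : ∀ p, PSD (fun a b => H p a b - G p a b)) (s : Finset ι) :
    PSD (fun d e : ι → α => ∏ p ∈ s, H p (d p) (e p) - ∏ p ∈ s, G p (d p) (e p)) := by
  have hH : ∀ p, PSD (H p) := fun p => by
    have := (hGH p).add (hG p); simpa using this
  induction s using Finset.induction_on with
  | empty => simp only [prod_empty, sub_self]; exact ⟨by simp, by simp⟩
  | insert a s ha ih =>
    simp_rw [prod_insert ha]
    have h1 := ((hGH a).comap (fun d : ι → α => d a)).mul (psd_prod H hH s)
    have h2 := ((hG a).comap (fun d : ι → α => d a)).mul ih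
    have := h1.add h2
    convert this using 3
    ring

lemma qf_mono (G H : ι → α → α → ℝ) (hG : ∀ p, PSD (G p))
    (hGH : ∀ p, PSD (fun a b => H p a b - G p a b)) (c : (ι → α) → ℝ) : qf G c ≤ qf H c := by
  have := (psd_prod_sub G H hG hGH univ).2 c
  unfold qf
  simp_rw [mul_sub, sum_sub_distrib] at this
  linarith

lemma PSD.congr {M T : α → α → ℝ} (hM : PSD M) :
    PSD (fun a b => ∑ x, ∑ y, M x y * T a x * T b y) := by
  refine ⟨fun a b => ?_, fun v => ?_⟩
  · beta_reduce
    rw [sum_comm]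
    refine sum_congr rfl fun x _ => sum_congr rfl fun y _ => ?_
    rw [hM.1]; ring
  · have := hM.2 (fun x => ∑ a, v a * T a x)
    refine this.trans (le_of_eq ?_)
    simp_rw [sum_mul_sum, sum_mul, mul_sum]
    have e1 : ∀ f : α → α → α → α → ℝ,
        ∑ d, ∑ e, ∑ s, ∑ t, f d e s t = ∑ s, ∑ t, ∑ d, ∑ e, f d e s t := by
      intro f
      calc _ = ∑ d, ∑ s, ∑ e, ∑ t, f d e s t := sum_congr rfl fun d _ => sum_comm
        _ = ∑ s, ∑ d, ∑ e, ∑ t, f d e s t := sum_comm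
        _ = ∑ s, ∑ d, ∑ t, ∑ e, f d e s t :=
            sum_congr rfl fun d _ => sum_congr rfl fun s _ => sum_comm
        _ = _ := sum_congr rfl fun s _ => sum_comm
    rw [e1]
    refine sum_congr rfl fun s _ => sum_congr rfl fun t _ => sum_congr rfl fun d _ =>
      sum_congr rfl fun e _ => ?_
    ring

/-- Diagonal kernel. -/
def dg (D : α → ℝ) (a b : α) : ℝ := if a = b then D a else 0

lemma qf_dg (D : ι → α → ℝ) (c : (ι → α) → ℝ) :
    qf (fun p => dg (D p)) c = ∑ s, c s ^ 2 * ∏ p, D p (s p) := by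
  unfold qf
  refine sum_congr rfl fun d _ => ?_
  rw [sum_eq_single d]
  · simp [dg, sq]
  · intro e _ hne
    obtain ⟨p, hp⟩ := Function.ne_iff.mp hne
    rw [prod_eq_zero (mem_univ p), mul_zero]
    simp [dg, Ne.symm hp]
  · simp

lemma psd_dg {D : α → ℝ} (h : ∀ a, 0 ≤ D a) : PSD (dg D) := by
  refine ⟨fun a b => ?_, fun x => ?_⟩
  · unfold dg; split_ifs with h1 h2 h2 <;> simp_all
  · simp only [dg, mul_ite, mul_zero, sum_ite_eq, mem_univ, if_true]
    exact sum_nonneg fun a _ => mul_nonneg (mul_self_nonneg _) (h a)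

end Abstract

section Local
variable {κ : Type*} [Fintype κ] [DecidableEq κ]

/-- local change of basis `ψ_i = 1_{A_i} - 1/(q-1)`. -/
noncomputable def lT (q : ℝ) : Option κ → Option κ → ℝ
  | none, none => 1
  | none, some _ => 0
  | some _, none => -(1 / (q - 1))
  | some i, some j => if i = j then 1 else 0

/-- local densities, uniform measure. -/
noncomputable def lg1 (q : ℝ) : Option κ → Option κ → ℝ
  | none, none => 1
  | none, some _ => 1 / q
  | some _, none => 1 / q
  | some i, some j => if i = j then 1 / q else 0

/-- local densities, conditioned on divisibility at `i`. -/
noncomputable def lv (i : κ) : Option κ → ℝ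
  | none => 1
  | some j => if j = i then 1 else 0

/-- local densities, conditioned on non-divisibility at `m`. -/
noncomputable def lg2 (q : ℝ) (m : κ) : Option κ → Option κ → ℝ
  | none, none => 1
  | none, some j => if j = m then 0 else 1 / (q - 1)
  | some i, none => if i = m then 0 else 1 / (q - 1)
  | some i, some j => if i = j ∧ i ≠ m then 1 / (q - 1) else 0

noncomputable def lD1 (κ : Type*) [Fintype κ] (q : ℝ) : Option κ → ℝ
  | none => 1 + Fintype.card κ / (q * (q - 1))
  | some _ => 1 / (q - 1)

noncomputable def lu (q : ℝ) (i : κ) : Option κ → ℝ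
  | none => 1
  | some j => if j = i then 1 - 1 / (q - 1) else -(1 / (q - 1))

noncomputable def lK (q : ℝ) (m : κ) : Option κ → Option κ → ℝ
  | none, none => 1
  | none, some _ => 0
  | some i, none => if i = m then -(1 / (q - 1)) else 0
  | some i, some j => if i = j ∧ i ≠ m then 1 else 0

noncomputable def lG2 (q : ℝ) (m : κ) : Option κ → Option κ → ℝ
  | none, none => 1
  | none, some _ => 0
  | some _, none => 0
  | some i, some j => if i = m ∨ j = m then 0 else
      (if i = j then 1 / (q - 1) else 0) - 1 / (q - 1) ^ 2

noncomputable def lD2 (q : ℝ) (m : κ) : Option κ → ℝ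
  | none => 1
  | some i => if i = m then 0 else 1 / (q - 1) * (1 - Fintype.card κ / (q - 1))

lemma sum_lT (q : ℝ) (a : Option κ) (f : Option κ → ℝ) :
    ∑ x, f x * lT q a x = match a with
      | none => f none
      | some i => f (some i) - f none / (q - 1) := by
  rw [Fintype.sum_option]
  cases a with
  | none => simp [lT]
  | some i => simp [lT]; ring

lemma psd_lg1 {q : ℝ} (hq : 0 < q) (hk : (Fintype.card κ : ℝ) ≤ q) :
    PSD (lg1 (κ := κ) q) := by
  refine ⟨fun a b => ?_, fun x => ?_⟩
  · rcases a with _ | i <;> rcases b with _ | j <;> simp [lg1, eq_comm]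
  · have : ∑ a, ∑ b, x a * x b * lg1 q a b
        = (1 - Fintype.card κ / q) * x none ^ 2 + (1 / q) * ∑ i, (x none + x (some i)) ^ 2 := by
      simp only [Fintype.sum_option, lg1, mul_ite, mul_zero, sum_ite_eq, mem_univ, if_true]
      simp_rw [add_sq, sum_add_distrib, sum_const, card_univ, nsmul_eq_mul]
      have e1 : ∑ i : κ, x none * x (some i) * (1 / q) = (1/q) * x none * ∑ i, x (some i) := by
        rw [mul_sum]; exact sum_congr rfl fun i _ => by ring
      have e2 : ∑ i : κ, x (some i) * x none * (1 / q) = (1/q) * x none * ∑ i, x (some i) := by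
        rw [mul_sum]; exact sum_congr rfl fun i _ => by ring
      have e3 : ∑ i : κ, x (some i) * x (some i) * (1 / q) = (1/q) * ∑ i, x (some i) ^ 2 := by
        rw [mul_sum]; exact sum_congr rfl fun i _ => by ring
      have e4 : ∑ i : κ, 2 * x none * x (some i) = 2 * x none * ∑ i, x (some i) := by
        rw [mul_sum]
      rw [e1, e2, e3, e4]; field_simp; ring
    rw [this]
    have h1 : (Fintype.card κ : ℝ) / q ≤ 1 := by rw [div_le_one hq]; exact hk
    have : 0 ≤ ∑ i, (x none + x (some i)) ^ 2 := sum_nonneg fun _ _ => by positivity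
    have h2 : 0 ≤ 1 - (Fintype.card κ : ℝ) / q := by linarith
    positivity

/-- Gram matrix for the uniform measure. -/
noncomputable def lG1 (q : ℝ) (a b : Option κ) : ℝ := ∑ x, ∑ y, lg1 q x y * lT q a x * lT q b y

lemma lG1_eq (q : ℝ) (hq : 1 < q) (a b : Option κ) : lG1 q a b = match a, b with
    | none, none => 1
    | none, some _ => -(1 / (q * (q - 1)))
    | some _, none => -(1 / (q * (q - 1)))
    | some i, some j => (if i = j then 1 / q else 0) - (q - 2) / (q * (q - 1) ^ 2) := by
  unfold lG1
  have hq1 : q - 1 ≠ 0 := by linarith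
  have hq0 : q ≠ 0 := by linarith
  simp_rw [sum_lT q b (fun y => lg1 q _ y * lT q a _)]
  rcases b with _ | j
  · simp only
    rw [sum_lT q a (fun x => lg1 q x none)]
    rcases a with _ | i
    · simp [lg1]
    · simp only [lg1]; field_simp; ring
  · simp only
    have : ∀ x, lg1 q x (some j) * lT q a x - lg1 q x none * lT q a x / (q - 1)
      = (lg1 q x (some j) - lg1 q x none / (q - 1)) * lT q a x := fun x => by ring
    simp_rw [this]
    rw [sum_lT q a (fun x => lg1 q x (some j) - lg1 q x none / (q - 1))]
    rcases a with _ | i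
    · simp only [lg1]; field_simp; ring
    · simp only [lg1]; split_ifs <;> field_simp <;> ring

lemma psd_lD1_sub {q : ℝ} (hq : 2 ≤ q) :
    PSD (fun a b : Option κ => dg (lD1 κ q) a b - lG1 q a b) := by
  have hq1 : q - 1 ≠ 0 := by linarith
  have hq0 : q ≠ 0 := by linarith
  simp_rw [lG1_eq q (by linarith : 1 < q)]
  refine ⟨fun a b => ?_, fun x => ?_⟩
  · rcases a with _ | i <;> rcases b with _ | j <;> simp [dg, lD1, eq_comm]
  · have : ∑ a, ∑ b, x a * x b * (dg (lD1 κ q) a b - (match a, b with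
        | none, none => 1
        | none, some _ => -(1 / (q * (q - 1)))
        | some _, none => -(1 / (q * (q - 1)))
        | some i, some j => (if i = j then 1 / q else 0) - (q - 2) / (q * (q - 1) ^ 2)))
        = (1 / (q * (q - 1))) * ∑ i, (x none + x (some i)) ^ 2
          + (q - 2) / (q * (q - 1) ^ 2) * (∑ i, x (some i)) ^ 2 := by
      simp only [Fintype.sum_option, dg, lD1, Option.some.injEq, reduceCtorEq, if_false, if_true,
        zero_sub, neg_neg]
      have e5 : ∑ i : κ, (x (some i) * x none * (1 / (q * (q - 1))) +
          ∑ j : κ, x (some i) * x (some j) * ((if i = j then 1 / (q - 1) else 0) -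
            ((if i = j then 1 / q else 0) - (q - 2) / (q * (q - 1) ^ 2))))
          = (1 / (q * (q - 1))) * x none * ∑ i, x (some i) + (1 / (q * (q - 1))) * ∑ i, x (some i) ^ 2
            + (q - 2) / (q * (q - 1) ^ 2) * (∑ i, x (some i)) ^ 2 := by
        rw [sq (∑ i, x (some i)), sum_mul_sum, mul_sum, mul_sum, mul_sum, ← sum_add_distrib,
          ← sum_add_distrib]
        refine sum_congr rfl fun i _ => ?_
        have : ∀ j : κ, x (some i) * x (some j) * ((if i = j then 1 / (q - 1) else 0) -
            ((if i = j then 1 / q else 0) - (q - 2) / (q * (q - 1) ^ 2)))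
            = (if i = j then x (some i) * x (some j) * (1 / (q * (q - 1))) else 0)
              + (q - 2) / (q * (q - 1) ^ 2) * (x (some i) * x (some j)) := by
          intro j; split_ifs
          · field_simp; ring
          · ring
        simp_rw [this, sum_add_distrib, sum_ite_eq, mem_univ, if_true, mul_sum]
        ring
      rw [e5]
      have e1 : ∑ i : κ, x none * x (some i) * (1 / (q * (q - 1)))
          = (1/(q * (q - 1))) * x none * ∑ i, x (some i) := by
        rw [mul_sum]; exact sum_congr rfl fun i _ => by ring
      have e4 : ∑ i : κ, 2 * x none * x (some i) = 2 * x none * ∑ i, x (some i) := by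
        rw [mul_sum]
      simp_rw [add_sq, sum_add_distrib, sum_const, card_univ, nsmul_eq_mul]
      rw [e1, e4]
      ring
    rw [this]
    have : 0 ≤ ∑ i, (x none + x (some i)) ^ 2 := sum_nonneg fun _ _ => by positivity
    have h2 : 0 ≤ q - 2 := by linarith
    have h3 : 0 < q - 1 := by linarith
    positivity

lemma lv_tr (q : ℝ) (i : κ) (a : Option κ) : ∑ x, lv i x * lT q a x = lu q i a := by
  rw [sum_lT]
  rcases a with _ | j
  · simp [lv, lu]
  · simp only [lv, lu]; split_ifs <;> ring

lemma psd_rank1 {α : Type*} [Fintype α] (u : α → ℝ) {r : ℝ} (hr : 0 ≤ r) :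
    PSD (fun a b => r * (u a * u b)) := by
  refine ⟨fun a b => by ring, fun x => ?_⟩
  have : ∑ a, ∑ b, x a * x b * (r * (u a * u b)) = r * (∑ a, x a * u a) ^ 2 := by
    rw [sq, sum_mul_sum, mul_sum]
    refine sum_congr rfl fun a _ => ?_
    rw [mul_sum]
    exact sum_congr rfl fun b _ => by ring
  rw [this]; positivity

lemma sum_lK (q : ℝ) (m : κ) (a : Option κ) (f : Option κ → ℝ) :
    ∑ x, f x * lK q m a x = match a with
      | none => f none
      | some i => if i = m then -(f none / (q - 1)) else f (some i) := by
  rw [Fintype.sum_option]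
  cases a with
  | none => simp [lK]
  | some i =>
    simp only [lK]
    by_cases h : i = m
    · simp [h]; ring
    · simp [h]

lemma lg2_lG2 (q : ℝ) (hq : 1 < q) (m : κ) (a b : Option κ) :
    ∑ x, ∑ y, lg2 q m x y * lT q a x * lT q b y = ∑ x, ∑ y, lG2 q m x y * lK q m a x * lK q m b y := by
  have hq1 : q - 1 ≠ 0 := by linarith
  have L : ∑ x, ∑ y, lg2 q m x y * lT q a x * lT q b y =
      match b with
      | none => (match a with
        | none => 1
        | some i => (if i = m then 0 else 1 / (q - 1)) - 1 / (q - 1))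
      | some j => (match a with
        | none => (if j = m then 0 else 1 / (q - 1)) - 1 / (q - 1)
        | some i => ((if i = j ∧ i ≠ m then 1 / (q - 1) else 0) - (if i = m then 0 else 1 / (q - 1)) / (q - 1)) - ((if j = m then 0 else 1 / (q - 1)) - 1 / (q - 1)) / (q - 1)) := by
    simp_rw [sum_lT q b (fun y => lg2 q m _ y * lT q a _)]
    rcases b with _ | j
    · simp only
      rw [sum_lT q a (fun x => lg2 q m x none)]
      rcases a with _ | i <;> simp [lg2]
    · simp only
      have : ∀ x, lg2 q m x (some j) * lT q a x - lg2 q m x none * lT q a x / (q - 1)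
        = (lg2 q m x (some j) - lg2 q m x none / (q - 1)) * lT q a x := fun x => by ring
      simp_rw [this]
      rw [sum_lT q a (fun x => lg2 q m x (some j) - lg2 q m x none / (q - 1))]
      rcases a with _ | i <;> simp [lg2]
  have Rr : ∑ x, ∑ y, lG2 q m x y * lK q m a x * lK q m b y =
      match b with
      | none => (match a with
        | none => 1
        | some i => if i = m then -(1 / (q - 1)) else 0)
      | some j => (match a with
        | none => if j = m then -(1 / (q - 1)) else 0
        | some i => if j = m then (if i = m then 1 / (q - 1) ^ 2 else 0) else (if i = m then 0 else (if i = j then 1 / (q - 1) else 0) - 1 / (q - 1) ^ 2)) := by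
    simp_rw [sum_lK q m b (fun y => lG2 q m _ y * lK q m a _)]
    rcases b with _ | j
    · simp only
      rw [sum_lK q m a (fun x => lG2 q m x none)]
      rcases a with _ | i <;> simp [lG2]
    · simp only
      by_cases hj : j = m
      · simp only [hj, if_true]
        have : ∀ x, -(lG2 q m x none * lK q m a x / (q - 1))
          = (-(lG2 q m x none / (q - 1))) * lK q m a x := fun x => by ring
        simp_rw [this]
        rw [sum_lK q m a (fun x => (-(lG2 q m x none / (q - 1))))]
        rcases a with _ | i
        · simp [lG2]
        · simp only [lG2]; split_ifs <;> field_simp <;> simp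
      · simp only [hj, if_false]
        rw [sum_lK q m a (fun x => lG2 q m x (some j))]
        rcases a with _ | i
        · simp [lG2]
        · simp only [lG2, hj, or_false]; split_ifs <;> simp
  rw [L, Rr]
  rcases a with _ | i <;> rcases b with _ | j <;> simp only
  · split_ifs <;> ring
  · split_ifs <;> ring
  · split_ifs <;> simp_all <;> field_simp <;> ring

lemma psd_lD2 {q : ℝ} (hq : 1 < q) (hk : (Fintype.card κ : ℝ) ≤ q - 1) (m : κ) :
    ∀ a, 0 ≤ lD2 q m a := by
  intro a
  rcases a with _ | i
  · simp [lD2]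
  · simp only [lD2]
    have h1 : (Fintype.card κ : ℝ) / (q - 1) ≤ 1 := by rw [div_le_one (by linarith)]; exact hk
    split_ifs
    · exact le_rfl
    · exact mul_nonneg (one_div_nonneg.mpr (by linarith)) (by linarith)

lemma psd_lG2_sub {q : ℝ} (hq : 1 < q) (m : κ) :
    PSD (fun a b : Option κ => lG2 q m a b - dg (lD2 q m) a b) := by
  have hq1 : q - 1 ≠ 0 := by linarith
  refine ⟨fun a b => ?_, fun x => ?_⟩
  · rcases a with _ | i <;> rcases b with _ | j <;> simp only [dg, lD2, lG2, reduceCtorEq, if_false]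
    by_cases hij : i = j
    · subst hij; rfl
    · have hji : ¬ j = i := fun h => hij h.symm
      by_cases him : i = m <;> by_cases hjm : j = m <;> simp [hij, hji, him, hjm]
  · have : ∑ a, ∑ b, x a * x b * (lG2 q m a b - dg (lD2 q m) a b)
        = (1 / (q - 1) ^ 2) * (Fintype.card κ * (∑ i, (if i = m then 0 else x (some i)) ^ 2)
          - (∑ i, (if i = m then 0 else x (some i))) ^ 2) := by
      simp only [Fintype.sum_option, dg, lD2, lG2, Option.some.injEq, reduceCtorEq, if_false,
        if_true, sub_self, mul_zero, sum_const_zero, zero_add, sub_zero]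
      rw [sq (∑ i, (if i = m then 0 else x (some i))), sum_mul_sum, mul_sum, ← sum_sub_distrib,
        mul_sum]
      refine sum_congr rfl fun i _ => ?_
      have : ∀ j : κ, x (some i) * x (some j) * ((if i = m ∨ j = m then 0 else
          (if i = j then 1 / (q - 1) else 0) - 1 / (q - 1) ^ 2) -
          (if i = j then (if i = m then 0 else 1 / (q - 1) * (1 - Fintype.card κ / (q - 1))) else 0))
          = (if i = j then (if i = m then 0 else x (some i)) * (if i = m then 0 else x (some i)) *
            (Fintype.card κ / (q - 1) ^ 2) else 0)
            - (1 / (q - 1) ^ 2) * ((if i = m then 0 else x (some i)) * (if j = m then 0 else x (some j))) := by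
        intro j
        by_cases hij : i = j
        · subst hij
          by_cases him : i = m
          · simp [him]
          · simp [him]; field_simp; ring
        · by_cases him : i = m
          · simp [hij, him]
          · by_cases hjm : j = m
            · simp [him, hjm]
            · simp [hij, him, hjm]; ring
      simp_rw [this, sum_sub_distrib, sum_ite_eq, mem_univ, if_true, ← mul_sum]
      ring
    rw [this]
    have cs : (∑ i, (if i = m then 0 else x (some i))) ^ 2 ≤
        Fintype.card κ * (∑ i, (if i = m then 0 else x (some i)) ^ 2) := by
      have := sq_sum_le_card_mul_sum_sq (s := (univ : Finset κ)) (f := fun i => if i = m then 0 else x (some i))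
      simpa [card_univ] using this
    have : 0 ≤ Fintype.card κ * (∑ i, (if i = m then 0 else x (some i)) ^ 2)
          - (∑ i, (if i = m then 0 else x (some i))) ^ 2 := by linarith
    positivity

end Local
end GPY

namespace GPY

section Labels
variable {ι κ : Type*} [Fintype ι] [DecidableEq ι] [Fintype κ] [DecidableEq κ]

/-- elements with a given label. -/
def lab (σ : ι → Option κ) (i : κ) : Finset ι := univ.filter (fun p => σ p = some i)

@[simp] lemma mem_lab (σ : ι → Option κ) (i : κ) (p : ι) : p ∈ lab σ i ↔ σ p = some i := by
  simp [lab]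

lemma lab_inj : Function.Injective (lab : (ι → Option κ) → κ → Finset ι) := by
  intro σ τ h
  funext p
  have h2 : ∀ i, σ p = some i ↔ τ p = some i := fun i => by
    rw [← mem_lab, ← mem_lab, h]
  exact Option.ext fun i => h2 i

lemma lab_disj (σ : ι → Option κ) {i j : κ} (h : i ≠ j) : Disjoint (lab σ i) (lab σ j) := by
  rw [Finset.disjoint_left]
  intro p hp hq
  simp only [mem_lab] at hp hq
  rw [hp] at hq
  exact h (Option.some.inj hq)

lemma lab_surj (S : κ → Finset ι) (h : ∀ i j, i ≠ j → Disjoint (S i) (S j)) :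
    ∃ σ : ι → Option κ, lab σ = S := by
  classical
  refine ⟨fun p => if h : ∃ i, p ∈ S i then some h.choose else none, ?_⟩
  funext i
  ext p
  simp only [mem_lab]
  constructor
  · intro hp
    split_ifs at hp with hh
    rw [← Option.some.inj hp]
    exact hh.choose_spec
  · intro hp
    have hh : ∃ i, p ∈ S i := ⟨i, hp⟩
    rw [dif_pos hh]
    congr 1
    by_contra hne
    exact (Finset.disjoint_left.mp (h _ _ hne)) hh.choose_spec hp

lemma prod_opt (h : ι → Option κ → ℝ) (h0 : ∀ p, h p none = 1) (σ : ι → Option κ) :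
    ∏ p, h p (σ p) = ∏ i, ∏ p ∈ lab σ i, h p (some i) := by
  simp_rw [lab, prod_filter]
  rw [prod_comm]
  refine prod_congr rfl fun p _ => ?_
  cases hσ : σ p with
  | none => simp [h0]
  | some j => simp

lemma sum_lab_le (a : κ → Finset ι → ℝ) (ha : ∀ i S, 0 ≤ a i S) :
    ∑ σ : ι → Option κ, ∏ i, a i (lab σ i) ≤ ∏ i, ∑ S, a i S := by
  rw [prod_univ_sum, Fintype.piFinset_univ]
  rw [← sum_image (f := fun S : κ → Finset ι => ∏ i, a i (S i)) (g := lab) (s := univ)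
    (lab_inj.injOn)]
  exact sum_le_sum_of_subset_of_nonneg (subset_univ _)
    fun S _ _ => prod_nonneg fun i _ => ha i _

/-- product expectation with one modified factor. -/
lemma sum_pi_one (a : κ → Finset ι → ℝ) (f : Finset ι → ℝ) (i0 : κ) (ε : ℝ)
    (ha : ∀ i S, 0 ≤ a i S)
    (hf : ∑ S, a i0 S * f S ≤ ε * ∑ S, a i0 S) :
    ∑ S : κ → Finset ι, (∏ i, a i (S i)) * f (S i0) ≤ ε * ∏ i, ∑ S, a i S := by
  have h1 : ∀ S : κ → Finset ι, (∏ i, a i (S i)) * f (S i0)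
      = ∏ i, (if i = i0 then a i (S i) * f (S i) else a i (S i)) := by
    intro S
    rw [← mul_prod_erase univ _ (mem_univ i0), ← mul_prod_erase univ (fun i => if i = i0 then a i (S i) * f (S i) else a i (S i)) (mem_univ i0)]
    simp only [if_true]
    have : ∏ i ∈ univ.erase i0, (if i = i0 then a i (S i) * f (S i) else a i (S i))
        = ∏ i ∈ univ.erase i0, a i (S i) :=
      prod_congr rfl fun i hi => by rw [if_neg (ne_of_mem_erase hi)]
    rw [this]; ring
  simp_rw [h1]
  have h2 := prod_univ_sum (fun _ : κ => (univ : Finset (Finset ι)))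
    (fun i S => if i = i0 then a i S * f S else a i S)
  rw [Fintype.piFinset_univ] at h2
  rw [← h2, ← mul_prod_erase univ _ (mem_univ i0), ← mul_prod_erase univ (fun i => ∑ S, a i S) (mem_univ i0)]
  simp only [if_true]
  have : ∏ i ∈ univ.erase i0, (∑ S, if i = i0 then a i S * f S else a i S)
      = ∏ i ∈ univ.erase i0, ∑ S, a i S :=
    prod_congr rfl fun i hi => sum_congr rfl fun S _ => by rw [if_neg (ne_of_mem_erase hi)]
  rw [this, ← mul_assoc]
  exact mul_le_mul_of_nonneg_right hf (prod_nonneg fun i _ => sum_nonneg fun S _ => ha i S)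

/-- product expectation with two modified factors. -/
lemma sum_pi_two (a : κ → Finset ι → ℝ) (f g : Finset ι → ℝ) (i0 j0 : κ) (hij : i0 ≠ j0) (ε ε' : ℝ)
    (ha : ∀ i S, 0 ≤ a i S) (hg0 : ∀ S, 0 ≤ g S) (hε : 0 ≤ ε)
    (hf : ∑ S, a i0 S * f S ≤ ε * ∑ S, a i0 S)
    (hg : ∑ S, a j0 S * g S ≤ ε' * ∑ S, a j0 S) :
    ∑ S : κ → Finset ι, (∏ i, a i (S i)) * (f (S i0) * g (S j0)) ≤ ε * ε' * ∏ i, ∑ S, a i S := by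
  set a' : κ → Finset ι → ℝ := fun i S => if i = j0 then a i S * g S else a i S with ha'
  have hr : ∀ b : κ → ℝ, ∏ i, b i = b j0 * ∏ i ∈ univ.erase j0, b i := fun b =>
    (mul_prod_erase univ _ (mem_univ j0)).symm
  have h1 : ∀ S : κ → Finset ι, (∏ i, a i (S i)) * (f (S i0) * g (S j0))
      = (∏ i, a' i (S i)) * f (S i0) := by
    intro S
    rw [hr, hr (fun i => a' i (S i))]
    have : ∏ i ∈ univ.erase j0, a' i (S i) = ∏ i ∈ univ.erase j0, a i (S i) :=
      prod_congr rfl fun i hi => by simp only [ha']; rw [if_neg (ne_of_mem_erase hi)]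
    rw [this]; simp only [ha', if_true]; ring
  simp_rw [h1]
  have ha0 : ∀ i S, 0 ≤ a' i S := by
    intro i S; simp only [ha']; split_ifs
    · exact mul_nonneg (ha _ _) (hg0 _)
    · exact ha _ _
  refine (sum_pi_one a' f i0 ε ha0 (by simp only [ha', if_neg hij]; exact hf)).trans ?_
  rw [mul_assoc]
  refine mul_le_mul_of_nonneg_left ?_ hε
  rw [hr, hr (fun i => ∑ S, a i S)]
  have : ∏ i ∈ univ.erase j0, ∑ S, a' i S = ∏ i ∈ univ.erase j0, ∑ S, a i S :=
      prod_congr rfl fun i hi => sum_congr rfl fun S _ => by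
        simp only [ha']; rw [if_neg (ne_of_mem_erase hi)]
  rw [this, ← mul_assoc]
  refine mul_le_mul_of_nonneg_right ?_ (prod_nonneg fun i _ => sum_nonneg fun S _ => ha i S)
  simpa only [ha', if_true] using hg

/-- Lower bound for sums over labellings. -/
lemma sum_lab_ge (a : κ → Finset ι → ℝ) (ha : ∀ i S, 0 ≤ a i S) (v : ι → ℝ) (hv : ∀ p, 0 ≤ v p)
    (hav : ∀ i p, ∑ S, a i S * (if p ∈ S then 1 else 0) ≤ v p * ∑ S, a i S)
    (h : Finset ι → ℝ) (h0 : ∀ S, 0 ≤ h S) (ε : ℝ)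
    (hah : ∀ i, ∑ S, a i S * h S ≤ ε * ∑ S, a i S)
    (hsmall : (Fintype.card κ : ℝ) ^ 2 * ∑ p, v p ^ 2 + Fintype.card κ * ε ≤ 1 / 2)
    (H : (ι → Option κ) → ℝ) (hH0 : ∀ σ, 0 ≤ H σ) (c : ℝ) (hc : 0 ≤ c)
    (hH : ∀ σ, ∑ i, h (lab σ i) ≤ 1 → c * ∏ i, a i (lab σ i) ≤ H σ) :
    c / 2 * ∏ i, ∑ S, a i S ≤ ∑ σ, H σ := by
  classical
  -- penalised sum over all tuples
  set pen : (κ → Finset ι) → ℝ := fun S =>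
    (∑ i, ∑ j, if i = j then 0 else ∑ p, (if p ∈ S i then (1 : ℝ) else 0) * (if p ∈ S j then 1 else 0))
      + ∑ i, h (S i) with hpen
  have hpair0 : ∀ (S : κ → Finset ι) i j, 0 ≤ (if i = j then 0 else ∑ p, (if p ∈ S i then (1 : ℝ) else 0) * (if p ∈ S j then 1 else 0)) := by
    intro S i j; split_ifs
    · exact le_rfl
    · exact sum_nonneg fun p _ => by split_ifs <;> norm_num
  have key : ∀ S : κ → Finset ι, c * ((∏ i, a i (S i)) * (1 - pen S)) ≤
      ∑ σ ∈ univ.filter (fun σ : ι → Option κ => lab σ = S), H σ := by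
    intro S
    have hpa : 0 ≤ ∏ i, a i (S i) := prod_nonneg fun i _ => ha i _
    have hs0 : 0 ≤ ∑ i, h (S i) := sum_nonneg fun i _ => h0 _
    by_cases hp : 1 ≤ pen S
    · refine le_trans ?_ (sum_nonneg fun σ _ => hH0 σ)
      have : (∏ i, a i (S i)) * (1 - pen S) ≤ 0 := mul_nonpos_of_nonneg_of_nonpos hpa (by linarith)
      exact mul_nonpos_of_nonneg_of_nonpos hc this
    · rw [not_le] at hp
      have hd : ∀ i j, i ≠ j → Disjoint (S i) (S j) := by
        intro i j hij
        rw [Finset.disjoint_left]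
        intro p hpi hpj
        have h1 : (1 : ℝ) ≤ ∑ i, ∑ j, if i = j then 0 else ∑ p, (if p ∈ S i then (1 : ℝ) else 0) * (if p ∈ S j then 1 else 0) := by
          refine le_trans ?_ (single_le_sum (f := fun i => ∑ j, if i = j then 0 else ∑ p, (if p ∈ S i then (1 : ℝ) else 0) * (if p ∈ S j then 1 else 0))
            (fun i _ => sum_nonneg fun j _ => hpair0 S i j) (mem_univ i))
          refine le_trans ?_ (single_le_sum (f := fun j => if i = j then 0 else ∑ p, (if p ∈ S i then (1 : ℝ) else 0) * (if p ∈ S j then 1 else 0))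
            (fun j _ => hpair0 S i j) (mem_univ j))
          simp only [if_neg hij]
          refine le_trans ?_ (single_le_sum (f := fun p => (if p ∈ S i then (1 : ℝ) else 0) * (if p ∈ S j then 1 else 0))
            (fun p _ => by beta_reduce; split_ifs <;> norm_num) (mem_univ p))
          simp [hpi, hpj]
        simp only [hpen] at hp
        linarith
      obtain ⟨σ, hσ⟩ := lab_surj S hd
      have hp0 : 0 ≤ ∑ i, ∑ j, if i = j then 0 else ∑ p, (if p ∈ S i then (1 : ℝ) else 0) * (if p ∈ S j then 1 else 0) :=
        sum_nonneg fun i _ => sum_nonneg fun j _ => hpair0 S i j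
      have h2 : ∑ i, h (lab σ i) ≤ 1 := by
        rw [hσ]; simp only [hpen] at hp; linarith
      have h3 := hH σ h2
      refine le_trans ?_ (single_le_sum (f := H) (fun σ _ => hH0 σ) (show σ ∈ _ by simp [hσ]))
      refine le_trans ?_ h3
      rw [hσ]
      refine mul_le_mul_of_nonneg_left ?_ hc
      have : 0 ≤ pen S := by simp only [hpen]; linarith
      nlinarith
  have tot : ∑ S : κ → Finset ι, c * ((∏ i, a i (S i)) * (1 - pen S)) ≤ ∑ σ, H σ := by
    refine (sum_le_sum fun S _ => key S).trans (le_of_eq ?_)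
    exact sum_fiberwise univ (fun σ => lab σ) H
  refine le_trans ?_ tot
  rw [← mul_sum, div_mul_eq_mul_div, mul_div_assoc]
  refine mul_le_mul_of_nonneg_left ?_ hc
  set Q := ∏ i, ∑ S, a i S with hQ
  have hQ0 : 0 ≤ Q := prod_nonneg fun i _ => sum_nonneg fun S _ => ha i S
  have e1 : ∑ S : κ → Finset ι, ∏ i, a i (S i) = Q := by
    rw [hQ, prod_univ_sum, Fintype.piFinset_univ]
  have e2 : ∑ S : κ → Finset ι, (∏ i, a i (S i)) * pen S ≤ (1 / 2) * Q := by
    simp only [hpen, mul_add, sum_add_distrib, mul_sum]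
    have f1 : ∑ S : κ → Finset ι, ∑ i, (∏ i, a i (S i)) * h (S i) ≤ Fintype.card κ * ε * Q := by
      rw [sum_comm]
      refine (sum_le_sum fun i _ => sum_pi_one a h i ε ha (hah i)).trans ?_
      rw [sum_const, card_univ, nsmul_eq_mul, mul_assoc]
    have f2 : ∑ S : κ → Finset ι, ∑ i, ∑ j, (∏ i, a i (S i)) *
        (if i = j then 0 else ∑ p, (if p ∈ S i then (1 : ℝ) else 0) * (if p ∈ S j then 1 else 0))
        ≤ (Fintype.card κ : ℝ) ^ 2 * (∑ p, v p ^ 2) * Q := by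
      rw [sum_comm]
      have : ∀ i, ∑ S : κ → Finset ι, ∑ j, (∏ i, a i (S i)) *
        (if i = j then 0 else ∑ p, (if p ∈ S i then (1 : ℝ) else 0) * (if p ∈ S j then 1 else 0))
        ≤ Fintype.card κ * ((∑ p, v p ^ 2) * Q) := by
        intro i
        rw [sum_comm, ← nsmul_eq_mul, ← card_univ, ← sum_const]
        refine sum_le_sum fun j _ => ?_
        by_cases hij : i = j
        · simp only [hij, if_true, mul_zero, sum_const_zero]
          exact mul_nonneg (sum_nonneg fun p _ => sq_nonneg _) hQ0
        · simp only [if_neg hij, mul_sum]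
          rw [sum_comm, sum_mul]
          refine sum_le_sum fun p _ => ?_
          rw [sq]
          exact sum_pi_two a (fun S => if p ∈ S then 1 else 0) (fun S => if p ∈ S then 1 else 0) i j hij
            (v p) (v p) ha (fun S => by beta_reduce; split_ifs <;> norm_num) (hv p) (hav i p) (hav j p)
      refine (sum_le_sum fun i _ => this i).trans ?_
      rw [sum_const, card_univ, nsmul_eq_mul]
      apply le_of_eq; ring
    calc _ ≤ _ := add_le_add f2 f1
      _ = ((Fintype.card κ : ℝ) ^ 2 * (∑ p, v p ^ 2) + Fintype.card κ * ε) * Q := by ring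
      _ ≤ _ := mul_le_mul_of_nonneg_right hsmall hQ0
  have e3 : ∑ S : κ → Finset ι, (∏ i, a i (S i)) * (1 - pen S)
      = Q - ∑ S : κ → Finset ι, (∏ i, a i (S i)) * pen S := by
    rw [← e1, ← sum_sub_distrib]; exact sum_congr rfl fun S _ => by ring
  rw [e3]; linarith

end Labels
end GPY

namespace GPY

section Weights
variable {ι κ : Type*} [Fintype ι] [DecidableEq ι] [Fintype κ] [DecidableEq κ]

noncomputable def xs (x : ι → ℝ) (S : Finset ι) : ℝ := ∑ p ∈ S, x p
noncomputable def vs (v : ι → ℝ) (S : Finset ι) : ℝ := ∏ p ∈ S, v p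
noncomputable def gw (A t : ℝ) : ℝ := 1 / (1 + A * t)
noncomputable def tot (x : ι → ℝ) (σ : ι → Option κ) : ℝ := ∑ i, xs x (lab σ i)
noncomputable def Fw (A : ℝ) (x : ι → ℝ) (σ : ι → Option κ) : ℝ :=
  max 0 (1 - tot x σ) * ∏ i, gw A (xs x (lab σ i))
noncomputable def mu (σ : ι → Option κ) : ℝ := ∏ p, if σ p = none then 1 else -1
noncomputable def cw (A : ℝ) (x : ι → ℝ) (σ : ι → Option κ) : ℝ := mu σ * Fw A x σ

/-- one-dimensional cut-off sums. -/
noncomputable def cut (x v : ι → ℝ) (t : ℝ) (G : ℝ → ℝ) (S : Finset ι) : ℝ :=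
  if xs x S ≤ t then G (xs x S) * vs v S else 0
noncomputable def Vs (x v : ι → ℝ) (t : ℝ) (G : ℝ → ℝ) : ℝ := ∑ S, cut x v t G S

/-- multi-dimensional cut-off sum -/
noncomputable def Ys (κ : Type*) [Fintype κ] [DecidableEq κ] (x v : ι → ℝ) (t : ℝ) : ℝ :=
  ∑ σ : ι → Option κ, if tot x σ ≤ t then ∏ i, vs v (lab σ i) else 0

variable {x v : ι → ℝ} (hx : ∀ p, 0 ≤ x p) (hv : ∀ p, 0 ≤ v p)

lemma xs_nonneg (hx : ∀ p, 0 ≤ x p) (S : Finset ι) : 0 ≤ xs x S := sum_nonneg fun p _ => hx p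
lemma vs_nonneg (hv : ∀ p, 0 ≤ v p) (S : Finset ι) : 0 ≤ vs v S := prod_nonneg fun p _ => hv p
lemma tot_nonneg (hx : ∀ p, 0 ≤ x p) (σ : ι → Option κ) : 0 ≤ tot x σ :=
  sum_nonneg fun i _ => xs_nonneg hx _
lemma xs_le_tot (hx : ∀ p, 0 ≤ x p) (σ : ι → Option κ) (i : κ) : xs x (lab σ i) ≤ tot x σ :=
  single_le_sum (f := fun i => xs x (lab σ i)) (fun i _ => xs_nonneg hx _) (mem_univ i)

lemma gw_nonneg {A t : ℝ} (hA : 0 ≤ A) (ht : 0 ≤ t) : 0 ≤ gw A t := by unfold gw; positivity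
lemma gw_pos {A t : ℝ} (hA : 0 ≤ A) (ht : 0 ≤ t) : 0 < gw A t := by unfold gw; positivity
lemma gw_le_one {A t : ℝ} (hA : 0 ≤ A) (ht : 0 ≤ t) : gw A t ≤ 1 := by
  unfold gw; rw [div_le_one (by positivity)]; nlinarith [mul_nonneg hA ht]
lemma gw_anti {A t u : ℝ} (hA : 0 ≤ A) (ht : 0 ≤ t) (h : t ≤ u) : gw A u ≤ gw A t := by
  unfold gw
  exact one_div_le_one_div_of_le (by positivity) (by nlinarith)
lemma gw_lip {A t u : ℝ} (hA : 0 ≤ A) (ht : 0 ≤ t) (hu : 0 ≤ u) : gw A t - gw A (t + u) ≤ A * u := by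
  unfold gw
  have h1 : 0 < 1 + A * t := by positivity
  have h2 : 0 < 1 + A * (t + u) := by positivity
  rw [div_sub_div _ _ h1.ne' h2.ne', div_le_iff₀ (by positivity)]
  have h3 : 1 ≤ (1 + A * t) * (1 + A * (t + u)) := by
    have := mul_nonneg hA ht; have := mul_nonneg hA hu; nlinarith [mul_nonneg (mul_nonneg hA ht) (mul_nonneg hA (add_nonneg ht hu))]
  nlinarith [mul_nonneg hA hu]

lemma Fw_nonneg {A : ℝ} (hA : 0 ≤ A) (hx : ∀ p, 0 ≤ x p) (σ : ι → Option κ) : 0 ≤ Fw A x σ :=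
  mul_nonneg (le_max_left _ _) (prod_nonneg fun i _ => gw_nonneg hA (xs_nonneg hx _))

lemma prod_gw_le_one {A : ℝ} (hA : 0 ≤ A) (hx : ∀ p, 0 ≤ x p) (σ : ι → Option κ) :
    ∏ i, gw A (xs x (lab σ i)) ≤ 1 :=
  prod_le_one (fun i _ => gw_nonneg hA (xs_nonneg hx _)) fun i _ => gw_le_one hA (xs_nonneg hx _)

lemma Fw_le {A : ℝ} (hA : 0 ≤ A) (hx : ∀ p, 0 ≤ x p) (σ : ι → Option κ) :
    Fw A x σ ≤ if tot x σ ≤ 1 then ∏ i, gw A (xs x (lab σ i)) else 0 := by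
  have hp : 0 ≤ ∏ i, gw A (xs x (lab σ i)) := prod_nonneg fun i _ => gw_nonneg hA (xs_nonneg hx _)
  unfold Fw
  split_ifs with h
  · have h1 : max 0 (1 - tot x σ) ≤ 1 := max_le zero_le_one (by linarith [tot_nonneg hx σ])
    nlinarith
  · rw [max_eq_left (by linarith), zero_mul]

lemma Fw_le_ind {A : ℝ} (hA : 0 ≤ A) (hx : ∀ p, 0 ≤ x p) (σ : ι → Option κ) :
    Fw A x σ ≤ if tot x σ ≤ 1 then 1 else 0 := by
  refine (Fw_le hA hx σ).trans ?_
  split_ifs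
  · exact prod_gw_le_one hA hx σ
  · exact le_rfl

lemma mu_sq (σ : ι → Option κ) : mu σ ^ 2 = 1 := by
  unfold mu; rw [← prod_pow]; apply prod_eq_one; intro p _; split_ifs <;> norm_num

lemma abs_mu (σ : ι → Option κ) : |mu σ| = 1 := by
  have := mu_sq σ
  rw [← abs_one, ← sq_eq_sq_iff_abs_eq_abs, this, one_pow]

lemma cut_nonneg (hv : ∀ p, 0 ≤ v p) (hx : ∀ p, 0 ≤ x p) {t : ℝ} {G : ℝ → ℝ} (hG : ∀ t, 0 ≤ t → 0 ≤ G t) (S : Finset ι) :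
    0 ≤ cut x v t G S := by
  unfold cut; split_ifs
  · exact mul_nonneg (hG _ (xs_nonneg hx S)) (vs_nonneg hv S)
  · exact le_rfl

lemma Vs_nonneg (hv : ∀ p, 0 ≤ v p) (hx : ∀ p, 0 ≤ x p) {t : ℝ} {G : ℝ → ℝ} (hG : ∀ t, 0 ≤ t → 0 ≤ G t) :
    0 ≤ Vs x v t G := sum_nonneg fun S _ => cut_nonneg hv hx hG S

lemma Vs_mono_G (hv : ∀ p, 0 ≤ v p) (hx : ∀ p, 0 ≤ x p) {t : ℝ} {G H : ℝ → ℝ} (hG : ∀ t, 0 ≤ t → G t ≤ H t) :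
    Vs x v t G ≤ Vs x v t H := by
  refine sum_le_sum fun S _ => ?_
  unfold cut; split_ifs
  · exact mul_le_mul_of_nonneg_right (hG _ (xs_nonneg hx S)) (vs_nonneg hv S)
  · exact le_rfl

lemma one_le_Vs (hv : ∀ p, 0 ≤ v p) (hx : ∀ p, 0 ≤ x p) {t : ℝ} (ht : 0 ≤ t) {G : ℝ → ℝ} (hG : ∀ t, 0 ≤ t → 0 ≤ G t)
    (hG0 : G 0 = 1) : 1 ≤ Vs x v t G := by
  refine le_trans ?_ (single_le_sum (f := cut x v t G) (fun S _ => cut_nonneg hv hx hG S) (mem_univ ∅))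
  simp [cut, xs, vs, ht, hG0]

lemma one_le_Ys (hv : ∀ p, 0 ≤ v p) (hx : ∀ p, 0 ≤ x p) {t : ℝ} (ht : 0 ≤ t) : 1 ≤ Ys κ x v t := by
  refine le_trans ?_ (single_le_sum (f := fun σ : ι → Option κ => if tot x σ ≤ t then ∏ i, vs v (lab σ i) else 0)
    (fun σ _ => ?_) (mem_univ (fun _ => none)))
  · simp [tot, xs, vs, lab, ht]
  · beta_reduce; split_ifs
    · exact prod_nonneg fun i _ => vs_nonneg hv _
    · exact le_rfl

lemma Ys_le (hv : ∀ p, 0 ≤ v p) (hx : ∀ p, 0 ≤ x p) {t : ℝ} :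
    Ys κ x v t ≤ Vs x v t (fun _ => 1) ^ Fintype.card κ := by
  have := sum_lab_le (κ := κ) (fun _ => cut x v t (fun _ => 1))
    (fun i S => cut_nonneg hv hx (fun _ _ => zero_le_one) S)
  rw [prod_const, card_univ] at this
  refine le_trans ?_ this
  refine sum_le_sum fun σ _ => ?_
  split_ifs with h
  · refine le_of_eq (prod_congr rfl fun i _ => ?_)
    unfold cut; rw [if_pos ((xs_le_tot hx σ i).trans h), one_mul]
  · exact prod_nonneg fun i _ => cut_nonneg hv hx (fun _ _ => zero_le_one) _

lemma mem_sum_le {φ : Finset ι → ℝ} (hφ : ∀ S, 0 ≤ φ S) {p : ι} {vp : ℝ} (hvp : 0 ≤ vp)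
    (h : ∀ T, p ∉ T → φ (insert p T) ≤ vp * φ T) :
    ∑ S, φ S * (if p ∈ S then 1 else 0) ≤ vp * ∑ S, φ S := by
  simp only [mul_ite, mul_one, mul_zero]
  rw [← sum_filter, mul_sum]
  calc _ ≤ ∑ S ∈ univ.filter (fun S : Finset ι => p ∈ S), vp * φ (S.erase p) := by
        refine sum_le_sum fun S hS => ?_
        have hp : p ∈ S := (mem_filter.mp hS).2
        have := h (S.erase p) (notMem_erase p S)
        rwa [insert_erase hp] at this
    _ = ∑ T ∈ (univ.filter (fun S : Finset ι => p ∈ S)).image (fun S : Finset ι => S.erase p), vp * φ T := by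
        rw [sum_image]
        intro S hS T hT hST
        have h1 : p ∈ S := by simpa using hS
        have h2 : p ∈ T := by simpa using hT
        simp only at hST
        rw [← insert_erase h1, ← insert_erase h2, hST]
    _ ≤ _ := sum_le_sum_of_subset_of_nonneg (subset_univ _) fun T _ _ => mul_nonneg hvp (hφ T)

lemma cut_insert (hv : ∀ p, 0 ≤ v p) (hx : ∀ p, 0 ≤ x p) {t : ℝ} {G : ℝ → ℝ} (hG : ∀ t, 0 ≤ t → 0 ≤ G t)
    (hGa : ∀ t u, 0 ≤ t → t ≤ u → G u ≤ G t) (p : ι) (T : Finset ι) (hp : p ∉ T) :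
    cut x v t G (insert p T) ≤ v p * cut x v t G T := by
  unfold cut
  have e1 : xs x (insert p T) = x p + xs x T := sum_insert hp
  have e2 : vs v (insert p T) = v p * vs v T := prod_insert hp
  have h1 := hx p
  rw [e1, e2]
  by_cases h : x p + xs x T ≤ t
  · rw [if_pos h, if_pos (by linarith)]
    have h2 := hGa (xs x T) (x p + xs x T) (xs_nonneg hx T) (by linarith)
    have h3 := mul_nonneg (hv p) (vs_nonneg hv T)
    nlinarith
  · rw [if_neg h]
    exact mul_nonneg (hv p) (cut_nonneg hv hx hG T)

lemma cut_mem_sum (hv : ∀ p, 0 ≤ v p) (hx : ∀ p, 0 ≤ x p) {t : ℝ} {G : ℝ → ℝ} (hG : ∀ t, 0 ≤ t → 0 ≤ G t)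
    (hGa : ∀ t u, 0 ≤ t → t ≤ u → G u ≤ G t) (p : ι) :
    ∑ S, cut x v t G S * (if p ∈ S then 1 else 0) ≤ v p * ∑ S, cut x v t G S :=
  mem_sum_le (fun S => cut_nonneg hv hx hG S) (hv p) (cut_insert hv hx hG hGa p)

lemma Ys_ge (hv : ∀ p, 0 ≤ v p) (hx : ∀ p, 0 ≤ x p) {t u : ℝ} (hu : Fintype.card κ * u ≤ t)
    (hsmall : (Fintype.card κ : ℝ) ^ 2 * ∑ p, v p ^ 2 ≤ 1 / 2) :
    1 / 2 * Vs x v u (fun _ => 1) ^ Fintype.card κ ≤ Ys κ x v t := by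
  have := sum_lab_ge (κ := κ) (fun _ => cut x v u (fun _ => 1))
    (fun i S => cut_nonneg hv hx (fun _ _ => zero_le_one) S) v hv
    (fun i p => cut_mem_sum hv hx (fun _ _ => zero_le_one) (fun _ _ _ _ => le_rfl) p)
    (fun _ => 0) (fun _ => le_rfl) 0 (by simp) (by simpa using hsmall)
    (fun σ => if tot x σ ≤ t then ∏ i, vs v (lab σ i) else 0)
    (fun σ => by
      beta_reduce; split_ifs
      · exact prod_nonneg fun i _ => vs_nonneg hv _
      · exact le_rfl) 1 zero_le_one ?_
  · rwa [prod_const, card_univ] at this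
  · intro σ _
    rw [one_mul]
    by_cases hh : ∀ i, xs x (lab σ i) ≤ u
    · have : tot x σ ≤ t := by
        refine le_trans ?_ hu
        rw [← nsmul_eq_mul, ← card_univ, ← sum_const]
        exact sum_le_sum fun i _ => hh i
      rw [if_pos this]
      refine le_of_eq (prod_congr rfl fun i _ => ?_)
      unfold cut; rw [if_pos (hh i), one_mul]
    · obtain ⟨i, hi⟩ := not_forall.mp hh
      rw [prod_eq_zero (mem_univ i)]
      · split_ifs
        · exact prod_nonneg fun i _ => vs_nonneg hv _
        · exact le_rfl
      · unfold cut; rw [if_neg hi]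

/-- the Euler-type constant -/
noncomputable def PC (κ : Type*) [Fintype κ] (q : ι → ℝ) : ℝ := ∏ p, (1 + Fintype.card κ / (q p * (q p - 1)))

lemma PC_nonneg {q : ι → ℝ} (hq : ∀ p, 2 ≤ q p) : 0 ≤ PC κ q := by
  refine prod_nonneg fun p _ => ?_
  have := hq p
  have : 0 ≤ q p * (q p - 1) := by nlinarith
  positivity

lemma prod_lD1_le {q : ι → ℝ} (hq : ∀ p, 2 ≤ q p) (hvq : ∀ p, v p = 1 / (q p - 1)) (σ : ι → Option κ) :
    ∏ p, lD1 κ (q p) (σ p) ≤ PC κ q * ∏ i, vs v (lab σ i) := by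
  set h : ι → Option κ → ℝ := fun p a => match a with
    | none => 1
    | some _ => v p with hh
  have e : ∏ i, vs v (lab σ i) = ∏ p, h p (σ p) := by
    rw [prod_opt h (fun p => rfl)]; rfl
  rw [e, PC, ← prod_mul_distrib]
  refine prod_le_prod (fun p _ => ?_) fun p _ => ?_
  · have h2 := hq p
    have h3 : 0 < q p - 1 := by linarith
    have h4 : 0 < q p := by linarith
    rcases σ p with _ | i <;> simp only [lD1] <;> positivity
  · have h2 := hq p
    have h3 : 0 < q p - 1 := by linarith
    have h4 : 0 < q p := by linarith
    rcases hσ : σ p with _ | i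
    · simp [lD1, hh]
    · simp only [lD1, hh, hvq]
      refine le_mul_of_one_le_left (by positivity) ?_
      have : 0 ≤ (Fintype.card κ : ℝ) / (q p * (q p - 1)) := by positivity
      linarith

lemma S1_main {A : ℝ} (hA : 0 ≤ A) (hx : ∀ p, 0 ≤ x p) {q : ι → ℝ} (hq : ∀ p, 2 ≤ q p) (hvq : ∀ p, v p = 1 / (q p - 1)) :
    ∑ σ : ι → Option κ, cw A x σ ^ 2 * ∏ p, lD1 κ (q p) (σ p)
      ≤ PC κ q * Vs x v 1 (fun t => gw A t ^ 2) ^ Fintype.card κ := by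
  have hv : ∀ p, 0 ≤ v p := fun p => by
    rw [hvq]; have := hq p; exact one_div_nonneg.mpr (by linarith)
  have := sum_lab_le (κ := κ) (fun _ => cut x v 1 (fun t => gw A t ^ 2))
    (fun i S => cut_nonneg hv hx (fun _ _ => sq_nonneg _) S)
  rw [prod_const, card_univ] at this
  refine le_trans ?_ (mul_le_mul_of_nonneg_left this (PC_nonneg hq))
  rw [mul_sum]
  refine sum_le_sum fun σ _ => ?_
  have h1 : cw A x σ ^ 2 = Fw A x σ ^ 2 := by unfold cw; rw [mul_pow, mu_sq, one_mul]
  rw [h1]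
  have h2 := Fw_le hA hx σ
  have h3 := Fw_nonneg hA hx σ
  by_cases ht : tot x σ ≤ 1
  · rw [if_pos ht] at h2
    have h4 : Fw A x σ ^ 2 ≤ (∏ i, gw A (xs x (lab σ i))) ^ 2 := pow_le_pow_left₀ h3 h2 2
    have h5 := prod_lD1_le hq hvq σ
    calc _ ≤ (∏ i, gw A (xs x (lab σ i))) ^ 2 * (PC κ q * ∏ i, vs v (lab σ i)) :=
          mul_le_mul h4 h5 (prod_nonneg fun p _ => by
            have h2 := hq p
            have h3 : 0 < q p - 1 := by linarith
            have h4 : 0 < q p := by linarith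
            rcases σ p with _ | i <;> simp only [lD1] <;> positivity) (sq_nonneg _)
      _ = PC κ q * ∏ i, (gw A (xs x (lab σ i)) ^ 2 * vs v (lab σ i)) := by
          rw [prod_mul_distrib, prod_pow]; ring
      _ = _ := by
          congr 1
          refine prod_congr rfl fun i _ => ?_
          unfold cut; rw [if_pos ((xs_le_tot hx σ i).trans ht)]
  · rw [if_neg ht] at h2
    have : Fw A x σ = 0 := le_antisymm h2 h3
    rw [this]
    simp only [ne_eq, OfNat.ofNat_ne_zero, not_false_eq_true, zero_pow, zero_mul]
    exact mul_nonneg (PC_nonneg hq) (prod_nonneg fun i _ => cut_nonneg hv hx (fun _ _ => sq_nonneg _) _)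

end Weights
end GPY

namespace GPY

section S2
variable {ι κ : Type*} [Fintype ι] [DecidableEq ι] [Fintype κ] [DecidableEq κ]
variable {x v : ι → ℝ}

lemma one_sub_sum_le_prod (s : Finset ι) (f : ι → ℝ) (h0 : ∀ p, 0 ≤ f p) (h1 : ∀ p, f p ≤ 1) :
    1 - ∑ p ∈ s, f p ≤ ∏ p ∈ s, (1 - f p) := by
  induction s using Finset.induction_on with
  | empty => simp
  | insert a s ha ih =>
    rw [sum_insert ha, prod_insert ha]
    have h2 : ∏ p ∈ s, (1 - f p) ≤ 1 := prod_le_one (fun p _ => by linarith [h1 p]) fun p _ => by linarith [h0 p]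
    nlinarith [h0 a, h1 a]

/-- add the label `m` on `T`. -/
def extl (r : ι → Option κ) (m : κ) (T : Finset ι) (p : ι) : Option κ := if p ∈ T then some m else r p

lemma lab_extl_ne {r : ι → Option κ} {m : κ} {T : Finset ι} (hT : ∀ p ∈ T, r p = none) {i : κ} (hi : i ≠ m) :
    lab (extl r m T) i = lab r i := by
  ext p
  simp only [mem_lab, extl]
  split_ifs with h
  · simp [hT p h, hi.symm]
  · rfl

lemma lab_extl_eq {r : ι → Option κ} {m : κ} {T : Finset ι} (hm : lab r m = ∅) :
    lab (extl r m T) m = T := by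
  ext p
  simp only [mem_lab, extl]
  split_ifs with h
  · simp [h]
  · have : p ∉ lab r m := by simp [hm]
    simp only [mem_lab] at this
    simp [h, this]

noncomputable def lkk (vp : ℝ) (m : κ) : Option κ → Option κ → ℝ
  | none, none => 1
  | none, some _ => 0
  | some i, none => if i = m then vp else 0
  | some i, some j => if i = j ∧ i ≠ m then 1 else 0

lemma lkk_nonneg {vp : ℝ} (h : 0 ≤ vp) (m : κ) (a b : Option κ) : 0 ≤ lkk vp m a b := by
  rcases a with _ | i <;> rcases b with _ | j <;> simp only [lkk] <;> (try split_ifs) <;> first | exact h | norm_num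

lemma mu_tr (A : ℝ) {q : ι → ℝ} (hvq : ∀ p, v p = 1 / (q p - 1)) (m : κ) (r : ι → Option κ) :
    mu r * tr (fun p => lK (q p) m) (cw A x) r = ∑ s, Fw A x s * ∏ p, lkk (v p) m (s p) (r p) := by
  unfold tr cw
  rw [mul_sum]
  refine sum_congr rfl fun s _ => ?_
  have : ∏ p, lkk (v p) m (s p) (r p) = mu r * mu s * ∏ p, lK (q p) m (s p) (r p) := by
    unfold mu
    rw [← prod_mul_distrib, ← prod_mul_distrib]
    refine prod_congr rfl fun p _ => ?_
    rcases s p with _ | i <;> rcases r p with _ | j <;> simp [lkk, lK, hvq]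
  rw [this]; ring

lemma prod_lkk_extl (m : κ) {r : ι → Option κ} {T : Finset ι} (hm : lab r m = ∅) (hT : ∀ p ∈ T, r p = none) :
    ∏ p, lkk (v p) m (extl r m T p) (r p) = vs v T := by
  unfold vs
  have : ∀ p, lkk (v p) m (extl r m T p) (r p) = if p ∈ T then v p else 1 := by
    intro p
    unfold extl
    split_ifs with h
    · simp [hT p h, lkk]
    · have hp : p ∉ lab r m := by simp [hm]
      simp only [mem_lab] at hp
      rcases hr : r p with _ | j
      · simp [lkk]
      · have : j ≠ m := fun h => hp (by rw [hr, h])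
        simp [lkk, this]
  simp_rw [this]
  rw [prod_ite_mem, univ_inter]

lemma tr_lower {A : ℝ} (hA : 0 ≤ A) (hx : ∀ p, 0 ≤ x p) (hv : ∀ p, 0 ≤ v p) {q : ι → ℝ} (hvq : ∀ p, v p = 1 / (q p - 1))
    (m : κ) (r : ι → Option κ) (hm : lab r m = ∅)
    (h1 : ∑ i, xs x (lab r i) ≤ 1 / 4) (h2 : ∑ i, ∑ p ∈ lab r i, v p ≤ 1 / 4) :
    3 / 8 * (∏ i, gw A (xs x (lab r i))) * Vs x v (1 / 4) (gw A)
      ≤ mu r * tr (fun p => lK (q p) m) (cw A x) r := by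
  classical
  rw [mu_tr A hvq]
  set TT : Finset (Finset ι) := univ.filter (fun T => (∀ p ∈ T, r p = none) ∧ xs x T ≤ 1 / 4) with hTT
  have hG0 : ∀ t, 0 ≤ t → 0 ≤ gw A t := fun t ht => gw_nonneg hA ht
  have hGa : ∀ t u, 0 ≤ t → t ≤ u → gw A u ≤ gw A t := fun t u ht h => gw_anti hA ht h
  set Pg := ∏ i, gw A (xs x (lab r i)) with hPg
  have hPg0 : 0 ≤ Pg := prod_nonneg fun i _ => gw_nonneg hA (xs_nonneg hx _)
  -- step 1
  have st1 : ∑ T ∈ TT, 1 / 2 * Pg * cut x v (1/4) (gw A) T ≤ ∑ s, Fw A x s * ∏ p, lkk (v p) m (s p) (r p) := by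
    have hinj : Set.InjOn (fun T => extl r m T) (TT : Set (Finset ι)) := by
      intro T hT T' hT' h
      have e := congrArg (fun s => lab s m) h
      simpa only [lab_extl_eq hm] using e
    have := sum_image (f := fun s => Fw A x s * ∏ p, lkk (v p) m (s p) (r p)) hinj
    refine le_trans (le_trans ?_ this.symm.le) (sum_le_sum_of_subset_of_nonneg (subset_univ _) fun s _ _ =>
      mul_nonneg (Fw_nonneg hA hx s) (prod_nonneg fun p _ => lkk_nonneg (hv p) _ _ _))
    refine sum_le_sum fun T hT => ?_
    obtain ⟨hT1, hT2⟩ := (mem_filter.mp hT).2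
    rw [prod_lkk_extl m hm hT1]
    unfold cut
    rw [if_pos hT2]
    have hF : 1 / 2 * Pg * gw A (xs x T) ≤ Fw A x (extl r m T) := by
      unfold Fw
      have e1 : tot x (extl r m T) = tot x r + xs x T := by
        unfold tot
        rw [← add_sum_erase univ _ (mem_univ m), ← add_sum_erase univ (fun i => xs x (lab r i)) (mem_univ m),
          lab_extl_eq hm, hm]
        have : ∑ i ∈ univ.erase m, xs x (lab (extl r m T) i) = ∑ i ∈ univ.erase m, xs x (lab r i) :=
          sum_congr rfl fun i hi => by rw [lab_extl_ne hT1 (ne_of_mem_erase hi)]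
        rw [this]; simp [xs]; ring
      have e2 : ∏ i, gw A (xs x (lab (extl r m T) i)) = Pg * gw A (xs x T) := by
        rw [hPg, ← mul_prod_erase univ _ (mem_univ m), ← mul_prod_erase univ (fun i => gw A (xs x (lab r i))) (mem_univ m),
          lab_extl_eq hm, hm]
        have : ∏ i ∈ univ.erase m, gw A (xs x (lab (extl r m T) i)) = ∏ i ∈ univ.erase m, gw A (xs x (lab r i)) :=
          prod_congr rfl fun i hi => by rw [lab_extl_ne hT1 (ne_of_mem_erase hi)]
        rw [this]; simp [xs, gw]; ring
      rw [e2, e1, mul_assoc]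
      refine mul_le_mul_of_nonneg_right ?_ (mul_nonneg hPg0 (gw_nonneg hA (xs_nonneg hx T)))
      refine le_trans ?_ (le_max_right _ _)
      have : tot x r ≤ 1 / 4 := h1
      linarith
    calc _ = 1 / 2 * Pg * gw A (xs x T) * vs v T := by ring
      _ ≤ _ := mul_le_mul_of_nonneg_right hF (vs_nonneg hv T)
  refine le_trans ?_ st1
  rw [← mul_sum]
  have st2 : 3 / 4 * Vs x v (1/4) (gw A) ≤ ∑ T ∈ TT, cut x v (1/4) (gw A) T := by
    set D := univ.filter (fun p => r p ≠ none) with hD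
    have hDs : ∑ p ∈ D, v p ≤ 1 / 4 := by
      refine le_trans (le_of_eq ?_) h2
      simp_rw [lab, sum_filter]
      rw [sum_comm, hD, sum_filter]
      refine sum_congr rfl fun p _ => ?_
      rcases r p with _ | i <;> simp
    have a1 : Vs x v (1/4) (gw A) ≤ ∑ T ∈ TT, cut x v (1/4) (gw A) T
        + ∑ p ∈ D, ∑ S, cut x v (1/4) (gw A) S * (if p ∈ S then 1 else 0) := by
      unfold Vs
      rw [sum_comm, hTT, sum_filter, ← sum_add_distrib]
      refine sum_le_sum fun S _ => ?_
      have c0 := cut_nonneg hv hx (t := 1/4) hG0 S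
      have c1 : 0 ≤ ∑ p ∈ D, cut x v (1/4) (gw A) S * (if p ∈ S then 1 else 0) :=
        sum_nonneg fun p _ => mul_nonneg c0 (by split_ifs <;> norm_num)
      split_ifs with h
      · linarith
      · rw [not_and_or] at h
        rcases h with h | h
        · push Not at h
          obtain ⟨p, hp, hr⟩ := h
          have : cut x v (1/4) (gw A) S * (if p ∈ S then 1 else 0) ≤ ∑ p ∈ D, cut x v (1/4) (gw A) S * (if p ∈ S then 1 else 0) :=
            single_le_sum (f := fun p => cut x v (1/4) (gw A) S * (if p ∈ S then 1 else 0))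
              (fun p _ => mul_nonneg c0 (by split_ifs <;> norm_num)) (by simp [hD, hr])
          rw [if_pos hp, mul_one] at this
          linarith
        · have : cut x v (1/4) (gw A) S = 0 := by unfold cut; rw [if_neg h]
          rw [this] at c1 ⊢; linarith
    have a2 : ∑ p ∈ D, ∑ S, cut x v (1/4) (gw A) S * (if p ∈ S then 1 else 0) ≤ 1 / 4 * Vs x v (1/4) (gw A) := by
      refine (sum_le_sum fun p _ => cut_mem_sum hv hx hG0 hGa p).trans ?_
      rw [← sum_mul]
      exact mul_le_mul_of_nonneg_right hDs (Vs_nonneg hv hx hG0)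
    linarith
  calc _ = 1 / 2 * Pg * (3 / 4 * Vs x v (1/4) (gw A)) := by ring
    _ ≤ _ := mul_le_mul_of_nonneg_left st2 (by positivity)

lemma prod_lD2_lower (hv : ∀ p, 0 ≤ v p) {q : ι → ℝ} (hvq : ∀ p, v p = 1 / (q p - 1))
    (hk : ∀ p, Fintype.card κ * v p ≤ 1) (m : κ) (r : ι → Option κ) (hm : lab r m = ∅)
    (h2 : Fintype.card κ * ∑ i, ∑ p ∈ lab r i, v p ≤ 1 / 4) :
    3 / 4 * ∏ i, vs v (lab r i) ≤ ∏ p, lD2 (q p) m (r p) := by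
  rw [prod_opt (fun p a => lD2 (q p) m a) (fun p => rfl)]
  have e1 : ∏ i, ∏ p ∈ lab r i, lD2 (q p) m (some i)
      = (∏ i, ∏ p ∈ lab r i, (1 - Fintype.card κ * v p)) * ∏ i, vs v (lab r i) := by
    rw [← prod_mul_distrib]
    refine prod_congr rfl fun i _ => ?_
    unfold vs
    rw [← prod_mul_distrib]
    refine prod_congr rfl fun p hp => ?_
    have : i ≠ m := by
      rintro rfl; rw [hm] at hp; simp at hp
    simp only [lD2, if_neg this, hvq]; ring
  rw [e1]
  refine mul_le_mul_of_nonneg_right ?_ (prod_nonneg fun i _ => vs_nonneg hv _)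
  set h : ι → Option κ → ℝ := fun p a => match a with
    | none => 1
    | some _ => 1 - Fintype.card κ * v p with hh
  have e2 : ∏ i, ∏ p ∈ lab r i, (1 - Fintype.card κ * v p) = ∏ p, h p (r p) := by
    rw [prod_opt h (fun p => rfl)]
  have e3 : ∏ p, h p (r p) = ∏ p, (1 - (if r p = none then 0 else Fintype.card κ * v p)) := by
    refine prod_congr rfl fun p _ => ?_
    rcases r p with _ | i <;> simp [hh]
  have e4 := one_sub_sum_le_prod univ (fun p => if r p = none then 0 else Fintype.card κ * v p)
    (fun p => by
      beta_reduce; split_ifs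
      · exact le_rfl
      · exact mul_nonneg (Nat.cast_nonneg _) (hv p))
    (fun p => by
      beta_reduce; split_ifs
      · exact zero_le_one
      · exact hk p)
  rw [e2, e3]
  refine le_trans ?_ e4
  have e5 : ∑ p, (if r p = none then 0 else Fintype.card κ * v p) = Fintype.card κ * ∑ i, ∑ p ∈ lab r i, v p := by
    simp_rw [lab, sum_filter]
    rw [sum_comm, mul_sum]
    refine sum_congr rfl fun p _ => ?_
    rcases r p with _ | i <;> simp
  linarith

lemma S2_main {A : ℝ} (hA : 0 ≤ A) (hx : ∀ p, 0 ≤ x p) {q : ι → ℝ} (hq : ∀ p, 2 ≤ q p)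
    (hvq : ∀ p, v p = 1 / (q p - 1)) (hk : ∀ p, (Fintype.card κ : ℝ) ≤ q p - 1) (m : κ)
    (ε : ℝ) (hε : 0 ≤ ε) (hJ : 4 * Vs x v 1 (fun t => t * gw A t ^ 2) ≤ ε * Vs x v 1 (fun t => gw A t ^ 2))
    (hsmall : (Fintype.card κ : ℝ) ^ 2 * ∑ p, v p ^ 2 + Fintype.card κ * (ε + 4 * Fintype.card κ * ∑ p, v p ^ 2) ≤ 1 / 2) :
    1 / 20 * Vs x v (1 / 4) (gw A) ^ 2 * Vs x v 1 (fun t => gw A t ^ 2) ^ (Fintype.card κ - 1)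
      ≤ ∑ r, tr (fun p => lK (q p) m) (cw A x) r ^ 2 * ∏ p, lD2 (q p) m (r p) := by
  classical
  have hv : ∀ p, 0 ≤ v p := fun p => by
    rw [hvq]; have := hq p; exact one_div_nonneg.mpr (by linarith)
  have hkv : ∀ p, Fintype.card κ * v p ≤ 1 := fun p => by
    have h1 := hq p
    rw [hvq, mul_one_div, div_le_one (by linarith)]; exact hk p
  have hG0 : ∀ t, 0 ≤ t → 0 ≤ gw A t ^ 2 := fun t ht => sq_nonneg _
  have hGa : ∀ t u, 0 ≤ t → t ≤ u → gw A u ^ 2 ≤ gw A t ^ 2 := fun t u ht h =>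
    pow_le_pow_left₀ (gw_nonneg hA (ht.trans h)) (gw_anti hA ht h) 2
  set K : ℝ := (Fintype.card κ : ℝ) with hK
  have hK1 : 1 ≤ K := by
    have : 0 < Fintype.card κ := Fintype.card_pos_iff.mpr ⟨m⟩
    rw [hK]; exact_mod_cast this
  set a : κ → Finset ι → ℝ := fun i S => if i = m then (if S = ∅ then 1 else 0) else cut x v 1 (fun t => gw A t ^ 2) S with ha
  have ha0 : ∀ i S, 0 ≤ a i S := by
    intro i S; simp only [ha]; split_ifs
    · exact zero_le_one
    · exact le_rfl
    · exact cut_nonneg hv hx hG0 S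
  have hprod : ∏ i, ∑ S, a i S = Vs x v 1 (fun t => gw A t ^ 2) ^ (Fintype.card κ - 1) := by
    rw [← mul_prod_erase univ _ (mem_univ m)]
    have e1 : ∑ S, a m S = 1 := by simp [ha]
    have e2 : ∏ i ∈ univ.erase m, ∑ S, a i S = ∏ i ∈ univ.erase m, Vs x v 1 (fun t => gw A t ^ 2) :=
      prod_congr rfl fun i hi => by simp only [ha, if_neg (ne_of_mem_erase hi)]; rfl
    rw [e1, e2, prod_const, card_erase_of_mem (mem_univ m), card_univ, one_mul]
  have hav : ∀ i p, ∑ S, a i S * (if p ∈ S then 1 else 0) ≤ v p * ∑ S, a i S := by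
    intro i p
    by_cases hi : i = m
    · have z : ∀ S : Finset ι, a i S * (if p ∈ S then 1 else 0) = 0 := by
        intro S
        by_cases hS : S = ∅
        · simp [hS]
        · simp [ha, hi, hS]
      simp only [z, sum_const_zero]
      exact mul_nonneg (hv p) (sum_nonneg fun S _ => ha0 i S)
    · simp only [ha, if_neg hi]
      exact cut_mem_sum hv hx hG0 hGa p
  set h : Finset ι → ℝ := fun S => 4 * xs x S + 4 * K * ∑ p ∈ S, v p with hh
  have hh0 : ∀ S, 0 ≤ h S := fun S => by
    have := xs_nonneg hx S
    have h2 : 0 ≤ ∑ p ∈ S, v p := sum_nonneg fun p _ => hv p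
    have : 0 ≤ K := by linarith
    simp only [hh]; positivity
  have hsq0 : 0 ≤ ∑ p, v p ^ 2 := sum_nonneg fun p _ => sq_nonneg _
  have hah : ∀ i, ∑ S, a i S * h S ≤ (ε + 4 * K * ∑ p, v p ^ 2) * ∑ S, a i S := by
    intro i
    by_cases hi : i = m
    · simp [ha, hi, hh, xs]
      have : 0 ≤ K := by linarith
      positivity
    · have b1 : ∑ S, a i S * h S = 4 * ∑ S, a i S * xs x S + 4 * K * ∑ S, a i S * ∑ p ∈ S, v p := by
        rw [mul_sum, mul_sum, ← sum_add_distrib]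
        refine sum_congr rfl fun S _ => ?_
        simp only [hh]; ring
      have b2 : ∑ S, a i S * xs x S = Vs x v 1 (fun t => t * gw A t ^ 2) := by
        unfold Vs
        refine sum_congr rfl fun S _ => ?_
        simp only [ha, if_neg hi, cut]; split_ifs <;> ring
      have b3 : ∑ S, a i S = Vs x v 1 (fun t => gw A t ^ 2) := by
        simp only [ha, if_neg hi]; rfl
      have b4 : ∑ S, a i S * ∑ p ∈ S, v p ≤ (∑ p, v p ^ 2) * ∑ S, a i S := by
        have : ∀ S, a i S * ∑ p ∈ S, v p = ∑ p, v p * (a i S * (if p ∈ S then 1 else 0)) := by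
          intro S
          rw [mul_sum]
          simp only [mul_ite, mul_one, mul_zero]
          rw [sum_ite_mem, univ_inter]
          exact sum_congr rfl fun p _ => mul_comm _ _
        simp_rw [this]
        rw [sum_comm, sum_mul]
        refine sum_le_sum fun p _ => ?_
        rw [← mul_sum, sq, mul_assoc]
        exact mul_le_mul_of_nonneg_left (hav i p) (hv p)
      rw [b1, b2, add_mul]
      refine add_le_add (by rw [b3]; exact hJ) ?_
      rw [mul_assoc (4 * K)]
      exact mul_le_mul_of_nonneg_left b4 (by linarith)
  have hI1 : 0 ≤ Vs x v (1/4) (gw A) := Vs_nonneg hv hx fun t ht => gw_nonneg hA ht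
  have main := sum_lab_ge (κ := κ) a ha0 v hv hav h hh0 (ε + 4 * K * ∑ p, v p ^ 2) hah
    (by rw [← hK]; exact hsmall)
    (fun r => tr (fun p => lK (q p) m) (cw A x) r ^ 2 * ∏ p, lD2 (q p) m (r p))
    (fun r => mul_nonneg (sq_nonneg _) (prod_nonneg fun p _ =>
      psd_lD2 (by linarith [hq p]) (hk p) m _))
    (1 / 10 * Vs x v (1/4) (gw A) ^ 2) (by positivity) ?_
  · rw [hprod] at main
    refine le_trans (le_of_eq ?_) main
    ring
  · intro r hr
    by_cases hm : lab r m = ∅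
    swap
    · have : ∏ i, a i (lab r i) = 0 := prod_eq_zero (mem_univ m) (by simp [ha, hm])
      rw [this, mul_zero]
      exact mul_nonneg (sq_nonneg _) (prod_nonneg fun p _ => psd_lD2 (by linarith [hq p]) (hk p) m _)
    · have s1 : 4 * ∑ i, xs x (lab r i) + 4 * (K * ∑ i, ∑ p ∈ lab r i, v p) ≤ 1 := by
        refine le_trans (le_of_eq ?_) hr
        simp only [hh, sum_add_distrib, mul_sum, mul_assoc]
      have s2 : 0 ≤ ∑ i, xs x (lab r i) := sum_nonneg fun i _ => xs_nonneg hx _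
      have s3 : 0 ≤ ∑ i, ∑ p ∈ lab r i, v p := sum_nonneg fun i _ => sum_nonneg fun p _ => hv p
      have s4 : ∑ i, ∑ p ∈ lab r i, v p ≤ K * ∑ i, ∑ p ∈ lab r i, v p := le_mul_of_one_le_left s3 hK1
      have t1 := tr_lower hA hx hv hvq m r hm (by linarith) (by linarith)
      have t2 := prod_lD2_lower hv hvq hkv m r hm (by rw [← hK]; linarith)
      have hPg0 : 0 ≤ ∏ i, gw A (xs x (lab r i)) := prod_nonneg fun i _ => gw_nonneg hA (xs_nonneg hx _)
      have t3 : (3 / 8 * (∏ i, gw A (xs x (lab r i))) * Vs x v (1 / 4) (gw A)) ^ 2 ≤ tr (fun p => lK (q p) m) (cw A x) r ^ 2 := by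
        refine (pow_le_pow_left₀ (by positivity) t1 2).trans (le_of_eq ?_)
        rw [mul_pow, mu_sq, one_mul]
      have hvs0 : 0 ≤ ∏ i, vs v (lab r i) := prod_nonneg fun i _ => vs_nonneg hv _
      have t4 := mul_le_mul t3 t2 (by positivity) (sq_nonneg _)
      refine le_trans ?_ t4
      have t5 : ∏ i, a i (lab r i) ≤ (∏ i, gw A (xs x (lab r i))) ^ 2 * ∏ i, vs v (lab r i) := by
        rw [← prod_pow, ← prod_mul_distrib]
        refine prod_le_prod (fun i _ => ha0 i _) fun i _ => ?_
        by_cases hi : i = m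
        · subst hi; simp [ha, hm, gw, xs, vs]
        · simp only [ha, if_neg hi, cut]
          split_ifs
          · exact le_rfl
          · exact mul_nonneg (sq_nonneg _) (vs_nonneg hv _)
      have hsq : 0 ≤ Vs x v (1 / 4) (gw A) ^ 2 := sq_nonneg _
      have hPP : 0 ≤ (∏ i, gw A (xs x (lab r i))) ^ 2 * ∏ i, vs v (lab r i) := by positivity
      calc _ ≤ 1 / 10 * Vs x v (1/4) (gw A) ^ 2 * ((∏ i, gw A (xs x (lab r i))) ^ 2 * ∏ i, vs v (lab r i)) :=
            mul_le_mul_of_nonneg_left t5 (by positivity)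
        _ ≤ (27 / 256) * Vs x v (1/4) (gw A) ^ 2 * ((∏ i, gw A (xs x (lab r i))) ^ 2 * ∏ i, vs v (lab r i)) := by
            refine mul_le_mul_of_nonneg_right ?_ hPP
            exact mul_le_mul_of_nonneg_right (by norm_num) hsq
        _ = _ := by ring

end S2
end GPY

namespace GPY

section QF
variable {ι κ : Type*} [Fintype ι] [DecidableEq ι] [Fintype κ] [DecidableEq κ]
variable {x v q : ι → ℝ}

lemma lD1_nonneg {t : ℝ} (ht : 2 ≤ t) (a : Option κ) : 0 ≤ lD1 κ t a := by
  have h3 : 0 < t - 1 := by linarith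
  have h4 : 0 < t := by linarith
  rcases a with _ | i <;> simp only [lD1] <;> positivity

lemma S1_qf (hq : ∀ p, 2 ≤ q p) (hk : ∀ p, (Fintype.card κ : ℝ) ≤ q p) (c : (ι → Option κ) → ℝ) :
    qf (fun p => lg1 (q p)) (tr (fun p => lT (q p)) c) ≤ ∑ σ, c σ ^ 2 * ∏ p, lD1 κ (q p) (σ p) := by
  rw [qf_tr, ← qf_dg]
  refine qf_mono _ _ (fun p => ?_) (fun p => psd_lD1_sub (hq p)) c
  exact (psd_lg1 (by linarith [hq p]) (hk p)).congr

lemma S2_qf (hq : ∀ p, 2 ≤ q p) (hk : ∀ p, (Fintype.card κ : ℝ) ≤ q p - 1) (m : κ) (c : (ι → Option κ) → ℝ) :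
    ∑ r, tr (fun p => lK (q p) m) c r ^ 2 * ∏ p, lD2 (q p) m (r p)
      ≤ qf (fun p => lg2 (q p) m) (tr (fun p => lT (q p)) c) := by
  rw [qf_tr, ← qf_dg]
  have : (fun (p : ι) (a b : Option κ) => ∑ x, ∑ y, lg2 (q p) m x y * lT (q p) a x * lT (q p) b y)
      = fun p a b => ∑ x, ∑ y, lG2 (q p) m x y * lK (q p) m a x * lK (q p) m b y := by
    funext p a b
    exact lg2_lG2 (q p) (by linarith [hq p]) m a b
  rw [this, ← qf_tr]
  exact qf_mono _ _ (fun p => psd_dg (psd_lD2 (by linarith [hq p]) (hk p) m))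
    (fun p => psd_lG2_sub (by linarith [hq p]) m) _

/-- kernel for the bad set. -/
noncomputable def lgb (q : ι → ℝ) (p0 : ι) (i : κ) (p : ι) : Option κ → Option κ → ℝ :=
  if p = p0 then fun a b => (1 / q p) * (lv i a * lv i b) else lg1 (q p)

lemma bad_qf (hq : ∀ p, 2 ≤ q p) (hk : ∀ p, (Fintype.card κ : ℝ) ≤ q p) (p0 : ι) (i : κ) (c : (ι → Option κ) → ℝ) :
    qf (lgb q p0 i) (tr (fun p => lT (q p)) c) ≤
      ∑ s : ι → Option κ, if s p0 = none then
        (∑ a, lu (q p0) i a * c (Function.update s p0 a)) ^ 2 * ((1 / q p0) * ∏ p ∈ univ.erase p0, lD1 κ (q p) (s p)) else 0 := by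
  rw [qf_tr]
  set T : ι → Option κ → Option κ → ℝ := fun p a y =>
    if p = p0 then (if y = none then lu (q p) i a else 0) else (if a = y then 1 else 0) with hT
  set D3 : ι → Option κ → ℝ := fun p a =>
    if p = p0 then (if a = none then 1 / q p else 0) else lD1 κ (q p) a with hD3
  have hD3n : ∀ p a, 0 ≤ D3 p a := by
    intro p a; simp only [hD3]
    have := hq p
    split_ifs
    · exact one_div_nonneg.mpr (by linarith)
    · exact le_rfl
    · exact lD1_nonneg (hq p) a
  have e1 : ∀ p a b, (∑ y, ∑ z, dg (D3 p) y z * T p a y * T p b z) =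
      if p = p0 then (1 / q p) * (lu (q p) i a * lu (q p) i b) else dg (lD1 κ (q p)) a b := by
    intro p a b
    by_cases hp : p = p0
    · simp only [hp, hT, hD3, if_true, dg, ite_mul, zero_mul, sum_ite_eq, mem_univ]
      rw [sum_eq_single none]
      · simp; ring
      · intro y _ hy; simp [hy]
      · simp
    · simp only [hp, hT, hD3, if_false, dg]
      simp
  have step : qf (fun p a b => ∑ x, ∑ y, lgb q p0 i p x y * lT (q p) a x * lT (q p) b y) c
      ≤ qf (fun p a b => ∑ y, ∑ z, dg (D3 p) y z * T p a y * T p b z) c := by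
    refine qf_mono _ _ (fun p => ?_) (fun p => ?_) c
    · refine PSD.congr ?_
      unfold lgb
      split_ifs
      · exact psd_rank1 _ (one_div_nonneg.mpr (by linarith [hq p]))
      · exact psd_lg1 (by linarith [hq p]) (hk p)
    · simp only [e1]
      by_cases hp : p = p0
      · have : ∀ a b, ∑ x, ∑ y, lgb q p0 i p x y * lT (q p) a x * lT (q p) b y = (1 / q p) * (lu (q p) i a * lu (q p) i b) := by
          intro a b
          rw [← lv_tr, ← lv_tr, sum_mul_sum, mul_sum]
          refine sum_congr rfl fun y _ => ?_
          rw [mul_sum]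
          refine sum_congr rfl fun z _ => ?_
          simp only [lgb, if_pos hp]; ring
        simp only [this, if_pos hp, sub_self]
        exact ⟨by simp, by simp⟩
      · simp only [if_neg hp, lgb]
        exact psd_lD1_sub (hq p)
  refine step.trans ?_
  rw [← qf_tr, qf_dg]
  refine sum_le_sum fun s _ => ?_
  rw [← mul_prod_erase univ (fun p => D3 p (s p)) (mem_univ p0)]
  split_ifs with hs
  · have e2 : tr T c s = ∑ a, lu (q p0) i a * c (Function.update s p0 a) := by
      unfold tr
      have : ∀ t : ι → Option κ, ∏ p, T p (t p) (s p) = ∑ a, if t = Function.update s p0 a then lu (q p0) i a else 0 := by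
        intro t
        rw [← mul_prod_erase univ _ (mem_univ p0)]
        have e3 : T p0 (t p0) (s p0) = lu (q p0) i (t p0) := by simp [hT, hs]
        have e4 : ∏ p ∈ univ.erase p0, T p (t p) (s p) = ∏ p ∈ univ.erase p0, (if t p = s p then 1 else 0) :=
          prod_congr rfl fun p hp => by simp [hT, ne_of_mem_erase hp]
        rw [e3, e4]
        by_cases hh : ∀ p ∈ univ.erase p0, t p = s p
        · have ht : t = Function.update s p0 (t p0) := by
            funext p
            by_cases hp : p = p0
            · subst hp; simp
            · rw [Function.update_of_ne hp]; exact hh p (by simp [hp])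
          rw [prod_congr rfl fun p hp => if_pos (hh p hp), prod_const_one, mul_one]
          rw [sum_eq_single (t p0)]
          · rw [if_pos ht]
          · intro a _ ha
            rw [if_neg]
            intro h
            apply ha
            rw [h]; simp
          · simp
        · push Not at hh
          obtain ⟨p, hp, hne⟩ := hh
          rw [prod_eq_zero hp (if_neg hne), mul_zero]
          symm
          refine sum_eq_zero fun a _ => if_neg ?_
          intro h
          apply hne
          rw [h, Function.update_of_ne (ne_of_mem_erase hp)]
      simp_rw [this, mul_sum]
      rw [sum_comm]
      refine sum_congr rfl fun a _ => ?_
      simp only [mul_ite, mul_zero]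
      rw [sum_ite_eq']
      simp [mul_comm]
    rw [e2]
    have e5 : ∏ p ∈ univ.erase p0, D3 p (s p) = ∏ p ∈ univ.erase p0, lD1 κ (q p) (s p) :=
      prod_congr rfl fun p hp => by simp [hD3, ne_of_mem_erase hp]
    rw [e5]
    simp [hD3, hs]
  · simp [hD3, hs]

lemma lab_update {s : ι → Option κ} {p0 : ι} (hs : s p0 = none) (j i : κ) :
    lab (Function.update s p0 (some j)) i = if i = j then insert p0 (lab s i) else lab s i := by
  ext p
  by_cases hp : p = p0
  · subst hp
    by_cases hij : i = j
    · simp [hij]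
    · simp [hij, hs, Ne.symm hij]
  · by_cases hij : i = j
    · simp [hij, hp, Function.update_of_ne hp]
    · simp [hij, Function.update_of_ne hp]

lemma mu_update {s : ι → Option κ} {p0 : ι} (hs : s p0 = none) (j : κ) :
    mu (Function.update s p0 (some j)) = - mu s := by
  unfold mu
  rw [← mul_prod_erase univ _ (mem_univ p0), ← mul_prod_erase univ (fun p => if s p = none then (1:ℝ) else -1) (mem_univ p0)]
  have : ∏ p ∈ univ.erase p0, (if Function.update s p0 (some j) p = none then (1:ℝ) else -1)
      = ∏ p ∈ univ.erase p0, (if s p = none then (1:ℝ) else -1) :=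
    prod_congr rfl fun p hp => by rw [Function.update_of_ne (ne_of_mem_erase hp)]
  rw [this]; simp [hs]

lemma Fw_update {A : ℝ} (hA : 0 ≤ A) (hx : ∀ p, 0 ≤ x p) {s : ι → Option κ} {p0 : ι} (hs : s p0 = none) (j : κ) :
    Fw A x (Function.update s p0 (some j)) ≤ Fw A x s ∧
      Fw A x s - Fw A x (Function.update s p0 (some j)) ≤ (1 + A) * x p0 := by
  have hn : p0 ∉ lab s j := by simp [hs]
  have e0 : xs x (insert p0 (lab s j)) = xs x (lab s j) + x p0 := by
    unfold xs; rw [sum_insert hn, add_comm]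
  have et : tot x (Function.update s p0 (some j)) = tot x s + x p0 := by
    unfold tot
    rw [← add_sum_erase univ _ (mem_univ j), ← add_sum_erase univ (fun i => xs x (lab s i)) (mem_univ j)]
    have : ∑ i ∈ univ.erase j, xs x (lab (Function.update s p0 (some j)) i) = ∑ i ∈ univ.erase j, xs x (lab s i) :=
      sum_congr rfl fun i hi => by rw [lab_update hs, if_neg (ne_of_mem_erase hi)]
    rw [this, lab_update hs, if_pos rfl, e0]; ring
  set Q := ∏ i ∈ univ.erase j, gw A (xs x (lab s i)) with hQ
  have hQ0 : 0 ≤ Q := prod_nonneg fun i _ => gw_nonneg hA (xs_nonneg hx _)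
  have hQ1 : Q ≤ 1 := prod_le_one (fun i _ => gw_nonneg hA (xs_nonneg hx _)) fun i _ => gw_le_one hA (xs_nonneg hx _)
  have ep : ∏ i, gw A (xs x (lab (Function.update s p0 (some j)) i)) = gw A (xs x (lab s j) + x p0) * Q := by
    rw [← mul_prod_erase univ _ (mem_univ j)]
    have : ∏ i ∈ univ.erase j, gw A (xs x (lab (Function.update s p0 (some j)) i)) = Q :=
      prod_congr rfl fun i hi => by rw [lab_update hs, if_neg (ne_of_mem_erase hi)]
    rw [this, lab_update hs, if_pos rfl, e0]
  have ep2 : ∏ i, gw A (xs x (lab s i)) = gw A (xs x (lab s j)) * Q := by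
    rw [← mul_prod_erase univ _ (mem_univ j)]
  unfold Fw
  rw [et, ep, ep2]
  set y := xs x (lab s j) with hy
  have hy0 : 0 ≤ y := xs_nonneg hx _
  have hx0 := hx p0
  have g1 := gw_lip hA hy0 hx0
  have g2 := gw_anti hA hy0 (show y ≤ y + x p0 by linarith)
  have g3 := gw_nonneg hA (show 0 ≤ y + x p0 by linarith)
  have g4 := gw_le_one hA hy0
  have t0 := tot_nonneg hx s
  have m1 : max 0 (1 - (tot x s + x p0)) ≤ max 0 (1 - tot x s) := max_le_max le_rfl (by linarith)
  have m2 : max 0 (1 - tot x s) ≤ max 0 (1 - (tot x s + x p0)) + x p0 := by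
    refine max_le ?_ ?_
    · have := le_max_left 0 (1 - (tot x s + x p0)); linarith
    · have := le_max_right 0 (1 - (tot x s + x p0)); linarith
  have m3 : max 0 (1 - (tot x s + x p0)) ≤ 1 := max_le zero_le_one (by linarith)
  have m4 := le_max_left 0 (1 - (tot x s + x p0))
  set m := max 0 (1 - tot x s)
  set m' := max 0 (1 - (tot x s + x p0))
  set g := gw A y
  set g' := gw A (y + x p0)
  constructor
  · have := mul_le_mul_of_nonneg_right g2 hQ0
    exact mul_le_mul m1 this (mul_nonneg g3 hQ0) (m4.trans m1)
  · have k1 : (m - m') * (g * Q) ≤ x p0 := by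
      have : g * Q ≤ 1 := by nlinarith [g3.trans g2]
      have h5 : 0 ≤ m - m' := by linarith
      have h6 : 0 ≤ g * Q := mul_nonneg (g3.trans g2) hQ0
      nlinarith
    have k2 : m' * ((g - g') * Q) ≤ A * x p0 := by
      have h7 : 0 ≤ g - g' := by linarith
      have h8 : (g - g') * Q ≤ g - g' := by nlinarith
      have h9 : 0 ≤ (g - g') * Q := mul_nonneg h7 hQ0
      nlinarith
    nlinarith

lemma Bad_main {A : ℝ} (hA : 0 ≤ A) (hx : ∀ p, 0 ≤ x p) (hq : ∀ p, 2 ≤ q p) (hvq : ∀ p, v p = 1 / (q p - 1))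
    (hk : ∀ p, (Fintype.card κ : ℝ) ≤ q p) (p0 : ι) (i : κ) :
    qf (lgb q p0 i) (tr (fun p => lT (q p)) (cw A x)) ≤
      1 / q p0 * ((1 + A) * x p0 + Fintype.card κ * v p0) ^ 2 * (PC κ q * Ys κ x v 1) := by
  have hv : ∀ p, 0 ≤ v p := fun p => by
    rw [hvq]; have := hq p; exact one_div_nonneg.mpr (by linarith)
  refine (bad_qf hq hk p0 i _).trans ?_
  unfold Ys
  rw [mul_sum, mul_sum]
  refine sum_le_sum fun s _ => ?_
  have hB : 0 ≤ (1 + A) * x p0 + Fintype.card κ * v p0 := by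
    have := hx p0; have := hv p0; positivity
  have hq0 : 0 ≤ 1 / q p0 := one_div_nonneg.mpr (by linarith [hq p0])
  by_cases hs : s p0 = none
  swap
  · rw [if_neg hs]
    refine mul_nonneg (by positivity) (mul_nonneg (PC_nonneg hq) ?_)
    split_ifs
    · exact prod_nonneg fun i _ => vs_nonneg hv _
    · exact le_rfl
  rw [if_pos hs]
  have e1 : ∑ a, lu (q p0) i a * cw A x (Function.update s p0 a) =
      mu s * ((Fw A x s - Fw A x (Function.update s p0 (some i))) + v p0 * ∑ j, Fw A x (Function.update s p0 (some j))) := by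
    rw [Fintype.sum_option]
    have e2 : Function.update s p0 none = s := by rw [← hs]; exact Function.update_eq_self p0 s
    rw [e2]
    have e3 : ∀ j, lu (q p0) i (some j) * cw A x (Function.update s p0 (some j)) =
        mu s * ((if j = i then - Fw A x (Function.update s p0 (some j)) else 0) + v p0 * Fw A x (Function.update s p0 (some j))) := by
      intro j
      unfold cw
      rw [mu_update hs, hvq]
      simp only [lu]
      split_ifs <;> ring
    simp_rw [e3]
    rw [← mul_sum, sum_add_distrib, sum_ite_eq', ← mul_sum]
    simp [lu, cw]; ring
  rw [e1, mul_pow, mu_sq, one_mul]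
  by_cases ht : tot x s ≤ 1
  · rw [if_pos ht]
    have b1 := Fw_update hA hx hs
    have b2 : ∀ j, Fw A x (Function.update s p0 (some j)) ≤ 1 := fun j => by
      refine (b1 j).1.trans ((Fw_le_ind hA hx s).trans ?_); rw [if_pos ht]
    have b3 : ∑ j, Fw A x (Function.update s p0 (some j)) ≤ Fintype.card κ := by
      refine (sum_le_sum fun j _ => b2 j).trans ?_; simp
    have b4 : 0 ≤ ∑ j, Fw A x (Function.update s p0 (some j)) := sum_nonneg fun j _ => Fw_nonneg hA hx _
    have b5 : 0 ≤ (Fw A x s - Fw A x (Function.update s p0 (some i))) + v p0 * ∑ j, Fw A x (Function.update s p0 (some j)) :=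
      add_nonneg (by linarith [(b1 i).1]) (mul_nonneg (hv p0) b4)
    have b6 : (Fw A x s - Fw A x (Function.update s p0 (some i))) + v p0 * ∑ j, Fw A x (Function.update s p0 (some j))
        ≤ (1 + A) * x p0 + Fintype.card κ * v p0 := by
      have := (b1 i).2
      have := mul_le_mul_of_nonneg_left b3 (hv p0)
      linarith
    have b7 := pow_le_pow_left₀ b5 b6 2
    have b8 : ∏ p ∈ univ.erase p0, lD1 κ (q p) (s p) ≤ PC κ q * ∏ i, vs v (lab s i) := by
      refine le_trans ?_ (prod_lD1_le hq hvq s)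
      rw [← mul_prod_erase univ (fun p => lD1 κ (q p) (s p)) (mem_univ p0)]
      refine le_mul_of_one_le_left (prod_nonneg fun p _ => lD1_nonneg (hq p) _) ?_
      rw [hs]; simp only [lD1]
      have : 0 ≤ (Fintype.card κ : ℝ) / (q p0 * (q p0 - 1)) := by
        have := hq p0
        have : 0 < q p0 - 1 := by linarith
        have : 0 < q p0 := by linarith
        positivity
      linarith
    calc _ ≤ ((1 + A) * x p0 + Fintype.card κ * v p0) ^ 2 * (1 / q p0 * (PC κ q * ∏ i, vs v (lab s i))) :=
          mul_le_mul b7 (mul_le_mul_of_nonneg_left b8 hq0)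
            (mul_nonneg hq0 (prod_nonneg fun p _ => lD1_nonneg (hq p) _)) (sq_nonneg _)
      _ = _ := by ring
  · rw [if_neg ht]
    have z0 : Fw A x s = 0 := le_antisymm ((Fw_le_ind hA hx s).trans (by rw [if_neg ht])) (Fw_nonneg hA hx s)
    have z1 : ∀ j, Fw A x (Function.update s p0 (some j)) = 0 := fun j =>
      le_antisymm ((Fw_update hA hx hs j).1.trans z0.le) (Fw_nonneg hA hx _)
    simp [z0, z1]

end QF
end GPY

namespace GPY

section Pointwise
variable {ι κ : Type*} [Fintype ι] [DecidableEq ι] [Fintype κ] [DecidableEq κ]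
variable {x v : ι → ℝ}

lemma tot_eq (x : ι → ℝ) (σ : ι → Option κ) : tot x σ = ∑ p, if σ p = none then 0 else x p := by
  unfold tot xs lab
  simp_rw [sum_filter]
  rw [sum_comm]
  refine sum_congr rfl fun p _ => ?_
  cases h : σ p with
  | none => simp
  | some i => simp

lemma prod_vs_eq (v : ι → ℝ) (σ : ι → Option κ) :
    ∏ i, vs v (lab σ i) = ∏ p, if σ p = none then 1 else v p := by
  have := prod_opt (κ := κ) (fun p (a : Option κ) => if a = none then 1 else v p) (fun p => by simp) σ
  simp only [this, reduceCtorEq, if_false]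
  rfl

lemma lT_abs_le {q : ℝ} (hq : 2 ≤ q) (a b : Option κ) :
    |lT q a b| ≤ if b = none then (if a = none then 1 else 1 / (q - 1)) else (if a = b then 1 else 0) := by
  have : 0 ≤ 1 / (q - 1) := one_div_nonneg.mpr (by linarith)
  rcases a with _ | i <;> rcases b with _ | j
  · simp [lT]
  · simp [lT]
  · simp only [lT, if_true, reduceCtorEq, if_false, abs_neg]
    rw [abs_of_nonneg this]
  · simp only [lT, reduceCtorEq, if_false, Option.some.injEq]
    split_ifs <;> simp

lemma lam_bound (hx : ∀ p, 0 ≤ x p) {q : ι → ℝ} (hq : ∀ p, 2 ≤ q p) (hvq : ∀ p, v p = 1 / (q p - 1))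
    {c : (ι → Option κ) → ℝ} (hc : ∀ s, |c s| ≤ if tot x s ≤ 1 then 1 else 0) (d : ι → Option κ) :
    |tr (fun p => lT (q p)) c d| ≤ if tot x d ≤ 1 then Ys κ x v 1 else 0 := by
  have hv : ∀ p, 0 ≤ v p := fun p => by
    rw [hvq]; have := hq p; exact one_div_nonneg.mpr (by linarith)
  set F : Finset (ι → Option κ) := univ.filter (fun s => tot x s ≤ 1 ∧ ∀ p, d p ≠ none → s p = d p) with hF
  set r : (ι → Option κ) → (ι → Option κ) := fun s p => if d p = none then s p else none with hr
  set h : (ι → Option κ) → ℝ := fun σ => if tot x σ ≤ 1 then ∏ i, vs v (lab σ i) else 0 with hh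
  have h0 : ∀ σ, 0 ≤ h σ := fun σ => by
    simp only [hh]; split_ifs
    · exact prod_nonneg fun i _ => vs_nonneg hv _
    · exact le_rfl
  have key : |tr (fun p => lT (q p)) c d| ≤ ∑ s ∈ F, h (r s) := by
    unfold tr
    refine (abs_sum_le_sum_abs _ _).trans ?_
    rw [hF, sum_filter]
    refine sum_le_sum fun s _ => ?_
    rw [abs_mul, abs_prod]
    by_cases hs : tot x s ≤ 1
    · have hc' := hc s
      rw [if_pos hs] at hc'
      have hp0 : 0 ≤ ∏ p, |lT (q p) (s p) (d p)| := prod_nonneg fun p _ => abs_nonneg _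
      by_cases he : ∀ p, d p ≠ none → s p = d p
      · rw [if_pos ⟨hs, he⟩]
        have ht : tot x (r s) ≤ 1 := by
          refine le_trans ?_ hs
          rw [tot_eq, tot_eq]
          refine sum_le_sum fun p _ => ?_
          simp only [hr]
          have := hx p
          split_ifs <;> simp_all
        simp only [hh]
        rw [if_pos ht, prod_vs_eq]
        calc |c s| * ∏ p, |lT (q p) (s p) (d p)| ≤ 1 * ∏ p, |lT (q p) (s p) (d p)| :=
              mul_le_mul_of_nonneg_right hc' hp0
          _ = ∏ p, |lT (q p) (s p) (d p)| := one_mul _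
          _ ≤ _ := by
              refine prod_le_prod (fun p _ => abs_nonneg _) fun p _ => ?_
              refine (lT_abs_le (hq p) _ _).trans ?_
              simp only [hr, hvq]
              by_cases hd : d p = none
              · simp [hd]
              · simp [hd]; split_ifs <;> norm_num
      · rw [if_neg (fun hh => he hh.2)]
        push Not at he
        obtain ⟨p, hp, hp2⟩ := he
        rw [prod_eq_zero (mem_univ p), mul_zero]
        have := lT_abs_le (hq p) (s p) (d p)
        rw [if_neg hp, if_neg hp2] at this
        exact le_antisymm this (abs_nonneg _)
    · have hc' := hc s
      rw [if_neg hs] at hc'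
      have : |c s| = 0 := le_antisymm hc' (abs_nonneg _)
      rw [this, zero_mul]
      split_ifs
      · exact h0 _
      · exact le_rfl
  refine key.trans ?_
  by_cases hd : tot x d ≤ 1
  · rw [if_pos hd]
    have hinj : Set.InjOn r F := by
      intro s hs t ht hst
      simp only [hF, coe_filter, mem_univ, true_and, Set.mem_setOf_eq] at hs ht
      funext p
      by_cases hp : d p = none
      · have := congrFun hst p
        simpa [hr, hp] using this
      · rw [hs.2 p hp, ht.2 p hp]
    rw [← sum_image (f := h) hinj]
    exact sum_le_sum_of_subset_of_nonneg (subset_univ _) fun σ _ _ => h0 σ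
  · rw [if_neg hd]
    have : F = ∅ := by
      rw [hF, filter_eq_empty_iff]
      rintro s _ ⟨h1, h2⟩
      refine hd (le_trans ?_ h1)
      rw [tot_eq, tot_eq]
      refine sum_le_sum fun p _ => ?_
      have := hx p
      have := h2 p
      split_ifs <;> simp_all
    rw [this, sum_empty]

lemma count_tot_le (hx : ∀ p, 0 ≤ x p) {q : ι → ℝ} (hq : ∀ p, 2 ≤ q p) (hvq : ∀ p, v p = 1 / (q p - 1))
    {L : ℝ} (hL : 0 < L) (hxq : ∀ p, x p = Real.log (q p) / L) :
    ∑ d : ι → Option κ, (if tot x d ≤ 1 then (1:ℝ) else 0) ≤ Real.exp L * Ys κ x v 1 := by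
  unfold Ys
  rw [mul_sum]
  refine sum_le_sum fun d _ => ?_
  split_ifs with h
  · rw [prod_vs_eq]
    have h1 : Real.exp (-L) ≤ ∏ p, if d p = none then 1 else v p := by
      calc Real.exp (-L) ≤ Real.exp (- (L * tot x d)) := by
            apply Real.exp_le_exp.mpr; nlinarith
        _ = ∏ p, Real.exp (-(L * if d p = none then 0 else x p)) := by
            rw [← Real.exp_sum, tot_eq, mul_sum, sum_neg_distrib]
        _ ≤ _ := by
            refine prod_le_prod (fun p _ => (Real.exp_pos _).le) fun p _ => ?_
            have := hq p
            split_ifs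
            · simp
            · rw [hxq, mul_div_cancel₀ _ hL.ne', Real.exp_neg, Real.exp_log (by linarith), hvq, inv_eq_one_div]
              exact one_div_le_one_div_of_le (by linarith) (by linarith)
    calc (1:ℝ) = Real.exp L * Real.exp (-L) := by rw [← Real.exp_add]; simp
      _ ≤ _ := mul_le_mul_of_nonneg_left h1 (Real.exp_pos _).le
  · simp

lemma sum_lam_le (hx : ∀ p, 0 ≤ x p) {q : ι → ℝ} (hq : ∀ p, 2 ≤ q p) (hvq : ∀ p, v p = 1 / (q p - 1))
    {L : ℝ} (hL : 0 < L) (hxq : ∀ p, x p = Real.log (q p) / L)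
    {c : (ι → Option κ) → ℝ} (hc : ∀ s, |c s| ≤ if tot x s ≤ 1 then 1 else 0) :
    ∑ d, |tr (fun p => lT (q p)) c d| ≤ Real.exp L * Ys κ x v 1 ^ 2 := by
  have hv : ∀ p, 0 ≤ v p := fun p => by
    rw [hvq]; have := hq p; exact one_div_nonneg.mpr (by linarith)
  have h1 := one_le_Ys (κ := κ) hv hx (zero_le_one)
  calc ∑ d, |tr (fun p => lT (q p)) c d| ≤ ∑ d : ι → Option κ, (if tot x d ≤ 1 then (1:ℝ) else 0) * Ys κ x v 1 := by
        refine sum_le_sum fun d _ => (lam_bound hx hq hvq hc d).trans ?_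
        split_ifs <;> simp
    _ = (∑ d : ι → Option κ, (if tot x d ≤ 1 then (1:ℝ) else 0)) * Ys κ x v 1 := by rw [sum_mul]
    _ ≤ _ := by
        have := count_tot_le (κ := κ) hx hq hvq hL hxq
        nlinarith

/-- local indicator -/
noncomputable def lind (D : κ → Finset ι) (p : ι) : Option κ → ℝ
  | none => 1
  | some i => if p ∈ D i then 1 else 0

/-- value of the sieve function at a point described by the incidence `D i = {p : p ∣ n + i}`. -/
noncomputable def fval (lam : (ι → Option κ) → ℝ) (D : κ → Finset ι) : ℝ :=
  ∑ d : ι → Option κ, lam d * ∏ p, lind D p (d p)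

lemma fval_bound (hx : ∀ p, 0 ≤ x p) {q : ι → ℝ} (hq : ∀ p, 2 ≤ q p) (hvq : ∀ p, v p = 1 / (q p - 1))
    {c : (ι → Option κ) → ℝ} (hc : ∀ s, |c s| ≤ if tot x s ≤ 1 then 1 else 0) (D : κ → Finset ι) :
    |fval (tr (fun p => lT (q p)) c) D| ≤ ∏ i, (2 ^ (D i).card * Vs x v 1 (fun _ => 1)) := by
  have hv : ∀ p, 0 ≤ v p := fun p => by
    rw [hvq]; have := hq p; exact one_div_nonneg.mpr (by linarith)
  have hv1 : ∀ p, v p ≤ 1 := fun p => by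
    rw [hvq]; have := hq p; rw [div_le_one (by linarith)]; linarith
  set ψ : ι → Option κ → ℝ := fun p a => match a with
    | none => 1
    | some i => (if p ∈ D i then 1 else 0) - v p with hψ
  have e1 : fval (tr (fun p => lT (q p)) c) D = ∑ s, c s * ∏ p, ψ p (s p) := by
    unfold fval tr
    simp_rw [sum_mul]
    rw [sum_comm]
    refine sum_congr rfl fun s _ => ?_
    simp_rw [mul_assoc, ← prod_mul_distrib]
    rw [← mul_sum, ← prod_sum_pi (fun p a => lT (q p) (s p) a * lind D p a)]
    congr 1
    refine prod_congr rfl fun p _ => ?_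
    rw [Fintype.sum_option]
    cases hs : s p with
    | none => simp [lT, hψ, lind]
    | some i =>
      simp only [lT, hψ, lind, hvq, ite_mul, one_mul, zero_mul, sum_ite_eq, mem_univ, if_true]
      ring
  rw [e1]
  set a : κ → Finset ι → ℝ := fun i S => if xs x S ≤ 1 then ∏ p ∈ S, (if p ∈ D i then 1 else v p) else 0 with ha
  have ha0 : ∀ i S, 0 ≤ a i S := fun i S => by
    simp only [ha]; split_ifs
    · exact prod_nonneg fun p _ => by split_ifs; exacts [zero_le_one, hv p]
    · exact le_rfl
  calc |∑ s, c s * ∏ p, ψ p (s p)| ≤ ∑ s : ι → Option κ, ∏ i, a i (lab s i) := by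
        refine (abs_sum_le_sum_abs _ _).trans (sum_le_sum fun s _ => ?_)
        rw [abs_mul, abs_prod]
        have hc' := hc s
        split_ifs at hc' with hs
        · have e2 : ∏ i, a i (lab s i) = ∏ i, ∏ p ∈ lab s i, (if p ∈ D i then 1 else v p) := by
            refine prod_congr rfl fun i _ => ?_
            simp only [ha]
            rw [if_pos ((xs_le_tot hx s i).trans hs)]
          have e3 := prod_opt (κ := κ) (fun p a => |ψ p a|) (fun p => by simp [hψ]) s
          rw [e2]
          calc _ ≤ 1 * ∏ p, |ψ p (s p)| := mul_le_mul_of_nonneg_right hc' (prod_nonneg fun p _ => abs_nonneg _)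
            _ = ∏ i, ∏ p ∈ lab s i, |ψ p (some i)| := by rw [one_mul]; exact e3
            _ ≤ _ := by
              refine prod_le_prod (fun i _ => prod_nonneg fun p _ => abs_nonneg _) fun i _ => ?_
              refine prod_le_prod (fun p _ => abs_nonneg _) fun p _ => ?_
              simp only [hψ]
              have := hv p; have := hv1 p
              split_ifs
              · rw [abs_le]; constructor <;> linarith
              · rw [zero_sub, abs_neg, abs_of_nonneg (hv p)]
        · have : |c s| = 0 := le_antisymm hc' (abs_nonneg _)
          rw [this, zero_mul]
          exact prod_nonneg fun i _ => ha0 _ _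
    _ ≤ ∏ i, ∑ S, a i S := sum_lab_le a ha0
    _ ≤ _ := by
        refine prod_le_prod (fun i _ => sum_nonneg fun S _ => ha0 _ _) fun i _ => ?_
        have hcut : ∀ S, 0 ≤ cut x v 1 (fun _ => 1) S := fun S => cut_nonneg hv hx (fun _ _ => zero_le_one) S
        calc ∑ S, a i S ≤ ∑ S, cut x v 1 (fun _ => 1) (S \ D i) := by
              refine sum_le_sum fun S _ => ?_
              simp only [ha]
              split_ifs with hS
              · unfold cut
                have : xs x (S \ D i) ≤ 1 := le_trans (sum_le_sum_of_subset_of_nonneg sdiff_subset fun p _ _ => hx p) hS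
                rw [if_pos this, one_mul]
                unfold vs
                rw [← prod_sdiff (inter_subset_left : S ∩ D i ⊆ S), sdiff_inter_self_left]
                rw [prod_eq_one (s := S ∩ D i)]
                · rw [mul_one]
                  exact le_of_eq (prod_congr rfl fun p hp => by rw [if_neg (mem_sdiff.mp hp).2])
                · intro p hp; rw [if_pos (mem_inter.mp hp).2]
              · exact hcut _
          _ ≤ ∑ z ∈ (D i).powerset ×ˢ (univ : Finset (Finset ι)), cut x v 1 (fun _ => 1) z.2 := by
              set r : Finset ι → Finset ι × Finset ι := fun S => (S ∩ D i, S \ D i) with hr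
              have hinj : Set.InjOn r (univ : Finset (Finset ι)) := by
                intro S _ T _ h
                simp only [hr, Prod.mk.injEq] at h
                rw [← sdiff_union_inter S (D i), ← sdiff_union_inter T (D i), h.1, h.2]
              rw [← sum_image (f := fun z : Finset ι × Finset ι => cut x v 1 (fun _ => 1) z.2) hinj]
              refine sum_le_sum_of_subset_of_nonneg ?_ fun z _ _ => hcut _
              intro z hz
              obtain ⟨S, _, rfl⟩ := mem_image.mp hz
              simp only [hr, mem_product, mem_powerset, mem_univ, and_true]
              exact inter_subset_right
          _ = _ := by
              rw [sum_product]
              simp [Vs, card_powerset]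

lemma fval_empty {q : ι → ℝ} (hvq : ∀ p, v p = 1 / (q p - 1)) :
    fval (tr (fun p => lT (q p)) (fun σ : ι → Option κ => mu σ * if tot x σ ≤ 1 then 1 else 0)) (fun _ => ∅) = Ys κ x v 1 := by
  unfold fval
  rw [sum_eq_single (fun _ => none)]
  · simp only [lind, prod_const_one, mul_one]
    unfold tr Ys mu
    refine sum_congr rfl fun s _ => ?_
    rw [prod_vs_eq, mul_right_comm, ← prod_mul_distrib]
    split_ifs
    · rw [mul_one]
      refine prod_congr rfl fun p _ => ?_
      cases s p <;> simp [lT, hvq]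
    · simp
  · intro d _ hd
    obtain ⟨p, hp⟩ := Function.ne_iff.mp hd
    rw [prod_eq_zero (mem_univ p), mul_zero]
    cases h : d p
    · exact absurd h hp
    · simp [lind]
  · simp
end Pointwise
end GPY

namespace GPY

section Counting
variable {P U : Finset ℕ}

/-- the incidence sets `{p ∈ P : p ∣ n + u}`. -/
def Dn (P : Finset ℕ) (U : Finset ℕ) (n : ℕ) (u : U) : Finset P :=
  univ.filter (fun p : P => (p : ℕ) ∣ n + (u : ℕ))

/-- constraint satisfaction -/
def sat (C : P → Finset U) (n : ℕ) : Prop := ∀ p : P, ∀ u ∈ C p, (p : ℕ) ∣ n + (u : ℕ)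

instance (C : P → Finset U) (n : ℕ) : Decidable (sat C n) := by unfold sat; infer_instance

lemma dvd_add_iff_modEq {p : ℕ} (hp : 0 < p) (n u : ℕ) : p ∣ n + u ↔ n ≡ (p - 1) * u [MOD p] := by
  obtain ⟨k, rfl⟩ : ∃ k, p = k + 1 := ⟨p - 1, by omega⟩
  simp only [Nat.add_sub_cancel]
  have h1 : k * u + u ≡ 0 [MOD (k+1)] := (Nat.modEq_zero_iff_dvd).mpr ⟨u, by ring⟩
  constructor
  · intro h
    have h2 : n + u ≡ 0 [MOD (k+1)] := (Nat.modEq_zero_iff_dvd).mpr h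
    exact Nat.ModEq.add_right_cancel' u (h2.trans h1.symm)
  · intro h
    exact (Nat.modEq_zero_iff_dvd).mp ((h.add_right u).trans h1)

lemma crt (hP : ∀ p ∈ P, p.Prime) (W b : ℕ) (hPW : ∀ p ∈ P, Nat.Coprime W p) (C : P → Finset U)
    (hC : ∀ p, (C p).card ≤ 1) (S : Finset P) :
    ∃ r, ∀ n, (n ≡ b [MOD W] ∧ ∀ p ∈ S, ∀ u ∈ C p, (p : ℕ) ∣ n + (u : ℕ)) ↔
      n ≡ r [MOD W * ∏ p ∈ S.filter (fun p => C p ≠ ∅), (p : ℕ)] := by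
  induction S using Finset.induction_on with
  | empty => exact ⟨b, fun n => by simp⟩
  | insert p S hp ih =>
    obtain ⟨r, hr⟩ := ih
    by_cases h : C p = ∅
    · refine ⟨r, fun n => ?_⟩
      rw [filter_insert, if_neg (by simpa using h), ← hr]
      refine and_congr_right fun _ => ?_
      simp only [mem_insert, forall_eq_or_imp, h, notMem_empty, false_imp_iff, implies_true, true_and]
    · obtain ⟨u, hu⟩ := card_eq_one.mp (le_antisymm (hC p) (card_pos.mpr (nonempty_iff_ne_empty.mpr h)))
      have hpp := hP p p.2
      have hcop : Nat.Coprime (W * ∏ p ∈ S.filter (fun p => C p ≠ ∅), (p : ℕ)) p := by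
        refine Nat.Coprime.mul_left (hPW p p.2) (Nat.Coprime.prod_left fun x hx => ?_)
        refine (Nat.coprime_primes (hP x x.2) hpp).mpr ?_
        intro hxp
        have : x = p := Subtype.ext hxp
        subst this
        exact hp (mem_filter.mp hx).1
      obtain ⟨k, hk1, hk2⟩ := Nat.chineseRemainder hcop r ((p - 1) * u)
      refine ⟨k, fun n => ?_⟩
      rw [filter_insert, if_pos (by simpa using h), prod_insert (by simp [hp]), mul_left_comm, mul_comm (p : ℕ),
        ← Nat.modEq_and_modEq_iff_modEq_mul hcop]
      have e1 : n ≡ k [MOD W * ∏ p ∈ S.filter (fun p => C p ≠ ∅), (p : ℕ)] ↔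
          n ≡ r [MOD W * ∏ p ∈ S.filter (fun p => C p ≠ ∅), (p : ℕ)] :=
        ⟨fun h => h.trans hk1, fun h => h.trans hk1.symm⟩
      have e2 : n ≡ k [MOD (p:ℕ)] ↔ (p:ℕ) ∣ n + (u:ℕ) := by
        rw [dvd_add_iff_modEq hpp.pos]
        exact ⟨fun h => h.trans hk2, fun h => h.trans hk2.symm⟩
      rw [e1, e2, ← hr]
      simp only [mem_insert, forall_eq_or_imp, hu, mem_singleton, forall_eq]
      tauto

lemma ap_count (N M : ℕ) {q : ℕ} (hq : 0 < q) (r : ℕ) :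
    |((#{n ∈ Ioc N (N + M) | n ≡ r [MOD q]} : ℕ) : ℝ) - M / q| ≤ 1 := by
  have h := Nat.Ioc_filter_modEq_card N (N + M) hq r
  have hq' : (0:ℝ) < q := by exact_mod_cast hq
  set X : ℚ := ((N + M : ℕ) - (r : ℚ)) / q with hX
  set Y : ℚ := (N - (r : ℚ)) / q with hY
  have hXY : X - Y = M / q := by rw [hX, hY]; push_cast; ring
  have hYX : Y ≤ X := by
    have : (0:ℚ) ≤ M / q := by positivity
    linarith
  rw [max_eq_left (by linarith [Int.floor_le_floor hYX])] at h
  have h' : ((#{n ∈ Ioc N (N + M) | n ≡ r [MOD q]} : ℕ) : ℚ) = (⌊X⌋ : ℚ) - ⌊Y⌋ := by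
    exact_mod_cast congrArg (Int.cast : ℤ → ℚ) h
  have h2 : |((#{n ∈ Ioc N (N + M) | n ≡ r [MOD q]} : ℕ) : ℚ) - M / q| ≤ 1 := by
    rw [h', ← hXY, abs_le]
    have := Int.floor_le X; have := Int.lt_floor_add_one X
    have := Int.floor_le Y; have := Int.lt_floor_add_one Y
    constructor <;> linarith
  have h3 : ((|((#{n ∈ Ioc N (N + M) | n ≡ r [MOD q]} : ℕ) : ℚ) - M / q| : ℚ) : ℝ) ≤ ((1:ℚ) : ℝ) := by
    exact_mod_cast h2
  push_cast at h3
  exact h3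

/-- local density -/
noncomputable def ld {κ : Type*} (p : ℝ) (c : Finset κ) : ℝ :=
  if c.card = 0 then 1 else if c.card = 1 then 1 / p else 0

lemma sat_card (hinj : ∀ p ∈ P, ∀ u ∈ U, ∀ u' ∈ U, u ≡ u' [MOD p] → u = u') {C : P → Finset U} {n : ℕ}
    (h : sat C n) (p : P) : (C p).card ≤ 1 := by
  rw [card_le_one]
  intro a ha b hb
  have h1 := (Nat.modEq_zero_iff_dvd).mpr (h p a ha)
  have h2 := (Nat.modEq_zero_iff_dvd).mpr (h p b hb)
  exact Subtype.ext (hinj p p.2 a a.2 b b.2 (Nat.ModEq.add_left_cancel' n (h1.trans h2.symm)))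

lemma sat_count (hP : ∀ p ∈ P, p.Prime) {W : ℕ} (hW : 0 < W) (b : ℕ) (hPW : ∀ p ∈ P, Nat.Coprime W p)
    (hinj : ∀ p ∈ P, ∀ u ∈ U, ∀ u' ∈ U, u ≡ u' [MOD p] → u = u') (C : P → Finset U) (N M : ℕ) :
    |((#{n ∈ Ioc N (N + M) | n ≡ b [MOD W] ∧ sat C n} : ℕ) : ℝ) - M / W * ∏ p : P, ld (p:ℝ) (C p)| ≤ 1 := by
  by_cases hC : ∀ p, (C p).card ≤ 1
  · obtain ⟨r, hr⟩ := crt hP W b hPW C hC univ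
    have e1 : {n ∈ Ioc N (N + M) | n ≡ b [MOD W] ∧ sat C n} =
        {n ∈ Ioc N (N + M) | n ≡ r [MOD W * ∏ p ∈ univ.filter (fun p => C p ≠ ∅), (p : ℕ)]} := by
      refine filter_congr fun n _ => ?_
      rw [← hr]
      simp [sat]
    rw [e1]
    have hpos : 0 < W * ∏ p ∈ univ.filter (fun p => C p ≠ ∅), (p : ℕ) :=
      Nat.mul_pos hW (prod_pos fun p _ => (hP p p.2).pos)
    have := ap_count N M hpos r
    convert this using 3
    have : ∏ p : P, ld (p:ℝ) (C p) = ∏ p ∈ univ.filter (fun p => C p ≠ ∅), (1 / (p:ℝ)) := by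
      rw [prod_filter]
      refine prod_congr rfl fun p _ => ?_
      unfold ld
      by_cases h : C p = ∅
      · simp [h]
      · have h0 : (C p).card ≠ 0 := by simpa using h
        have h1 : (C p).card = 1 := by have := hC p; omega
        rw [if_neg h0, if_pos h1, if_pos h]
    rw [this]
    push_cast
    rw [prod_div_distrib, prod_const_one, div_mul_div_comm, mul_one]
  · push Not at hC
    obtain ⟨p, hp⟩ := hC
    have e1 : {n ∈ Ioc N (N + M) | n ≡ b [MOD W] ∧ sat C n} = ∅ := by
      rw [filter_eq_empty_iff]
      rintro n _ ⟨_, h⟩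
      have := sat_card hinj h p
      omega
    rw [e1, prod_eq_zero (mem_univ p)]
    · simp
    · unfold ld; rw [if_neg (by omega), if_neg (by omega)]

/-- constraint set of a pair. -/
def cset {κ : Type*} [DecidableEq κ] (a b : Option κ) : Finset κ := a.toFinset ∪ b.toFinset

lemma ind_mul (n : ℕ) (d e : P → Option U) :
    (∏ p, lind (Dn P U n) p (d p)) *
    (∏ p, lind (Dn P U n) p (e p)) =
    if sat (fun p => cset (d p) (e p)) n then 1 else 0 := by
  rw [← prod_mul_distrib]
  split_ifs with h
  · refine prod_eq_one fun p _ => ?_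
    have := h p
    cases hd : d p <;> cases he : e p <;> simp [hd, he, cset, Dn, lind] at this ⊢ <;> simp [this]
  · unfold sat at h
    push Not at h
    obtain ⟨p, u, hu, hn⟩ := h
    refine prod_eq_zero (mem_univ p) ?_
    simp only [cset, mem_union, Option.mem_toFinset, Option.mem_def] at hu
    rcases hu with hu | hu
    · simp [hu, Dn, hn, lind]
    · simp [hu, Dn, hn, lind]

lemma fval_sq (lam : (P → Option U) → ℝ) (n : ℕ) :
    fval lam (Dn P U n) ^ 2 = ∑ d, ∑ e, lam d * lam e * if sat (fun p => cset (d p) (e p)) n then 1 else 0 := by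
  unfold fval
  rw [sq, sum_mul_sum]
  refine sum_congr rfl fun d _ => sum_congr rfl fun e _ => ?_
  rw [← ind_mul]; ring

/-- extra-constrained second moment -/
lemma moment_le (hP : ∀ p ∈ P, p.Prime) {W : ℕ} (hW : 0 < W) (b : ℕ) (hPW : ∀ p ∈ P, Nat.Coprime W p)
    (hinj : ∀ p ∈ P, ∀ u ∈ U, ∀ u' ∈ U, u ≡ u' [MOD p] → u = u') (E : P → Finset U) (N M : ℕ)
    (lam : (P → Option U) → ℝ) :
    ∑ n ∈ Ioc N (N + M) with (n ≡ b [MOD W] ∧ sat E n), fval lam (Dn P U n) ^ 2 ≤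
      M / W * qf (fun (p : P) a b => ld (p:ℝ) (cset a b ∪ E p)) lam + (∑ d, |lam d|) ^ 2 := by
  have e1 : ∑ n ∈ Ioc N (N + M) with (n ≡ b [MOD W] ∧ sat E n), fval lam (Dn P U n) ^ 2 =
      ∑ d, ∑ e, lam d * lam e * ((#{n ∈ Ioc N (N + M) | n ≡ b [MOD W] ∧
        sat (fun p => cset (d p) (e p) ∪ E p) n} : ℕ) : ℝ) := by
    simp_rw [fval_sq]
    rw [sum_comm]
    refine sum_congr rfl fun d _ => ?_
    rw [sum_comm]
    refine sum_congr rfl fun e _ => ?_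
    rw [← mul_sum]
    congr 1
    rw [sum_boole, filter_filter]
    congr 2
    refine filter_congr fun n _ => ?_
    simp only [sat, mem_union]
    constructor
    · rintro ⟨⟨h1, h2⟩, h3⟩
      exact ⟨h1, fun p u hu => hu.elim (h3 p u) (h2 p u)⟩
    · rintro ⟨h1, h2⟩
      exact ⟨⟨h1, fun p u hu => h2 p u (Or.inr hu)⟩, fun p u hu => h2 p u (Or.inl hu)⟩
  rw [e1]
  unfold qf
  rw [sq, sum_mul_sum, mul_sum, ← sum_add_distrib]
  refine sum_le_sum fun d _ => ?_
  rw [mul_sum, ← sum_add_distrib]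
  refine sum_le_sum fun e _ => ?_
  have := sat_count hP hW b hPW hinj (fun p => cset (d p) (e p) ∪ E p) N M
  set X : ℝ := ((#{n ∈ Ioc N (N + M) | n ≡ b [MOD W] ∧ sat (fun p => cset (d p) (e p) ∪ E p) n} : ℕ) : ℝ)
  set Y := ∏ p : P, ld (p:ℝ) (cset (d p) (e p) ∪ E p)
  have h2 : lam d * lam e * (X - M / W * Y) ≤ |lam d| * |lam e| := by
    refine (le_abs_self _).trans ?_
    rw [abs_mul, abs_mul]
    have := mul_nonneg (abs_nonneg (lam d)) (abs_nonneg (lam e))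
    nlinarith
  linarith

lemma ld_lg1 {κ : Type*} [DecidableEq κ] (p : ℝ) (a b : Option κ) : ld p (cset a b) = lg1 p a b := by
  cases a with
  | none => cases b <;> simp [cset, ld, lg1]
  | some i => cases b with
    | none => simp [cset, ld, lg1]
    | some j =>
      simp only [cset, ld, lg1, Option.toFinset_some]
      by_cases h : i = j
      · simp [h]
      · have : #({i} ∪ {j} : Finset κ) = 2 := card_pair h
        simp [this, h]

lemma ld_lv {κ : Type*} [DecidableEq κ] (p : ℝ) (i : κ) (a b : Option κ) :
    ld p (cset a b ∪ {i}) = 1 / p * (lv i a * lv i b) := by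
  have key : ld p (cset a b ∪ {i}) = if cset a b ⊆ {i} then 1 / p else 0 := by
    unfold ld
    have h1 : (cset a b ∪ {i}).card ≠ 0 := by
      simp
    rw [if_neg h1]
    by_cases h : cset a b ⊆ {i}
    · rw [if_pos h, union_eq_right.mpr h, card_singleton, if_pos rfl]
    · rw [if_neg h, if_neg]
      intro h2
      obtain ⟨j, hj⟩ := card_eq_one.mp h2
      have : i ∈ ({j} : Finset κ) := by rw [← hj]; simp
      rw [mem_singleton] at this
      subst this
      exact h (by rw [← hj]; exact subset_union_left)
  rw [key]
  have e : (cset a b ⊆ {i}) ↔ (∀ j, a = some j → j = i) ∧ (∀ j, b = some j → j = i) := by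
    unfold cset
    rw [union_subset_iff]
    simp only [subset_iff, Option.mem_toFinset, Option.mem_def, mem_singleton]
  simp only [e]
  cases a <;> cases b <;> simp [lv, ite_and]
  split_ifs <;> simp

lemma moment_S1 (hP : ∀ p ∈ P, p.Prime) {W : ℕ} (hW : 0 < W) (b : ℕ) (hPW : ∀ p ∈ P, Nat.Coprime W p)
    (hinj : ∀ p ∈ P, ∀ u ∈ U, ∀ u' ∈ U, u ≡ u' [MOD p] → u = u') (N M : ℕ) (lam : (P → Option U) → ℝ) :
    ∑ n ∈ Ioc N (N + M) with (n ≡ b [MOD W]), fval lam (Dn P U n) ^ 2 ≤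
      M / W * qf (fun (p : P) => lg1 (p:ℝ)) lam + (∑ d, |lam d|) ^ 2 := by
  have := moment_le hP hW b hPW hinj (fun _ => ∅) N M lam
  simpa [sat, ld_lg1] using this

lemma moment_bad (hP : ∀ p ∈ P, p.Prime) {W : ℕ} (hW : 0 < W) (b : ℕ) (hPW : ∀ p ∈ P, Nat.Coprime W p)
    (hinj : ∀ p ∈ P, ∀ u ∈ U, ∀ u' ∈ U, u ≡ u' [MOD p] → u = u') (N M : ℕ) (lam : (P → Option U) → ℝ)
    (p0 : P) (i : U) :
    ∑ n ∈ Ioc N (N + M) with (n ≡ b [MOD W] ∧ (p0:ℕ) ∣ n + (i:ℕ)), fval lam (Dn P U n) ^ 2 ≤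
      M / W * qf (lgb (fun p : P => (p:ℝ)) p0 i) lam + (∑ d, |lam d|) ^ 2 := by
  have := moment_le hP hW b hPW hinj (fun p => if p = p0 then {i} else ∅) N M lam
  have e1 : ∀ n, sat (fun p : P => if p = p0 then {i} else ∅) n ↔ (p0:ℕ) ∣ n + (i:ℕ) := by
    intro n
    constructor
    · intro h; exact h p0 i (by simp)
    · intro h p u hu
      by_cases hp : p = p0
      · subst hp; simp at hu; subst hu; exact h
      · simp [hp] at hu
  have e2 : (fun (p : P) (a b : Option U) => ld (p:ℝ) (cset a b ∪ if p = p0 then {i} else ∅)) =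
      lgb (fun p : P => (p:ℝ)) p0 i := by
    funext p a b
    unfold lgb
    by_cases hp : p = p0
    · simp only [hp, if_true]; rw [ld_lv]
    · simp only [hp, if_false, union_empty]; rw [ld_lg1]
  rw [e2] at this
  simp_rw [e1] at this
  exact this
end Counting
end GPY

namespace GPY

section CountingPrimes
variable {P U : Finset ℕ}

lemma lg2_eq {κ : Type*} [DecidableEq κ] (q : ℝ) (m : κ) (a b : Option κ) :
    lg2 q m a b = if m ∈ cset a b then 0 else ld (q - 1) (cset a b) := by
  rw [ld_lg1]
  cases a with
  | none => cases b with
    | none => simp [cset, lg2, lg1]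
    | some j => simp only [cset, lg2, lg1]; simp [eq_comm]
  | some i => cases b with
    | none => simp only [cset, lg2, lg1]; simp [eq_comm]
    | some j =>
      simp only [cset, lg2, lg1]
      by_cases h : i = j
      · subst h; simp [eq_comm]
      · simp [h]

lemma primeSumAP_eq (X q a : ℕ) : primeSumAP X q a = ∑ l ∈ range (X + 1) with (l ≡ a [MOD q]), theta l := by
  unfold primeSumAP theta
  rw [← sum_filter, filter_filter]
  refine sum_congr ?_ fun _ _ => rfl
  refine filter_congr fun l _ => ?_
  exact and_comm

lemma sum_theta_ap (N M m q r : ℕ) :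
    ∑ n ∈ Ioc N (N + M) with (n ≡ r [MOD q]), theta (n + m) =
      primeSumAP (N + M + m) q (r + m) - primeSumAP (N + m) q (r + m) := by
  rw [primeSumAP_eq, primeSumAP_eq, eq_sub_iff_add_eq]
  have e1 : ∑ n ∈ Ioc N (N + M) with (n ≡ r [MOD q]), theta (n + m) =
      ∑ l ∈ Ioc (N + m) (N + M + m) with (l ≡ r + m [MOD q]), theta l := by
    refine sum_bij (fun n _ => n + m) ?_ ?_ ?_ ?_
    · intro n hn
      simp only [mem_filter, mem_Ioc] at hn ⊢
      exact ⟨by omega, hn.2.add_right m⟩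
    · intro a _ b _ h; simpa using h
    · intro l hl
      simp only [mem_filter, mem_Ioc] at hl
      refine ⟨l - m, ?_, by omega⟩
      simp only [mem_filter, mem_Ioc]
      refine ⟨by omega, Nat.ModEq.add_right_cancel' m ?_⟩
      rw [Nat.sub_add_cancel (by omega)]; exact hl.2
    · intro n _; rfl
  rw [e1, ← sum_union]
  · refine sum_congr ?_ fun _ _ => rfl
    rw [← filter_union]
    congr 1
    ext l; simp only [mem_union, mem_Ioc, mem_range]; omega
  · refine disjoint_filter_filter ?_
    rw [disjoint_left]; intro l; simp only [mem_Ioc, mem_range]; omega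

/-- joint support -/
def supp {ι κ : Type*} [Fintype ι] [DecidableEq κ] (d e : ι → Option κ) : Finset ι :=
  univ.filter (fun p => cset (d p) (e p) ≠ ∅)

lemma supp_none {ι κ : Type*} [Fintype ι] [DecidableEq κ] {d e : ι → Option κ} {p : ι} (h : p ∉ supp d e) :
    d p = none ∧ e p = none := by
  unfold supp cset at h
  rw [mem_filter, not_and, not_not] at h
  have := h (mem_univ p)
  rw [union_eq_empty] at this
  constructor
  · cases hd : d p with
    | none => rfl
    | some i => have := this.1; rw [hd] at this; simp at this
  · cases hd : e p with
    | none => rfl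
    | some i => have := this.2; rw [hd] at this; simp at this

lemma theta_nonneg (n : ℕ) : 0 ≤ theta n := by
  unfold theta; split_ifs
  · exact Real.log_natCast_nonneg n
  · exact le_rfl

lemma theta_count (hP : ∀ p ∈ P, p.Prime) {W : ℕ} (hW : 0 < W) (b : ℕ) (hPW : ∀ p ∈ P, Nat.Coprime W p)
    (hinj : ∀ p ∈ P, ∀ u ∈ U, ∀ u' ∈ U, u ≡ u' [MOD p] → u = u') (m : U) (hbm : Nat.Coprime (b + m) W)
    (N M : ℕ) (hPN : ∀ p ∈ P, p ≤ N) (E : ℕ → ℕ → ℝ) (hE0 : ∀ X q, 0 ≤ E X q)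
    (hE : ∀ X q a, 0 < q → Nat.Coprime a q → |primeSumAP X q a - X / Nat.totient q| ≤ E X q)
    (d e : P → Option U) :
    |∑ n ∈ Ioc N (N + M) with (n ≡ b [MOD W] ∧ sat (fun p => cset (d p) (e p)) n), theta (n + m) -
      M / Nat.totient W * ∏ p : P, lg2 (p:ℝ) m (d p) (e p)| ≤
      E (N + M + m) (W * ∏ p ∈ supp d e, (p:ℕ)) + E (N + m) (W * ∏ p ∈ supp d e, (p:ℕ)) := by
  set C : P → Finset U := fun p => cset (d p) (e p) with hCdef
  by_cases hC : (∀ p, (C p).card ≤ 1) ∧ ∀ p, m ∉ C p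
  · obtain ⟨hC1, hC2⟩ := hC
    obtain ⟨r, hr⟩ := crt hP W b hPW C hC1 univ
    set q := W * ∏ p ∈ univ.filter (fun p => C p ≠ ∅), (p : ℕ) with hq
    have hqs : q = W * ∏ p ∈ supp d e, (p:ℕ) := rfl
    have hpos : 0 < q := Nat.mul_pos hW (prod_pos fun p _ => (hP p p.2).pos)
    have e1 : {n ∈ Ioc N (N + M) | n ≡ b [MOD W] ∧ sat C n} =
        {n ∈ Ioc N (N + M) | n ≡ r [MOD q]} := by
      refine filter_congr fun n _ => ?_
      rw [← hr]
      simp [sat]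
    obtain ⟨hr1, hr2⟩ := (hr r).mpr rfl
    have hcop : Nat.Coprime (r + m) q := by
      refine Nat.Coprime.mul_right ?_ (Nat.Coprime.prod_right fun p hp => ?_)
      · have h1 : r + m ≡ b + m [MOD W] := hr1.add_right _
        have h2 := h1.gcd_eq
        unfold Nat.Coprime at *
        rw [h2, hbm]
      · rw [Nat.coprime_comm, (hP p p.2).coprime_iff_not_dvd]
        intro hdvd
        obtain ⟨u, hu⟩ := nonempty_iff_ne_empty.mpr (mem_filter.mp hp).2
        have h1 := (Nat.modEq_zero_iff_dvd).mpr (hr2 p (mem_univ p) u hu)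
        have h2 := (Nat.modEq_zero_iff_dvd).mpr hdvd
        have : u = m := Subtype.ext (hinj p p.2 u u.2 m m.2 (Nat.ModEq.add_left_cancel' r (h1.trans h2.symm)))
        subst this
        exact hC2 p hu
    rw [e1, sum_theta_ap]
    have hφ : (Nat.totient q : ℝ) = Nat.totient W * ∏ p ∈ univ.filter (fun p => C p ≠ ∅), ((p:ℝ) - 1) := by
      rw [hq, Nat.totient_mul (Nat.Coprime.prod_right (ι := P) fun p _ => hPW p p.2)]
      push_cast
      congr 1
      have : ∀ S : Finset P, ((Nat.totient (∏ p ∈ S, (p:ℕ)) : ℕ) : ℝ) = ∏ p ∈ S, ((p:ℝ) - 1) := by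
        intro S
        induction S using Finset.induction_on with
        | empty => simp
        | insert p S hp ih =>
          rw [prod_insert hp, prod_insert hp, Nat.totient_mul, Nat.totient_prime (hP p p.2)]
          · rw [← ih]; push_cast [Nat.cast_sub (hP p p.2).one_lt.le]; ring
          · refine Nat.Coprime.prod_right fun x hx => (Nat.coprime_primes (hP p p.2) (hP x x.2)).mpr ?_
            intro h
            have : p = x := Subtype.ext h
            subst this; exact hp hx
      exact this _
    have e2 : ∏ p : P, lg2 (p:ℝ) m (d p) (e p) = ∏ p ∈ univ.filter (fun p => C p ≠ ∅), (1 / ((p:ℝ) - 1)) := by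
      rw [prod_filter]
      refine prod_congr rfl fun p _ => ?_
      rw [lg2_eq, if_neg (hC2 p)]
      unfold ld
      by_cases h : C p = ∅
      · have h0 : #(cset (d p) (e p)) = 0 := by simpa [hCdef] using h
        rw [if_pos h0, if_neg (by simpa using h)]
      · have h0 : #(cset (d p) (e p)) ≠ 0 := by simpa [hCdef] using h
        have h1 : #(cset (d p) (e p)) = 1 := by have : #(cset (d p) (e p)) ≤ 1 := hC1 p; omega
        rw [if_neg h0, if_pos h1, if_pos h]
    have e3 : (M:ℝ) / Nat.totient W * ∏ p : P, lg2 (p:ℝ) m (d p) (e p) =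
        ((N + M + m : ℕ) : ℝ) / Nat.totient q - ((N + m : ℕ) : ℝ) / Nat.totient q := by
      rw [e2, hφ, prod_div_distrib, prod_const_one, div_mul_div_comm, mul_one]
      push_cast; ring
    rw [e3, ← hqs]
    have h1 := hE (N + M + m) q (r + m) hpos hcop
    have h2 := hE (N + m) q (r + m) hpos hcop
    rw [abs_le] at *
    constructor <;> linarith [h1.1, h1.2, h2.1, h2.2]
  · have e1 : ∑ n ∈ Ioc N (N + M) with (n ≡ b [MOD W] ∧ sat C n), theta (n + m) = 0 := by
      refine sum_eq_zero fun n hn => ?_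
      simp only [mem_filter, mem_Ioc] at hn
      obtain ⟨hn1, hn2, hn3⟩ := hn
      have : ¬ ∀ p, m ∉ C p := fun h => hC ⟨sat_card hinj hn3, h⟩
      push Not at this
      obtain ⟨p, hp⟩ := this
      have hdvd := hn3 p m hp
      unfold theta
      rw [if_neg]
      intro hpr
      have := (Nat.prime_dvd_prime_iff_eq (hP p p.2) hpr).mp hdvd
      have := hPN p p.2
      omega
    have e2 : ∏ p : P, lg2 (p:ℝ) m (d p) (e p) = 0 := by
      rw [not_and_or] at hC
      rcases hC with hC | hC
      · push Not at hC
        obtain ⟨p, hp⟩ := hC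
        refine prod_eq_zero (mem_univ p) ?_
        have hp' : 1 < #(cset (d p) (e p)) := hp
        rw [lg2_eq]; unfold ld; rw [if_neg (show ¬ #(cset (d p) (e p)) = 0 by omega), if_neg (show ¬ #(cset (d p) (e p)) = 1 by omega)]; simp
      · push Not at hC
        obtain ⟨p, hp⟩ := hC
        refine prod_eq_zero (mem_univ p) ?_
        rw [lg2_eq, if_pos hp]
    rw [e1, e2, mul_zero, sub_zero, abs_zero]
    exact add_nonneg (hE0 _ _) (hE0 _ _)

lemma moment_S2 (hP : ∀ p ∈ P, p.Prime) {W : ℕ} (hW : 0 < W) (b : ℕ) (hPW : ∀ p ∈ P, Nat.Coprime W p)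
    (hinj : ∀ p ∈ P, ∀ u ∈ U, ∀ u' ∈ U, u ≡ u' [MOD p] → u = u') (m : U) (hbm : Nat.Coprime (b + m) W)
    (N M : ℕ) (hPN : ∀ p ∈ P, p ≤ N) (E : ℕ → ℕ → ℝ) (hE0 : ∀ X q, 0 ≤ E X q)
    (hE : ∀ X q a, 0 < q → Nat.Coprime a q → |primeSumAP X q a - X / Nat.totient q| ≤ E X q)
    (lam : (P → Option U) → ℝ) :
    M / Nat.totient W * qf (fun (p : P) => lg2 (p:ℝ) m) lam
      - ∑ d, ∑ e, |lam d| * |lam e| * (E (N + M + m) (W * ∏ p ∈ supp d e, (p:ℕ)) + E (N + m) (W * ∏ p ∈ supp d e, (p:ℕ)))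
      ≤ ∑ n ∈ Ioc N (N + M) with (n ≡ b [MOD W]), theta (n + m) * fval lam (Dn P U n) ^ 2 := by
  have e1 : ∑ n ∈ Ioc N (N + M) with (n ≡ b [MOD W]), theta (n + m) * fval lam (Dn P U n) ^ 2 =
      ∑ d, ∑ e, lam d * lam e * ∑ n ∈ Ioc N (N + M) with (n ≡ b [MOD W] ∧ sat (fun p => cset (d p) (e p)) n), theta (n + m) := by
    simp_rw [fval_sq, mul_sum]
    rw [sum_comm]
    refine sum_congr rfl fun d _ => ?_
    rw [sum_comm]
    refine sum_congr rfl fun e _ => ?_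
    rw [← filter_filter, sum_filter (p := fun n => sat (fun p => cset (d p) (e p)) n)]
    refine sum_congr rfl fun n _ => ?_
    split_ifs <;> ring
  rw [e1]
  unfold qf
  rw [mul_sum, ← sum_sub_distrib]
  refine sum_le_sum fun d _ => ?_
  rw [mul_sum, ← sum_sub_distrib]
  refine sum_le_sum fun e _ => ?_
  have := theta_count hP hW b hPW hinj m hbm N M hPN E hE0 hE d e
  set X := ∑ n ∈ Ioc N (N + M) with (n ≡ b [MOD W] ∧ sat (fun p => cset (d p) (e p)) n), theta (n + m)
  set Z := E (N + M + m) (W * ∏ p ∈ supp d e, (p:ℕ)) + E (N + m) (W * ∏ p ∈ supp d e, (p:ℕ))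
  set Y := ∏ p : P, lg2 (p:ℝ) m (d p) (e p)
  have h2 : -(|lam d| * |lam e| * Z) ≤ lam d * lam e * (X - M / Nat.totient W * Y) := by
    have h3 : |lam d * lam e * (X - M / Nat.totient W * Y)| ≤ |lam d| * |lam e| * Z := by
      rw [abs_mul, abs_mul]
      exact mul_le_mul_of_nonneg_left this (mul_nonneg (abs_nonneg _) (abs_nonneg _))
    exact (abs_le.mp h3).1
  linarith
end CountingPrimes

section ErrSum
variable {ι κ : Type*} [Fintype ι] [DecidableEq ι] [Fintype κ] [DecidableEq κ]
variable {x v : ι → ℝ}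

lemma cut_two_pow (hv : ∀ p, 0 ≤ v p) (hx : ∀ p, 0 ≤ x p) (t : ℝ) (j : ℕ) :
    ∑ S, cut x v t (fun _ => 1) S * ((2:ℝ) ^ j) ^ S.card ≤ Vs x v t (fun _ => 1) ^ (2 ^ j) := by
  have hcut : ∀ S, 0 ≤ cut x v t (fun _ => 1) S := fun S => cut_nonneg hv hx (fun _ _ => zero_le_one) S
  induction j with
  | zero => simp [Vs]
  | succ j ih =>
    set g : Finset ι → ℝ := fun S => cut x v t (fun _ => 1) S * ((2:ℝ) ^ j) ^ S.card with hg
    have hg0 : ∀ S, 0 ≤ g S := fun S => mul_nonneg (hcut S) (by positivity)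
    have h1 : ∑ S, cut x v t (fun _ => 1) S * ((2:ℝ) ^ (j+1)) ^ S.card ≤ (∑ S, g S) ^ 2 := by
      rw [sq, sum_mul_sum]
      rw [← sum_product' (f := fun A B => g A * g B)]
      calc _ ≤ ∑ S : Finset ι, ∑ A ∈ S.powerset, g A * g (S \ A) := by
            refine sum_le_sum fun S _ => ?_
            have : ((2:ℝ) ^ (j+1)) ^ S.card = ∑ A ∈ S.powerset, ((2:ℝ) ^ j) ^ S.card := by
              rw [sum_const, card_powerset, nsmul_eq_mul, pow_succ, mul_pow]; push_cast; ring
            rw [this, mul_sum]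
            refine sum_le_sum fun A hA => ?_
            have hA := mem_powerset.mp hA
            simp only [hg]
            by_cases hS : xs x S ≤ t
            · have h1 : xs x A ≤ t := le_trans (sum_le_sum_of_subset_of_nonneg hA fun p _ _ => hx p) hS
              have h2 : xs x (S \ A) ≤ t := le_trans (sum_le_sum_of_subset_of_nonneg sdiff_subset fun p _ _ => hx p) hS
              unfold cut
              rw [if_pos hS, if_pos h1, if_pos h2]
              have e1 : vs v S = vs v A * vs v (S \ A) := by
                unfold vs; rw [mul_comm, prod_sdiff hA]
              have e2 : S.card = A.card + (S \ A).card := by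
                rw [add_comm, card_sdiff_add_card_eq_card hA]
              rw [e1, e2, pow_add]
              exact le_of_eq (by ring)
            · have : cut x v t (fun _ => 1) S = 0 := by unfold cut; rw [if_neg hS]
              rw [this, zero_mul]
              exact mul_nonneg (hg0 _) (hg0 _)
        _ = ∑ z ∈ (univ : Finset (Finset ι)).sigma (fun S => S.powerset), g z.2 * g (z.1 \ z.2) := by
            rw [sum_sigma]
        _ ≤ _ := by
            set r : (Σ _ : Finset ι, Finset ι) → Finset ι × Finset ι := fun z => (z.2, z.1 \ z.2) with hr
            have hinj : Set.InjOn r ((univ : Finset (Finset ι)).sigma (fun S => S.powerset) : Finset (Σ _ : Finset ι, Finset ι)) := by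
              rintro ⟨S, A⟩ h1 ⟨T, B⟩ h2 h
              simp only [coe_sigma, Set.mem_sigma_iff, mem_coe, mem_univ, mem_powerset, true_and] at h1 h2
              simp only [hr, Prod.mk.injEq] at h
              obtain ⟨h3, h4⟩ := h
              subst h3
              have : S = T := by rw [← sdiff_union_of_subset h1, ← sdiff_union_of_subset h2, h4]
              subst this; rfl
            rw [← sum_image (f := fun z : Finset ι × Finset ι => g z.1 * g z.2) hinj]
            exact sum_le_sum_of_subset_of_nonneg (fun _ _ => by simp) fun z _ _ => mul_nonneg (hg0 _) (hg0 _)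
    refine h1.trans ?_
    rw [pow_succ 2 j, pow_mul]
    exact pow_le_pow_left₀ (sum_nonneg fun S _ => hg0 S) ih 2

lemma err_sum (hv : ∀ p, 0 ≤ v p) (hx : ∀ p, 0 ≤ x p) {lam : (ι → Option κ) → ℝ} {Y : ℝ} (hY : 0 ≤ Y)
    (hlam : ∀ d, |lam d| ≤ if tot x d ≤ 1 then Y else 0) (F : Finset ι → ℝ) (hF0 : ∀ S, 0 ≤ F S)
    {Z T : ℝ} (hT : 0 < T) (hZ : 0 ≤ Z) (hFZ : ∀ S, xs x S ≤ 2 → F S ≤ Z * vs v S) {j : ℕ} (hj : ((Fintype.card κ + 1) ^ 4 : ℝ) ≤ 2 ^ j) :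
    ∑ d, ∑ e, |lam d| * |lam e| * F (supp d e) ≤
      Y ^ 2 * (T * (∑ S with xs x S ≤ 2, F S) + Z / T * Vs x v 2 (fun _ => 1) ^ (2 ^ j)) := by
  set k1 : ℝ := (Fintype.card κ : ℝ) + 1 with hk1
  have hk0 : 0 ≤ k1 := by positivity
  have hsupp : ∀ d e : ι → Option κ, tot x d ≤ 1 → tot x e ≤ 1 → xs x (supp d e) ≤ 2 := by
    intro d e hd he
    have : xs x (supp d e) ≤ tot x d + tot x e := by
      unfold xs supp
      rw [tot_eq, tot_eq, ← sum_add_distrib, sum_filter]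
      refine sum_le_sum fun p _ => ?_
      have := hx p
      cases h1 : d p <;> cases h2 : e p <;> simp [cset] <;> linarith
    linarith
  have step1 : ∑ d, ∑ e, |lam d| * |lam e| * F (supp d e) ≤
      Y ^ 2 * ∑ S with xs x S ≤ 2, (k1 ^ 2) ^ S.card * F S := by
    have h1 : ∑ d, ∑ e, |lam d| * |lam e| * F (supp d e) ≤
        ∑ d : ι → Option κ, ∑ e : ι → Option κ, Y ^ 2 * ∑ S with xs x S ≤ 2, if supp d e = S then F S else 0 := by
      refine sum_le_sum fun d _ => sum_le_sum fun e _ => ?_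
      have hd := hlam d
      have he := hlam e
      have hnn : 0 ≤ ∑ S with xs x S ≤ 2, if supp d e = S then F S else 0 :=
        sum_nonneg fun S _ => by split_ifs; exacts [hF0 S, le_rfl]
      by_cases h1 : tot x d ≤ 1
      · by_cases h2 : tot x e ≤ 1
        · rw [if_pos h1] at hd
          rw [if_pos h2] at he
          rw [sum_ite_eq, if_pos (by simpa using hsupp d e h1 h2), sq]
          exact mul_le_mul_of_nonneg_right (mul_le_mul hd he (abs_nonneg _) hY) (hF0 _)
        · rw [if_neg h2] at he
          have : |lam e| = 0 := le_antisymm he (abs_nonneg _)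
          rw [this, mul_zero, zero_mul]; positivity
      · rw [if_neg h1] at hd
        have : |lam d| = 0 := le_antisymm hd (abs_nonneg _)
        rw [this, zero_mul, zero_mul]; positivity
    refine h1.trans ?_
    simp_rw [← mul_sum]
    refine mul_le_mul_of_nonneg_left ?_ (sq_nonneg Y)
    have e1 : ∑ d : ι → Option κ, ∑ e : ι → Option κ, ∑ S with xs x S ≤ 2, (if supp d e = S then F S else 0)
        = ∑ S with xs x S ≤ 2, ∑ d : ι → Option κ, ∑ e : ι → Option κ, (if supp d e = S then F S else 0) := by
      rw [sum_comm (s := univ.filter _)]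
      refine sum_congr rfl fun d _ => ?_
      rw [sum_comm]
    rw [e1]
    refine sum_le_sum fun S _ => ?_
    set G := Fintype.piFinset (fun p : ι => if p ∈ S then (univ : Finset (Option κ)) else {none}) with hG
    have hGc : (G.card : ℝ) = k1 ^ S.card := by
      rw [hG, Fintype.card_piFinset]
      push_cast
      have : ∀ p : ι, ((#(if p ∈ S then (univ : Finset (Option κ)) else {none}) : ℕ) : ℝ) = if p ∈ S then k1 else 1 := by
        intro p; split_ifs <;> simp [hk1]
      simp_rw [this]
      rw [prod_ite_mem, univ_inter, prod_const]
    calc ∑ d : ι → Option κ, ∑ e : ι → Option κ, (if supp d e = S then F S else 0)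
        ≤ ∑ d : ι → Option κ, ∑ e : ι → Option κ, (if d ∈ G then (1:ℝ) else 0) * ((if e ∈ G then 1 else 0) * F S) := by
          refine sum_le_sum fun d _ => sum_le_sum fun e _ => ?_
          split_ifs with h h1 h2 h2 <;> first | simp [hF0 S] | skip
          all_goals
            exfalso
            subst h
          · refine h2 ?_
            rw [hG, Fintype.mem_piFinset]
            intro p
            split_ifs with hp
            · simp
            · simpa using (supp_none hp).2
          · refine h1 ?_
            rw [hG, Fintype.mem_piFinset]
            intro p
            split_ifs with hp
            · simp
            · simpa using (supp_none hp).1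
          · refine h1 ?_
            rw [hG, Fintype.mem_piFinset]
            intro p
            split_ifs with hp
            · simp
            · simpa using (supp_none hp).1
      _ = (G.card : ℝ) * (G.card * F S) := by
          simp_rw [← mul_sum, ← sum_mul]
          rw [sum_boole, filter_mem_eq_inter, univ_inter]
      _ = _ := by rw [hGc, ← pow_mul, mul_comm 2, pow_mul]; ring
      _ ≤ _ := le_rfl
  refine step1.trans (mul_le_mul_of_nonneg_left ?_ (sq_nonneg Y))
  have step2 : ∑ S with xs x S ≤ 2, (k1 ^ 2) ^ S.card * F S ≤
      ∑ S with xs x S ≤ 2, (T * F S + Z / T * (vs v S * ((2:ℝ) ^ j) ^ S.card)) := by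
    refine sum_le_sum fun S hS => ?_
    have hS := (mem_filter.mp hS).2
    set m := (k1 ^ 2) ^ S.card with hm
    have hm0 : 0 ≤ m := by positivity
    have hm2 : m ^ 2 ≤ ((2:ℝ) ^ j) ^ S.card := by
      rw [hm, ← pow_mul, mul_comm, pow_mul]
      refine pow_le_pow_left₀ (by positivity) ?_ _
      calc (k1 ^ 2) ^ 2 = k1 ^ 4 := by ring
        _ ≤ _ := hj
    have hvS := vs_nonneg hv S
    have hF := hF0 S
    have hF2 := hFZ S hS
    have hrest : 0 ≤ Z / T * (vs v S * ((2:ℝ) ^ j) ^ S.card) := by positivity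
    by_cases hmT : m ≤ T
    · nlinarith
    · push Not at hmT
      have h1 : m ≤ m ^ 2 / T := by rw [le_div_iff₀ hT]; nlinarith
      have h2 : m * F S ≤ (m ^ 2 / T) * (Z * vs v S) :=
        mul_le_mul h1 hF2 hF (by positivity)
      have h3 : (m ^ 2 / T) * (Z * vs v S) ≤ (((2:ℝ) ^ j) ^ S.card / T) * (Z * vs v S) := by
        gcongr
      have h4 : (((2:ℝ) ^ j) ^ S.card / T) * (Z * vs v S) = Z / T * (vs v S * ((2:ℝ) ^ j) ^ S.card) := by ring
      have : 0 ≤ T * F S := by positivity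
      linarith
  refine step2.trans ?_
  rw [sum_add_distrib, ← mul_sum, ← mul_sum]
  have h5 := cut_two_pow (v := v) hv hx 2 j
  have e5 : ∑ S with xs x S ≤ 2, vs v S * ((2:ℝ) ^ j) ^ S.card = ∑ S, cut x v 2 (fun _ => 1) S * ((2:ℝ) ^ j) ^ S.card := by
    rw [sum_filter]
    refine sum_congr rfl fun S _ => ?_
    unfold cut; split_ifs <;> simp
  rw [e5]
  have : 0 ≤ Z / T := by positivity
  nlinarith
end ErrSum
end GPY

namespace GPY

lemma primeSumAP_mod (X q a : ℕ) : primeSumAP X q (a % q) = primeSumAP X q a := by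
  unfold primeSumAP; simp

lemma exists_argmax (X : ℕ) : ∃ a : ℕ → ℕ, (∀ q, Nat.Coprime (a q) q) ∧ ∀ q, 0 < q → ∀ b, Nat.Coprime b q →
    |primeSumAP X q b - X / Nat.totient q| ≤ |primeSumAP X q (a q) - X / Nat.totient q| := by
  have : ∀ q : ℕ, ∃ a : ℕ, Nat.Coprime a q ∧ (0 < q → ∀ b, Nat.Coprime b q →
      |primeSumAP X q b - X / Nat.totient q| ≤ |primeSumAP X q a - X / Nat.totient q|) := by
    intro q
    rcases Nat.eq_zero_or_pos q with rfl | hq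
    · exact ⟨1, by simp, fun h => absurd h (lt_irrefl _)⟩
    · have hmod : ∀ b, Nat.Coprime b q → Nat.Coprime (b % q) q := fun b hb => by
        unfold Nat.Coprime at *
        rw [(Nat.mod_modEq b q).gcd_eq, hb]
      obtain ⟨a, ha, h⟩ := exists_max_image ((range q).filter (fun a => Nat.Coprime a q))
        (fun a => |primeSumAP X q a - X / Nat.totient q|)
        ⟨1 % q, by simp only [mem_filter, mem_range]; exact ⟨Nat.mod_lt _ hq, hmod 1 (Nat.coprime_one_left q)⟩⟩
      refine ⟨a, (mem_filter.mp ha).2, fun _ b hb => ?_⟩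
      have := h (b % q) (by simp only [mem_filter, mem_range]; exact ⟨Nat.mod_lt _ hq, hmod b hb⟩)
      rw [primeSumAP_mod] at this
      exact this
  choose a h1 h2 using this
  exact ⟨a, h1, h2⟩

noncomputable def aE (X : ℕ) : ℕ → ℕ := (exists_argmax X).choose
noncomputable def EE (X q : ℕ) : ℝ := |primeSumAP X q (aE X q) - X / Nat.totient q|

lemma aE_coprime (X q : ℕ) : Nat.Coprime (aE X q) q := (exists_argmax X).choose_spec.1 q
lemma EE_nonneg (X q : ℕ) : 0 ≤ EE X q := abs_nonneg _
lemma EE_bound (X q a : ℕ) (hq : 0 < q) (ha : Nat.Coprime a q) :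
    |primeSumAP X q a - X / Nat.totient q| ≤ EE X q := (exists_argmax X).choose_spec.2 q hq a ha

lemma EE_level {ϑ : ℝ} (h : HasLevelOfDistribution ϑ) (hϑ : 1/2 < ϑ) (B : ℝ) (hB : 0 < B) :
    ∃ C : ℝ, 0 < C ∧ ∀ X : ℕ, 2 ≤ X →
      ∑ q ∈ Icc 1 ⌊(X:ℝ) ^ (1/2:ℝ)⌋₊, EE X q ≤ C * X / (Real.log X) ^ B := by
  obtain ⟨C, hC, h2⟩ := h B hB (ϑ - 1/2) (by linarith)
  refine ⟨C, hC, fun X hX => ?_⟩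
  have := h2 X hX (aE X) (aE_coprime X)
  rw [sub_sub_cancel] at this
  exact this

lemma EE_triv (X q : ℕ) (hq : 0 < q) (hqX : q ≤ X) (hX : 3 ≤ X) :
    EE X q ≤ 3 * X * Real.log X / Nat.totient q := by
  have hlog : 1 ≤ Real.log X := by
    rw [Real.le_log_iff_exp_le (by positivity)]
    have : (3:ℝ) ≤ X := by exact_mod_cast hX
    linarith [Real.exp_one_lt_d9]
  have hφ : 0 < Nat.totient q := Nat.totient_pos.mpr hq
  have hφ' : (0:ℝ) < Nat.totient q := by exact_mod_cast hφ
  have hq' : (0:ℝ) < q := by exact_mod_cast hq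
  have hφq : (Nat.totient q : ℝ) ≤ q := by exact_mod_cast Nat.totient_le q
  have hqX' : (q:ℝ) ≤ X := by exact_mod_cast hqX
  have hX0 : (0:ℝ) < X := by linarith
  have h1 : primeSumAP X q (aE X q) ≤ Real.log X * (X / q + 1) := by
    rw [primeSumAP_eq]
    calc _ ≤ ∑ l ∈ Ioc 0 (0 + X) with (l ≡ aE X q [MOD q]), Real.log X := by
          have e : ∑ l ∈ range (X+1) with (l ≡ aE X q [MOD q]), theta l = ∑ l ∈ Ioc 0 (0 + X) with (l ≡ aE X q [MOD q]), theta l := by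
            symm
            refine sum_subset ?_ ?_
            · intro l; simp only [mem_filter, mem_Ioc, mem_range]; rintro ⟨h1, h2⟩; exact ⟨by omega, h2⟩
            · intro l; simp only [mem_filter, mem_Ioc, mem_range]
              rintro ⟨h1, h2⟩ h3
              have : l = 0 := by
                by_contra h; exact h3 ⟨by omega, h2⟩
              subst this
              simp [theta, Nat.not_prime_zero]
          rw [e]
          refine sum_le_sum fun l hl => ?_
          simp only [mem_filter, mem_Ioc] at hl
          unfold theta
          split_ifs
          · exact Real.log_le_log (by exact_mod_cast hl.1.1) (by exact_mod_cast (by omega : l ≤ X))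
          · linarith
      _ = #{l ∈ Ioc 0 (0 + X) | l ≡ aE X q [MOD q]} * Real.log X := by rw [sum_const, nsmul_eq_mul]
      _ ≤ _ := by
          have := (abs_le.mp (ap_count 0 X hq (aE X q))).2
          nlinarith
  have h0 : 0 ≤ primeSumAP X q (aE X q) := by
    rw [primeSumAP_eq]; exact sum_nonneg fun l _ => theta_nonneg l
  have h2 : (X:ℝ) / q + 1 ≤ 2 * X / Nat.totient q := by
    have a1 : (X:ℝ) / q ≤ X / Nat.totient q := by gcongr
    have a2 : 1 ≤ (X:ℝ) / q := by rwa [le_div_iff₀ hq', one_mul]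
    calc (X:ℝ) / q + 1 ≤ X / Nat.totient q + X / Nat.totient q := by linarith
      _ = _ := by ring
  have h3 : primeSumAP X q (aE X q) ≤ 2 * X * Real.log X / Nat.totient q := by
    calc _ ≤ Real.log X * (2 * X / Nat.totient q) := h1.trans (mul_le_mul_of_nonneg_left h2 (by linarith))
      _ = _ := by ring
  have h4 : (X:ℝ) / Nat.totient q ≤ X * Real.log X / Nat.totient q := by
    gcongr; nlinarith
  have h5 : 0 ≤ (X:ℝ) / Nat.totient q := by positivity
  have h6 : 3 * X * Real.log X / Nat.totient q = 2 * X * Real.log X / Nat.totient q + X * Real.log X / Nat.totient q := by ring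
  unfold EE
  rw [abs_le, h6]
  constructor <;> linarith

section S2err
variable {P U : Finset ℕ}

lemma prod_inj (hP : ∀ p ∈ P, p.Prime) : Function.Injective (fun S : Finset P => ∏ p ∈ S, (p:ℕ)) := by
  intro S T h
  have key : ∀ S : Finset P, ∀ p : P, p ∈ S ↔ (p:ℕ) ∣ ∏ p ∈ S, (p:ℕ) := by
    intro S p
    constructor
    · exact fun h => dvd_prod_of_mem (fun p : P => (p:ℕ)) h
    · intro h
      obtain ⟨x, hx, h2⟩ := ((hP p p.2).prime.dvd_finset_prod_iff _).mp h
      have : (p:ℕ) = x := (Nat.prime_dvd_prime_iff_eq (hP p p.2) (hP x x.2)).mp h2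
      rwa [Subtype.ext this]
  ext p
  rw [key S, key T]
  simp only at h
  rw [h]

lemma totient_ge (hP : ∀ p ∈ P, p.Prime) {W : ℕ} (hW : 0 < W) (hPW : ∀ p ∈ P, Nat.Coprime W p)
    {v : P → ℝ} (hv : ∀ p : P, v p = 1 / ((p:ℝ) - 1)) (S : Finset P) :
    1 / (Nat.totient (W * ∏ p ∈ S, (p:ℕ)) : ℝ) ≤ vs v S := by
  induction S using Finset.induction_on with
  | empty =>
    simp only [prod_empty, mul_one, vs]
    have : (1:ℝ) ≤ Nat.totient W := by exact_mod_cast Nat.totient_pos.mpr hW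
    rw [div_le_one (by linarith)]; exact this
  | insert p S hp ih =>
    have hcop : Nat.Coprime (p:ℕ) (W * ∏ p ∈ S, (p:ℕ)) := by
      refine Nat.Coprime.mul_right (hPW p p.2).symm ?_
      refine Nat.Coprime.prod_right fun x hx => (Nat.coprime_primes (hP p p.2) (hP x x.2)).mpr ?_
      intro h
      have : p = x := Subtype.ext h
      subst this; exact hp hx
    rw [prod_insert hp, mul_left_comm, Nat.totient_mul hcop, Nat.totient_prime (hP p p.2)]
    unfold vs at *
    rw [prod_insert hp, hv]
    push_cast [Nat.cast_sub (hP p p.2).one_lt.le]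
    rw [one_div_mul_eq_div] 
    have h2 : (1:ℝ) < p := by exact_mod_cast (hP p p.2).one_lt
    have : 1 / (((p:ℝ) - 1) * (Nat.totient (W * ∏ p ∈ S, (p:ℕ)) : ℝ)) = (1 / (Nat.totient (W * ∏ p ∈ S, (p:ℕ)) : ℝ)) / ((p:ℝ) - 1) := by
      rw [div_div, mul_comm]
    rw [this]
    exact div_le_div_of_nonneg_right ih (by linarith)

lemma xs_prod (hP : ∀ p ∈ P, p.Prime) {L : ℝ} (hL : 0 < L) {x : P → ℝ} (hx : ∀ p : P, x p = Real.log p / L)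
    (S : Finset P) (t : ℝ) : xs x S ≤ t ↔ ((∏ p ∈ S, (p:ℕ) : ℕ) : ℝ) ≤ Real.exp (L * t) := by
  have hpos : (0:ℝ) < ((∏ p ∈ S, (p:ℕ) : ℕ) : ℝ) := by
    have : 0 < ∏ p ∈ S, (p:ℕ) := prod_pos fun (p : P) _ => (hP p p.2).pos
    exact Nat.cast_pos.mpr this
  have : L * xs x S = Real.log ((∏ p ∈ S, (p:ℕ) : ℕ) : ℝ) := by
    push_cast
    rw [Real.log_prod (fun p _ => by exact_mod_cast (hP p p.2).ne_zero)]
    unfold xs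
    rw [mul_sum]
    refine sum_congr rfl fun p _ => ?_
    rw [hx]; field_simp
  rw [← Real.log_le_iff_le_exp hpos, ← this]
  exact ⟨fun h => mul_le_mul_of_nonneg_left h hL.le, fun h => le_of_mul_le_mul_left h hL⟩

lemma sum_EE_le (hP : ∀ p ∈ P, p.Prime) {W : ℕ} (hW : 0 < W)
    {L : ℝ} (hL : 0 < L) {x : P → ℝ} (hx : ∀ p : P, x p = Real.log p / L) (X : ℕ)
    (hX : W * Real.exp (L * 2) ≤ (X:ℝ) ^ (1/2:ℝ)) :
    ∑ S : Finset P with xs x S ≤ 2, EE X (W * ∏ p ∈ S, (p:ℕ)) ≤ ∑ q ∈ Icc 1 ⌊(X:ℝ) ^ (1/2:ℝ)⌋₊, EE X q := by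
  have hinj : Set.InjOn (fun S : Finset P => W * ∏ p ∈ S, (p:ℕ)) (univ.filter (fun S : Finset P => xs x S ≤ 2)) := by
    intro S _ T _ h
    exact prod_inj hP (Nat.eq_of_mul_eq_mul_left hW h)
  rw [← sum_image (f := fun q => EE X q) hinj]
  refine sum_le_sum_of_subset_of_nonneg ?_ fun q _ _ => EE_nonneg X q
  intro q hq
  obtain ⟨S, hS, rfl⟩ := mem_image.mp hq
  have hS := (mem_filter.mp hS).2
  rw [xs_prod hP hL hx] at hS
  rw [mem_Icc]
  refine ⟨Nat.mul_pos hW (prod_pos fun p _ => (hP p p.2).pos), Nat.le_floor ?_⟩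
  rw [Nat.cast_mul]
  refine le_trans ?_ hX
  exact mul_le_mul_of_nonneg_left hS (by positivity)

lemma S2_err (hP : ∀ p ∈ P, p.Prime) {W : ℕ} (hW : 0 < W) (hPW : ∀ p ∈ P, Nat.Coprime W p)
    {L : ℝ} (hL : 0 < L) {x v : P → ℝ} (hx : ∀ p : P, x p = Real.log p / L) (hv : ∀ p : P, v p = 1 / ((p:ℝ) - 1))
    {N X1 X2 : ℕ} (hN : 3 ≤ N) (h1 : N ≤ X1) (h2 : N ≤ X2) (h3 : X1 ≤ 3 * N) (h4 : X2 ≤ 3 * N)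
    (hX : W * Real.exp (L * 2) ≤ (N:ℝ) ^ (1/2:ℝ))
    {lam : (P → Option U) → ℝ} {Y : ℝ} (hY : 0 ≤ Y)
    (hlam : ∀ d, |lam d| ≤ if tot x d ≤ 1 then Y else 0) {B C : ℝ} (hB : 0 < B) (hC : 0 < C)
    (hlev : ∀ X : ℕ, 2 ≤ X → ∑ q ∈ Icc 1 ⌊(X:ℝ) ^ (1/2:ℝ)⌋₊, EE X q ≤ C * X / (Real.log X) ^ B)
    {T : ℝ} (hT : 0 < T) {j : ℕ} (hj : ((Fintype.card U + 1) ^ 4 : ℝ) ≤ 2 ^ j) :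
    ∑ d, ∑ e, |lam d| * |lam e| * (EE X1 (W * ∏ p ∈ supp d e, (p:ℕ)) + EE X2 (W * ∏ p ∈ supp d e, (p:ℕ))) ≤
      Y ^ 2 * (T * (6 * C * N / (Real.log N) ^ B) + (18 * N * Real.log (3 * N)) / T * Vs x v 2 (fun _ => 1) ^ (2 ^ j)) := by
  have hN' : (3:ℝ) ≤ N := by exact_mod_cast hN
  have hlogN : 1 ≤ Real.log N := by
    rw [Real.le_log_iff_exp_le (by positivity)]
    linarith [Real.exp_one_lt_d9]
  have hx0 : ∀ p, 0 ≤ x p := fun p => by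
    rw [hx]; exact div_nonneg (Real.log_natCast_nonneg _) hL.le
  have hv0 : ∀ p, 0 ≤ v p := fun p => by
    rw [hv]; have : (1:ℝ) < p := by exact_mod_cast (hP p p.2).one_lt
    exact one_div_nonneg.mpr (by linarith)
  have hs : (N:ℝ) ^ (1/2:ℝ) ≤ N := by
    calc (N:ℝ) ^ (1/2:ℝ) ≤ (N:ℝ) ^ (1:ℝ) := Real.rpow_le_rpow_of_exponent_le (by linarith) (by norm_num)
      _ = N := Real.rpow_one _
  have hlev' : ∀ X : ℕ, N ≤ X → X ≤ 3 * N →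
      ∑ S : Finset P with xs x S ≤ 2, EE X (W * ∏ p ∈ S, (p:ℕ)) ≤ 3 * C * N / (Real.log N) ^ B := by
    intro X hX1 hX2
    have c1 : (N:ℝ) ≤ X := by exact_mod_cast hX1
    have c2 : (X:ℝ) ≤ 3 * N := by exact_mod_cast hX2
    refine (sum_EE_le hP hW hL hx X (hX.trans ?_)).trans ((hlev X (by omega)).trans ?_)
    · exact Real.rpow_le_rpow (by positivity) c1 (by norm_num)
    · have : (Real.log N) ^ B ≤ (Real.log X) ^ B :=
        Real.rpow_le_rpow (by linarith) (Real.log_le_log (by linarith) c1) hB.le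
      have hp : 0 < (Real.log N) ^ B := Real.rpow_pos_of_pos (by linarith) B
      exact div_le_div₀ (by positivity) (by nlinarith) hp this
  have htriv : ∀ X : ℕ, N ≤ X → X ≤ 3 * N → ∀ S : Finset P, xs x S ≤ 2 → EE X (W * ∏ p ∈ S, (p:ℕ)) ≤ 9 * N * Real.log (3 * N) * vs v S := by
    intro X hX1 hX2 S hS
    have c1 : (N:ℝ) ≤ X := by exact_mod_cast hX1
    have c2 : (X:ℝ) ≤ 3 * N := by exact_mod_cast hX2
    have hpos : 0 < W * ∏ p ∈ S, (p:ℕ) := Nat.mul_pos hW (prod_pos fun p _ => (hP p p.2).pos)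
    rw [xs_prod hP hL hx] at hS
    have hle : W * ∏ p ∈ S, (p:ℕ) ≤ X := by
      have : ((W * ∏ p ∈ S, (p:ℕ) : ℕ) : ℝ) ≤ X := by
        rw [Nat.cast_mul]
        refine le_trans (mul_le_mul_of_nonneg_left hS (by positivity)) ?_
        linarith
      exact_mod_cast this
    refine (EE_triv X _ hpos hle (by omega)).trans ?_
    have ht := totient_ge hP hW hPW hv S
    have hlogX : Real.log X ≤ Real.log (3 * N) := Real.log_le_log (by linarith) c2
    have hlogX0 : 0 ≤ Real.log X := Real.log_natCast_nonneg X
    rw [div_eq_mul_one_div]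
    have hb : 3 * (X:ℝ) * Real.log X ≤ 9 * N * Real.log (3 * N) := by nlinarith
    refine mul_le_mul hb ht (by positivity) ?_
    exact le_trans (by positivity) hb
  have hlog3 : 0 ≤ Real.log (3 * N) := Real.log_nonneg (by linarith)
  have := err_sum (κ := U) hv0 hx0 hY hlam
    (fun S => EE X1 (W * ∏ p ∈ S, (p:ℕ)) + EE X2 (W * ∏ p ∈ S, (p:ℕ)))
    (fun S => add_nonneg (EE_nonneg _ _) (EE_nonneg _ _)) (Z := 18 * N * Real.log (3 * N)) hT
    (by positivity) (fun S hS => by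
      have a := htriv X1 h1 h3 S hS
      have b := htriv X2 h2 h4 S hS
      linarith) hj
  refine this.trans ?_
  refine mul_le_mul_of_nonneg_left ?_ (sq_nonneg Y)
  refine add_le_add (mul_le_mul_of_nonneg_left ?_ hT.le) le_rfl
  rw [sum_add_distrib]
  calc _ ≤ 3 * C * N / (Real.log N) ^ B + 3 * C * N / (Real.log N) ^ B := add_le_add (hlev' X1 h1 h3) (hlev' X2 h2 h4)
    _ = _ := by ring
end S2err
end GPY

namespace GPY

section Abs
variable {ι : Type*} [Fintype ι] [DecidableEq ι] {x v u : ι → ℝ}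

lemma Vs_le_mul (hu : ∀ p, 0 ≤ u p) (hv : ∀ p, 0 ≤ v p) (hx : ∀ p, 0 ≤ x p) (huv : ∀ p, v p = u p * (1 + v p))
    {t : ℝ} {G : ℝ → ℝ} (hG : ∀ t, 0 ≤ t → 0 ≤ G t) (hGa : ∀ s t, 0 ≤ s → s ≤ t → G t ≤ G s) :
    Vs x v t G ≤ (∏ p, (1 + u p * v p)) * Vs x u t G := by
  have hcut : ∀ S, 0 ≤ cut x u t G S := fun S => cut_nonneg hu hx hG S
  have e0 : ∏ p, (1 + u p * v p) = ∑ E : Finset ι, vs (fun p => u p * v p) E := by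
    rw [prod_one_add, powerset_univ]; rfl
  have hw : ∀ E, 0 ≤ vs (fun p => u p * v p) E := fun E => vs_nonneg (fun p => mul_nonneg (hu p) (hv p)) E
  rw [e0]
  unfold Vs
  rw [sum_mul_sum, ← sum_product' (f := fun A B => vs (fun p => u p * v p) A * cut x u t G B)]
  calc _ ≤ ∑ S : Finset ι, ∑ E ∈ S.powerset, vs (fun p => u p * v p) E * cut x u t G (S \ E) := by
        refine sum_le_sum fun S _ => ?_
        by_cases hS : xs x S ≤ t
        · have h1 : cut x v t G S = ∑ E ∈ S.powerset, G (xs x S) * (vs (fun p => u p * v p) E * vs u (S \ E)) := by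
            unfold cut
            rw [if_pos hS, ← mul_sum]
            congr 1
            have : vs v S = vs u S * ∏ p ∈ S, (1 + v p) := by
              unfold vs; rw [← prod_mul_distrib]; exact prod_congr rfl fun p _ => huv p
            rw [this, prod_one_add, mul_sum]
            refine sum_congr rfl fun E hE => ?_
            have hE := mem_powerset.mp hE
            unfold vs
            rw [prod_mul_distrib, ← prod_sdiff hE]; ring
          rw [h1]
          refine sum_le_sum fun E hE => ?_
          have hE := mem_powerset.mp hE
          have h2 : xs x (S \ E) ≤ xs x S := sum_le_sum_of_subset_of_nonneg sdiff_subset fun p _ _ => hx p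
          unfold cut
          rw [if_pos (h2.trans hS)]
          have h3 := hGa _ _ (xs_nonneg hx (S \ E)) h2
          have := mul_nonneg (hw E) (vs_nonneg hu (S \ E))
          nlinarith
        · have : cut x v t G S = 0 := by unfold cut; rw [if_neg hS]
          rw [this]
          exact sum_nonneg fun E _ => mul_nonneg (hw _) (hcut _)
    _ = ∑ z ∈ (univ : Finset (Finset ι)).sigma (fun S => S.powerset), vs (fun p => u p * v p) z.2 * cut x u t G (z.1 \ z.2) := by
        rw [sum_sigma]
    _ ≤ _ := by
        set r : (Σ _ : Finset ι, Finset ι) → Finset ι × Finset ι := fun z => (z.2, z.1 \ z.2) with hr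
        have hinj : Set.InjOn r ((univ : Finset (Finset ι)).sigma (fun S => S.powerset) : Finset (Σ _ : Finset ι, Finset ι)) := by
          rintro ⟨S, A⟩ h1 ⟨T, B⟩ h2 h
          simp only [coe_sigma, Set.mem_sigma_iff, mem_coe, mem_univ, mem_powerset, true_and] at h1 h2
          simp only [hr, Prod.mk.injEq] at h
          obtain ⟨h3, h4⟩ := h
          subst h3
          have : S = T := by rw [← sdiff_union_of_subset h1, ← sdiff_union_of_subset h2, h4]
          subst this; rfl
        rw [← sum_image (f := fun z : Finset ι × Finset ι => vs (fun p => u p * v p) z.1 * cut x u t G z.2) hinj]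
        exact sum_le_sum_of_subset_of_nonneg (fun _ _ => by simp) fun z _ _ => mul_nonneg (hw _) (hcut _)

lemma Vs_mono_v (hu : ∀ p, 0 ≤ u p) (huv : ∀ p, u p ≤ v p) (hx : ∀ p, 0 ≤ x p) {t : ℝ} {G : ℝ → ℝ}
    (hG : ∀ t, 0 ≤ t → 0 ≤ G t) : Vs x u t G ≤ Vs x v t G := by
  refine sum_le_sum fun S _ => ?_
  unfold cut; split_ifs
  · refine mul_le_mul_of_nonneg_left ?_ (hG _ (xs_nonneg hx S))
    exact prod_le_prod (fun p _ => hu p) fun p _ => huv p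
  · exact le_rfl
end Abs

/-- the arithmetic weight `G (log r / L) / r` -/
noncomputable def gr (L : ℝ) (G : ℝ → ℝ) (r : ℕ) : ℝ := G (Real.log r / L) / r

/-- sums over integers coprime to `W` -/
noncomputable def Cop (W : ℕ) (L t : ℝ) (G : ℝ → ℝ) : ℝ :=
  ∑ r ∈ Icc 1 ⌊Real.exp (L * t)⌋₊ with Nat.Coprime r W, gr L G r

section Conc
variable {P : Finset ℕ}

lemma gr_nonneg {L : ℝ} (hL : 0 < L) {G : ℝ → ℝ} (hG : ∀ t, 0 ≤ t → 0 ≤ G t) (r : ℕ) : 0 ≤ gr L G r :=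
  div_nonneg (hG _ (div_nonneg (Real.log_natCast_nonneg r) hL.le)) (Nat.cast_nonneg r)

lemma cut_eq_gr (hP : ∀ p ∈ P, p.Prime) {L : ℝ} (hL : 0 < L) {x u : P → ℝ} (hx : ∀ p : P, x p = Real.log p / L)
    (hu : ∀ p : P, u p = 1 / (p:ℝ)) (t : ℝ) (G : ℝ → ℝ) (S : Finset P) :
    cut x u t G S = if ((∏ p ∈ S, (p:ℕ) : ℕ) : ℝ) ≤ Real.exp (L * t) then gr L G (∏ p ∈ S, (p:ℕ)) else 0 := by
  unfold cut
  simp only [xs_prod hP hL hx S t]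
  have h1 : xs x S = Real.log ((∏ p ∈ S, (p:ℕ) : ℕ) : ℝ) / L := by
    push_cast
    rw [Real.log_prod (fun p _ => by exact_mod_cast (hP p p.2).ne_zero)]
    unfold xs
    rw [sum_div]
    exact sum_congr rfl fun p _ => hx p
  have h2 : vs u S = 1 / ((∏ p ∈ S, (p:ℕ) : ℕ) : ℝ) := by
    push_cast
    unfold vs
    rw [one_div, ← prod_inv_distrib]
    exact prod_congr rfl fun p _ => by rw [hu, one_div]
  rw [h1, h2]
  unfold gr
  simp only [mul_one_div]

lemma Vs_le_Cop (hP : ∀ p ∈ P, p.Prime) {W : ℕ} (hPW : ∀ p ∈ P, Nat.Coprime W p)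
    {L : ℝ} (hL : 0 < L) {x u : P → ℝ} (hx : ∀ p : P, x p = Real.log p / L)
    (hu : ∀ p : P, u p = 1 / (p:ℝ)) (t : ℝ) {G : ℝ → ℝ} (hG : ∀ t, 0 ≤ t → 0 ≤ G t) :
    Vs x u t G ≤ Cop W L t G := by
  unfold Vs
  simp_rw [cut_eq_gr hP hL hx hu]
  rw [← sum_filter, ← sum_image (f := gr L G) (g := fun S : Finset P => ∏ p ∈ S, (p:ℕ)) (fun S _ T _ h => prod_inj hP h)]
  refine sum_le_sum_of_subset_of_nonneg ?_ fun r _ _ => gr_nonneg hL hG r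
  intro r hr
  obtain ⟨S, hS, rfl⟩ := mem_image.mp hr
  have hS := (mem_filter.mp hS).2
  rw [mem_filter, mem_Icc]
  exact ⟨⟨prod_pos fun (p : P) _ => (hP p p.2).pos, Nat.le_floor hS⟩, Nat.Coprime.prod_left fun (p : P) _ => (hPW p p.2).symm⟩

lemma Cop_mult {W : ℕ} {L : ℝ} (hL : 0 < L) (t : ℝ) {G : ℝ → ℝ} (hG : ∀ t, 0 ≤ t → 0 ≤ G t)
    (hGa : ∀ s t, 0 ≤ s → s ≤ t → G t ≤ G s) {m : ℕ} (hm : 0 < m) :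
    ∑ r ∈ Icc 1 ⌊Real.exp (L * t)⌋₊ with (Nat.Coprime r W ∧ m ∣ r), gr L G r ≤ 1 / m * Cop W L t G := by
  unfold Cop
  rw [mul_sum]
  have hsub : (Icc 1 ⌊Real.exp (L * t)⌋₊).filter (fun r => Nat.Coprime r W ∧ m ∣ r) ⊆
      ((Icc 1 ⌊Real.exp (L * t)⌋₊).filter (fun r => Nat.Coprime r W)).image (fun s => m * s) := by
    intro r hr
    simp only [mem_filter, mem_Icc] at hr
    obtain ⟨⟨h1, h2⟩, h3, s, rfl⟩ := hr
    rw [mem_image]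
    refine ⟨s, ?_, rfl⟩
    simp only [mem_filter, mem_Icc]
    have hs : 1 ≤ s := Nat.pos_of_ne_zero (by rintro rfl; simp at h1)
    exact ⟨⟨hs, le_trans (Nat.le_mul_of_pos_left s hm) h2⟩, Nat.Coprime.coprime_mul_left h3⟩
  refine (sum_le_sum_of_subset_of_nonneg hsub fun r _ _ => gr_nonneg hL hG r).trans ?_
  rw [sum_image (fun a _ b _ h => Nat.eq_of_mul_eq_mul_left hm h)]
  refine sum_le_sum fun s hs => ?_
  simp only [mem_filter, mem_Icc] at hs
  have hs1 : (1:ℝ) ≤ s := by exact_mod_cast hs.1.1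
  have hm1 : (1:ℝ) ≤ m := by exact_mod_cast hm
  unfold gr
  have h1 : Real.log (s:ℝ) / L ≤ Real.log ((m * s : ℕ) : ℝ) / L := by
    refine div_le_div_of_nonneg_right (Real.log_le_log (by linarith) ?_) hL.le
    push_cast; nlinarith
  have h2 := hGa _ _ (div_nonneg (Real.log_nonneg hs1) hL.le) h1
  have : 1 / (m:ℝ) * (G (Real.log s / L) / s) = G (Real.log s / L) / ((m * s : ℕ) : ℝ) := by
    push_cast; field_simp
  rw [this]
  exact div_le_div_of_nonneg_right h2 (Nat.cast_nonneg _)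

lemma Vs_ge_Cop (hP : ∀ p ∈ P, p.Prime) {W : ℕ}
    {L : ℝ} (hL : 0 < L) {x u : P → ℝ} (hx : ∀ p : P, x p = Real.log p / L)
    (hu : ∀ p : P, u p = 1 / (p:ℝ)) {t : ℝ} {G : ℝ → ℝ} (hG : ∀ t, 0 ≤ t → 0 ≤ G t)
    (hGa : ∀ s t, 0 ≤ s → s ≤ t → G t ≤ G s)
    (Q Bd : Finset ℕ) (hQ : ∀ p ∈ Q, p.Prime) (hB : ∀ p ∈ Bd, p.Prime)
    (hcov : ∀ p : ℕ, p.Prime → Nat.Coprime p W → (p:ℝ) ≤ Real.exp (L * t) → p ∈ Q ∧ (p ∈ P ∨ p ∈ Bd))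
    {τ σ : ℝ} (hτ : ∑ p ∈ Q, 1 / (p:ℝ) ^ 2 ≤ τ) (hσ : ∑ p ∈ Bd, 1 / (p:ℝ) ≤ σ) :
    (1 - τ - σ) * Cop W L t G ≤ Vs x u t G := by
  set I := (Icc 1 ⌊Real.exp (L * t)⌋₊).filter (fun r => Nat.Coprime r W) with hI
  have hC0 : 0 ≤ Cop W L t G := sum_nonneg fun r _ => gr_nonneg hL hG r
  -- good part
  have hgood : ∑ r ∈ I with (Squarefree r ∧ r.primeFactors ⊆ P), gr L G r ≤ Vs x u t G := by
    unfold Vs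
    simp_rw [cut_eq_gr hP hL hx hu]
    rw [← sum_filter, ← sum_image (f := gr L G) (g := fun S : Finset P => ∏ p ∈ S, (p:ℕ)) (fun S _ T _ h => prod_inj hP h)]
    refine sum_le_sum_of_subset_of_nonneg ?_ fun r _ _ => gr_nonneg hL hG r
    intro r hr
    simp only [hI, mem_filter, mem_Icc] at hr
    obtain ⟨⟨⟨h1, h2⟩, h3⟩, h4, h5⟩ := hr
    rw [mem_image]
    have e : ∏ p ∈ r.primeFactors.subtype (fun p => p ∈ P), (p:ℕ) = r := by
      rw [prod_subtype_of_mem (f := fun p => p) h5]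
      exact Nat.prod_primeFactors_of_squarefree h4
    refine ⟨r.primeFactors.subtype (fun p => p ∈ P), ?_, e⟩
    simp only [mem_filter, mem_univ, true_and]
    rw [e]
    exact (Nat.le_floor_iff (Real.exp_pos _).le).mp h2
  have hbad : ∑ r ∈ I with ¬ (Squarefree r ∧ r.primeFactors ⊆ P), gr L G r ≤ (τ + σ) * Cop W L t G := by
    calc _ ≤ ∑ r ∈ I, ((∑ p ∈ Q, if p ^ 2 ∣ r then gr L G r else 0) + ∑ p ∈ Bd, if p ∣ r then gr L G r else 0) := by
          rw [sum_filter]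
          refine sum_le_sum fun r hr => ?_
          have n1 : ∀ p ∈ Q, 0 ≤ if p ^ 2 ∣ r then gr L G r else 0 := fun p _ => by
            split_ifs; exacts [gr_nonneg hL hG r, le_rfl]
          have n2 : ∀ p ∈ Bd, 0 ≤ if p ∣ r then gr L G r else 0 := fun p _ => by
            split_ifs; exacts [gr_nonneg hL hG r, le_rfl]
          simp only [hI, mem_filter, mem_Icc] at hr
          obtain ⟨⟨h1, h2⟩, h3⟩ := hr
          have hcov' : ∀ p : ℕ, p.Prime → p ∣ r → p ∈ Q ∧ (p ∈ P ∨ p ∈ Bd) := by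
            intro p hp hpr
            refine hcov p hp (Nat.Coprime.coprime_dvd_left hpr h3) ?_
            refine le_trans ?_ ((Nat.le_floor_iff (Real.exp_pos _).le).mp h2)
            exact_mod_cast Nat.le_of_dvd h1 hpr
          split_ifs with h
          · exact add_nonneg (sum_nonneg n1) (sum_nonneg n2)
          · rw [not_and_or] at h
            rcases h with h | h
            · rw [Nat.squarefree_iff_prime_squarefree] at h
              push Not at h
              obtain ⟨p, hp, hpr⟩ := h
              have hpQ := (hcov' p hp (dvd_trans (Dvd.intro _ rfl) hpr)).1
              have := single_le_sum n1 hpQ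
              rw [if_pos (by rwa [sq])] at this
              linarith [sum_nonneg n2]
            · rw [not_subset] at h
              obtain ⟨p, hp, hpP⟩ := h
              have hp1 := Nat.prime_of_mem_primeFactors hp
              have hp2 := Nat.dvd_of_mem_primeFactors hp
              have hpB := (hcov' p hp1 hp2).2.resolve_left hpP
              have := single_le_sum n2 hpB
              rw [if_pos hp2] at this
              linarith [sum_nonneg n1]
      _ = (∑ p ∈ Q, ∑ r ∈ Icc 1 ⌊Real.exp (L * t)⌋₊ with (Nat.Coprime r W ∧ p ^ 2 ∣ r), gr L G r)
          + ∑ p ∈ Bd, ∑ r ∈ Icc 1 ⌊Real.exp (L * t)⌋₊ with (Nat.Coprime r W ∧ p ∣ r), gr L G r := by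
          rw [sum_add_distrib, sum_comm, sum_comm (t := Bd)]
          congr 1
          · refine sum_congr rfl fun p _ => ?_
            rw [← sum_filter, hI, filter_filter]
          · refine sum_congr rfl fun p _ => ?_
            rw [← sum_filter, hI, filter_filter]
      _ ≤ (∑ p ∈ Q, 1 / (p:ℝ) ^ 2 * Cop W L t G) + ∑ p ∈ Bd, 1 / (p:ℝ) * Cop W L t G := by
          refine add_le_add (sum_le_sum fun p hp => ?_) (sum_le_sum fun p hp => ?_)
          · have := Cop_mult (W := W) hL t hG hGa (pow_pos (hQ p hp).pos 2)
            push_cast at this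
            exact this
          · exact Cop_mult (W := W) hL t hG hGa (hB p hp).pos
      _ ≤ _ := by
          rw [← sum_mul, ← sum_mul, ← add_mul]
          exact mul_le_mul_of_nonneg_right (add_le_add hτ hσ) hC0
  have hsplit : Cop W L t G = ∑ r ∈ I with (Squarefree r ∧ r.primeFactors ⊆ P), gr L G r
      + ∑ r ∈ I with ¬ (Squarefree r ∧ r.primeFactors ⊆ P), gr L G r :=
    (sum_filter_add_sum_filter_not I _ _).symm
  linarith
end Conc
end GPY

namespace GPY

lemma cop_window (W n : ℕ) : ((Ico n (n+W)).filter (fun r => Nat.Coprime r W)).card = Nat.totient W := by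
  rw [← Nat.filter_coprime_Ico_eq_totient W n]
  congr 1
  refine filter_congr fun r _ => Nat.coprime_comm

/-- averaged upper bound for sums over integers coprime to `W`. -/
lemma cop_upper {W : ℕ} (hW : 0 < W) (Y : ℕ) {f : ℕ → ℝ} (hf : ∀ n, 0 ≤ f n) (hfa : ∀ m n, 1 ≤ m → m ≤ n → f n ≤ f m) :
    ∑ r ∈ Icc 1 Y with Nat.Coprime r W, f r ≤ ∑ r ∈ Icc 1 W, f r + (Nat.totient W : ℝ) / W * ∑ n ∈ Icc 1 Y, f n := by
  have hW' : (0:ℝ) < W := by exact_mod_cast hW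
  have h1 : ∑ r ∈ Icc 1 Y with Nat.Coprime r W, f r ≤ ∑ r ∈ Icc 1 W, f r + ∑ r ∈ Icc 1 Y with (Nat.Coprime r W ∧ W < r), f r := by
    rw [← sum_filter_add_sum_filter_not ((Icc 1 Y).filter (fun r => Nat.Coprime r W)) (fun r => r ≤ W)]
    refine add_le_add ?_ (le_of_eq ?_)
    · refine sum_le_sum_of_subset_of_nonneg ?_ fun n _ _ => hf n
      intro r; simp only [mem_filter, mem_Icc]; omega
    · rw [filter_filter]; simp only [not_le]
  have h2 : (W:ℝ) * ∑ r ∈ Icc 1 Y with (Nat.Coprime r W ∧ W < r), f r ≤ Nat.totient W * ∑ n ∈ Icc 1 Y, f n := by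
    calc _ ≤ ∑ r ∈ Icc 1 Y with (Nat.Coprime r W ∧ W < r), ∑ n ∈ Icc 1 Y, if r - W ≤ n ∧ n < r then f n else 0 := by
          rw [mul_sum]
          refine sum_le_sum fun r hr => ?_
          simp only [mem_filter, mem_Icc] at hr
          rw [← sum_filter]
          have : (Icc 1 Y).filter (fun n => r - W ≤ n ∧ n < r) = Ico (r - W) r := by
            ext n; simp only [mem_filter, mem_Icc, mem_Ico]; omega
          rw [this]
          have hc := card_nsmul_le_sum (Ico (r-W) r) f (f r) (fun n hn => by
            simp only [mem_Ico] at hn; exact hfa _ _ (by omega) (by omega))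
          rw [Nat.card_Ico, Nat.sub_sub_self (by omega), nsmul_eq_mul] at hc
          exact hc
      _ = ∑ n ∈ Icc 1 Y, ∑ r ∈ Icc 1 Y with (Nat.Coprime r W ∧ W < r), if r - W ≤ n ∧ n < r then f n else 0 := sum_comm
      _ ≤ _ := by
          rw [mul_sum]
          refine sum_le_sum fun n hn => ?_
          rw [← sum_filter, sum_const, nsmul_eq_mul]
          refine mul_le_mul_of_nonneg_right ?_ (hf n)
          rw [← cop_window W (n+1)]
          exact_mod_cast card_le_card (by
            intro r; simp only [mem_filter, mem_Icc, mem_Ico]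
            rintro ⟨⟨a, b, c⟩, d, e⟩
            exact ⟨by omega, b⟩)
  have h3 : ∑ r ∈ Icc 1 Y with (Nat.Coprime r W ∧ W < r), f r ≤ (Nat.totient W : ℝ) / W * ∑ n ∈ Icc 1 Y, f n := by
    rw [div_mul_eq_mul_div, le_div_iff₀ hW']; linarith
  linarith

lemma cop_lower {W : ℕ} (hW : 0 < W) (Y : ℕ) {f : ℕ → ℝ} (hf : ∀ n, 0 ≤ f n) (hfa : ∀ m n, 1 ≤ m → m ≤ n → f n ≤ f m) :
    (Nat.totient W : ℝ) / W * ∑ n ∈ Ioc W Y, f n ≤ ∑ r ∈ Icc 1 Y with Nat.Coprime r W, f r := by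
  have hW' : (0:ℝ) < W := by exact_mod_cast hW
  have h2 : Nat.totient W * ∑ n ∈ Ioc W Y, f n ≤ (W:ℝ) * ∑ r ∈ Icc 1 Y with Nat.Coprime r W, f r := by
    calc _ ≤ ∑ n ∈ Ioc W Y, ∑ r ∈ Icc 1 Y with Nat.Coprime r W, if n - W ≤ r ∧ r < n then f r else 0 := by
          rw [mul_sum]
          refine sum_le_sum fun n hn => ?_
          simp only [mem_Ioc] at hn
          rw [← sum_filter, filter_filter]
          have : (Icc 1 Y).filter (fun r => Nat.Coprime r W ∧ (n - W ≤ r ∧ r < n)) = (Ico (n-W) (n-W+W)).filter (fun r => Nat.Coprime r W) := by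
            ext r; simp only [mem_filter, mem_Icc, mem_Ico]; 
            constructor
            · rintro ⟨a, b, c⟩; exact ⟨by omega, b⟩
            · rintro ⟨a, b⟩; exact ⟨by omega, b, by omega⟩
          rw [this]
          have hc := card_nsmul_le_sum ((Ico (n-W) (n-W+W)).filter (fun r => Nat.Coprime r W)) f (f n) (fun r hr => by
            simp only [mem_filter, mem_Ico] at hr; exact hfa _ _ (by omega) (by omega))
          rw [cop_window, nsmul_eq_mul] at hc
          exact hc
      _ = ∑ r ∈ Icc 1 Y with Nat.Coprime r W, ∑ n ∈ Ioc W Y, if n - W ≤ r ∧ r < n then f r else 0 := sum_comm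
      _ ≤ _ := by
          rw [mul_sum]
          refine sum_le_sum fun r hn => ?_
          rw [← sum_filter, sum_const, nsmul_eq_mul]
          refine mul_le_mul_of_nonneg_right ?_ (hf r)
          have : ((Ioc r (r+W)).card : ℝ) = W := by rw [Nat.card_Ioc]; simp
          rw [← this]
          exact_mod_cast card_le_card (by
            intro r; simp only [mem_filter, mem_Ioc]; omega)
  rw [div_mul_eq_mul_div, div_le_iff₀ hW']; linarith

section K
variable {G K : ℝ → ℝ} {L : ℝ}

lemma gr_anti (hL : 0 < L) (hG : ∀ t, 0 ≤ t → 0 ≤ G t) (hGa : ∀ s t, 0 ≤ s → s ≤ t → G t ≤ G s) (m n : ℕ) (hm : 1 ≤ m) (h : m ≤ n) :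
    gr L G n ≤ gr L G m := by
  unfold gr
  have hm' : (1:ℝ) ≤ m := by exact_mod_cast hm
  have h' : (m:ℝ) ≤ n := by exact_mod_cast h
  have h1 := hGa _ _ (div_nonneg (Real.log_nonneg hm') hL.le) (div_le_div_of_nonneg_right (Real.log_le_log (by linarith) h') hL.le)
  exact div_le_div₀ (hG _ (div_nonneg (Real.log_nonneg hm') hL.le)) h1 (by linarith) h'

lemma gr_sum_le (hL : 0 < L) (hG : ∀ t, 0 ≤ t → 0 ≤ G t)
    (hK1 : ∀ a b, 0 ≤ a → a ≤ b → G b * (b - a) ≤ K b - K a) (Y : ℕ) (hY : 1 ≤ Y) :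
    ∑ n ∈ Icc 1 Y, gr L G n ≤ G 0 + L * (K (Real.log Y / L) - K 0) := by
  induction Y, hY using Nat.le_induction with
  | base => simp [gr]
  | succ n hn ih =>
    rw [sum_Icc_succ_top (by omega)]
    have hn' : (1:ℝ) ≤ n := by exact_mod_cast hn
    have h1 := hK1 (Real.log n / L) (Real.log (n+1:ℕ) / L) (div_nonneg (Real.log_nonneg hn') hL.le)
      (div_le_div_of_nonneg_right (Real.log_le_log (by linarith) (by push_cast; linarith)) hL.le)
    have h2 : 1 / ((n+1:ℕ):ℝ) ≤ Real.log (n+1:ℕ) - Real.log n := by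
      have := Real.log_le_sub_one_of_pos (x := (n:ℝ)/(n+1:ℕ)) (by positivity)
      rw [Real.log_div (by positivity) (by positivity)] at this
      have e : (n:ℝ)/(n+1:ℕ) - 1 = - (1/((n+1:ℕ):ℝ)) := by push_cast; field_simp; ring
      linarith
    have h3 := hG (Real.log (n+1:ℕ) / L) (div_nonneg (Real.log_natCast_nonneg _) hL.le)
    have h4 : gr L G (n+1) ≤ L * (K (Real.log (n+1:ℕ) / L) - K (Real.log n / L)) := by
      calc gr L G (n+1) = G (Real.log (n+1:ℕ) / L) * (1 / ((n+1:ℕ):ℝ)) := by unfold gr; ring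
        _ ≤ G (Real.log (n+1:ℕ) / L) * (Real.log (n+1:ℕ) - Real.log n) := mul_le_mul_of_nonneg_left h2 h3
        _ = L * (G (Real.log (n+1:ℕ) / L) * (Real.log (n+1:ℕ) / L - Real.log n / L)) := by field_simp
        _ ≤ _ := mul_le_mul_of_nonneg_left h1 hL.le
    linarith

lemma gr_sum_ge (hL : 0 < L) (hG : ∀ t, 0 ≤ t → 0 ≤ G t)
    (hK2 : ∀ a b, 0 ≤ a → a ≤ b → K b - K a ≤ G a * (b - a)) (W Y : ℕ) (hY : W ≤ Y) :
    L * (K (Real.log (Y+1:ℕ) / L) - K (Real.log (W+1:ℕ) / L)) ≤ ∑ n ∈ Ioc W Y, gr L G n := by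
  induction Y, hY using Nat.le_induction with
  | base => simp
  | succ n hn ih =>
    rw [sum_Ioc_succ_top (by omega)]
    have hn' : (1:ℝ) ≤ (n+1:ℕ) := by push_cast; linarith [Nat.cast_nonneg (α := ℝ) n]
    have h1 := hK2 (Real.log (n+1:ℕ) / L) (Real.log (n+1+1:ℕ) / L) (div_nonneg (Real.log_nonneg hn') hL.le)
      (div_le_div_of_nonneg_right (Real.log_le_log (by linarith) (by push_cast; linarith)) hL.le)
    have h2 : Real.log (n+1+1:ℕ) - Real.log (n+1:ℕ) ≤ 1 / ((n+1:ℕ):ℝ) := by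
      have := Real.log_le_sub_one_of_pos (x := ((n+1+1:ℕ):ℝ)/(n+1:ℕ)) (by positivity)
      rw [Real.log_div (by positivity) (by positivity)] at this
      have e : ((n+1+1:ℕ):ℝ)/(n+1:ℕ) - 1 = (1/((n+1:ℕ):ℝ)) := by push_cast; field_simp; ring
      linarith
    have h3 := hG (Real.log (n+1:ℕ) / L) (div_nonneg (Real.log_natCast_nonneg _) hL.le)
    have h4 : L * (K (Real.log (n+1+1:ℕ) / L) - K (Real.log (n+1:ℕ) / L)) ≤ gr L G (n+1) := by
      calc _ ≤ L * (G (Real.log (n+1:ℕ) / L) * (Real.log (n+1+1:ℕ) / L - Real.log (n+1:ℕ) / L)) := mul_le_mul_of_nonneg_left h1 hL.le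
        _ = G (Real.log (n+1:ℕ) / L) * (Real.log (n+1+1:ℕ) - Real.log (n+1:ℕ)) := by field_simp
        _ ≤ G (Real.log (n+1:ℕ) / L) * (1 / ((n+1:ℕ):ℝ)) := mul_le_mul_of_nonneg_left h2 h3
        _ = _ := by unfold gr; ring
    linarith

lemma Cop_le (hL : 0 < L) (hG : ∀ t, 0 ≤ t → 0 ≤ G t) (hGa : ∀ s t, 0 ≤ s → s ≤ t → G t ≤ G s)
    (hK1 : ∀ a b, 0 ≤ a → a ≤ b → G b * (b - a) ≤ K b - K a) {W : ℕ} (hW : 0 < W) {t : ℝ} (ht : 0 ≤ t) (hG0 : G 0 = 1) :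
    Cop W L t G ≤ (Nat.totient W : ℝ) / W * L * (K t - K 0) + (2 + Real.log (W + 1)) := by
  have hW' : (1:ℝ) ≤ W := by exact_mod_cast hW
  have hexp : 1 ≤ Real.exp (L * t) := Real.one_le_exp (by positivity)
  have hY : 1 ≤ ⌊Real.exp (L * t)⌋₊ := Nat.le_floor (by simpa using hexp)
  have h0 := cop_upper hW ⌊Real.exp (L * t)⌋₊ (fun n => gr_nonneg hL hG n) (gr_anti hL hG hGa)
  have h1 := gr_sum_le hL hG hK1 _ hY
  have h2 : ∑ r ∈ Icc 1 W, gr L G r ≤ 1 + Real.log (W+1) := by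
    have h3 : ∑ r ∈ Icc 1 W, gr L G r ≤ ∑ r ∈ Icc 1 W, gr L (fun _ => 1) r := by
      refine sum_le_sum fun r _ => ?_
      unfold gr
      refine div_le_div_of_nonneg_right ?_ (Nat.cast_nonneg _)
      rw [← hG0]
      exact hGa _ _ le_rfl (div_nonneg (Real.log_natCast_nonneg _) hL.le)
    have h4 := gr_sum_le (G := fun _ => 1) (K := fun t => t) hL (fun _ _ => zero_le_one) (fun a b _ _ => by simp) W hW
    have h5 : Real.log W ≤ Real.log (W+1) := Real.log_le_log (by linarith) (by linarith)
    have h6 : L * (Real.log W / L - 0) = Real.log W := by field_simp; ring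
    simp only [h6] at h4
    linarith
  have hlogY : Real.log (⌊Real.exp (L * t)⌋₊ : ℝ) / L ≤ t := by
    rw [div_le_iff₀ hL, mul_comm t]
    have h := Real.log_le_log (x := (⌊Real.exp (L * t)⌋₊ : ℝ)) (by exact_mod_cast hY) (Nat.floor_le (by linarith))
    rwa [Real.log_exp] at h
  have hlogY0 : 0 ≤ Real.log (⌊Real.exp (L * t)⌋₊ : ℝ) / L := div_nonneg (Real.log_natCast_nonneg _) hL.le
  have h7 := hK1 _ _ hlogY0 hlogY
  have h8 : 0 ≤ G t * (t - Real.log (⌊Real.exp (L * t)⌋₊ : ℝ) / L) := mul_nonneg (hG _ ht) (by linarith)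
  have hb0 : 0 ≤ (Nat.totient W : ℝ) / W := by positivity
  have hb1 : (Nat.totient W : ℝ) / W ≤ 1 := by
    rw [div_le_one (by linarith)]; exact_mod_cast Nat.totient_le W
  have h9 : ∑ n ∈ Icc 1 ⌊Real.exp (L * t)⌋₊, gr L G n ≤ 1 + L * (K t - K 0) := by
    rw [hG0] at h1
    have := mul_le_mul_of_nonneg_left (show K (Real.log (⌊Real.exp (L * t)⌋₊ : ℝ) / L) - K 0 ≤ K t - K 0 by linarith) hL.le
    linarith
  have h10 := mul_le_mul_of_nonneg_left h9 hb0
  unfold Cop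
  nlinarith

lemma Cop_ge (hL : 0 < L) (hG : ∀ t, 0 ≤ t → 0 ≤ G t) (hGa : ∀ s t, 0 ≤ s → s ≤ t → G t ≤ G s)
    (hK1 : ∀ a b, 0 ≤ a → a ≤ b → G b * (b - a) ≤ K b - K a)
    (hK2 : ∀ a b, 0 ≤ a → a ≤ b → K b - K a ≤ G a * (b - a)) {W : ℕ} (hW : 0 < W) {t : ℝ} (ht : 0 ≤ t) (hG0 : G 0 = 1) :
    (Nat.totient W : ℝ) / W * L * (K t - K 0) - (2 + Real.log (W + 1)) ≤ Cop W L t G := by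
  have hW' : (1:ℝ) ≤ W := by exact_mod_cast hW
  have hb0 : 0 ≤ (Nat.totient W : ℝ) / W := by positivity
  have hb1 : (Nat.totient W : ℝ) / W ≤ 1 := by
    rw [div_le_one (by linarith)]; exact_mod_cast Nat.totient_le W
  have hlW : 0 ≤ Real.log ((W:ℝ)+1) := Real.log_nonneg (by linarith)
  have hC0 : 0 ≤ Cop W L t G := sum_nonneg fun r _ => gr_nonneg hL hG r
  have hKW := hK2 0 (Real.log (W+1:ℕ) / L) le_rfl (div_nonneg (Real.log_natCast_nonneg _) hL.le)
  rw [hG0, one_mul, sub_zero] at hKW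
  have hKW' : L * (K (Real.log (W+1:ℕ) / L) - K 0) ≤ Real.log ((W:ℝ)+1) := by
    have := mul_le_mul_of_nonneg_left hKW hL.le
    rw [mul_div_cancel₀ _ hL.ne'] at this
    push_cast at this ⊢; exact this
  have htY : t ≤ Real.log ((⌊Real.exp (L * t)⌋₊ + 1 : ℕ) : ℝ) / L := by
    rw [le_div_iff₀ hL, mul_comm t]
    rw [Real.le_log_iff_exp_le (by positivity)]
    push_cast
    exact (Nat.lt_floor_add_one _).le
  have h7 := hK1 _ _ ht htY
  have h8 : 0 ≤ G (Real.log ((⌊Real.exp (L * t)⌋₊ + 1 : ℕ) : ℝ) / L) * (Real.log ((⌊Real.exp (L * t)⌋₊ + 1 : ℕ) : ℝ) / L - t) :=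
    mul_nonneg (hG _ (by linarith)) (by linarith)
  by_cases hWY : W ≤ ⌊Real.exp (L * t)⌋₊
  · have h1 := gr_sum_ge hL hG hK2 W _ hWY
    have h0 := cop_lower hW ⌊Real.exp (L * t)⌋₊ (fun n => gr_nonneg hL hG n) (gr_anti hL hG hGa)
    have h9 : L * (K t - K 0) - Real.log ((W:ℝ)+1) ≤ ∑ n ∈ Ioc W ⌊Real.exp (L * t)⌋₊, gr L G n := by
      have := mul_le_mul_of_nonneg_left (show K t ≤ K (Real.log ((⌊Real.exp (L * t)⌋₊ + 1 : ℕ) : ℝ) / L) by linarith) hL.le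
      linarith
    have h10 := mul_le_mul_of_nonneg_left h9 hb0
    unfold Cop
    nlinarith
  · push Not at hWY
    have h11 : L * t ≤ Real.log ((W:ℝ)+1) := by
      rw [Real.le_log_iff_exp_le (by positivity)]
      refine (Nat.lt_floor_add_one _).le.trans ?_
      have : ((⌊Real.exp (L * t)⌋₊ : ℕ) : ℝ) ≤ W := by exact_mod_cast hWY.le
      linarith
    have h12 := hK2 0 t le_rfl ht
    rw [hG0, one_mul, sub_zero] at h12
    have h13 : L * (K t - K 0) ≤ Real.log ((W:ℝ)+1) := (mul_le_mul_of_nonneg_left h12 hL.le).trans h11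
    have h14 := mul_le_mul_of_nonneg_left h13 hb0
    nlinarith
end K

lemma K_one : (∀ a b : ℝ, 0 ≤ a → a ≤ b → (1:ℝ) * (b - a) ≤ b - a) ∧ (∀ a b : ℝ, 0 ≤ a → a ≤ b → b - a ≤ (1:ℝ) * (b - a)) :=
  ⟨fun a b _ _ => by simp, fun a b _ _ => by simp⟩

lemma K_gw {A : ℝ} (hA : 0 < A) : (∀ a b : ℝ, 0 ≤ a → a ≤ b → gw A b * (b - a) ≤ Real.log (1 + A * b) / A - Real.log (1 + A * a) / A) ∧
    (∀ a b : ℝ, 0 ≤ a → a ≤ b → Real.log (1 + A * b) / A - Real.log (1 + A * a) / A ≤ gw A a * (b - a)) := by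
  constructor
  · intro a b ha hab
    have h1 : 0 < 1 + A * a := by positivity
    have h2 : 0 < 1 + A * b := by nlinarith
    have := Real.log_le_sub_one_of_pos (x := (1 + A * a)/(1 + A * b)) (by positivity)
    rw [Real.log_div (by positivity) (by positivity)] at this
    have e : (1 + A * a)/(1 + A * b) - 1 = - A * (1 / (1 + A * b) * (b - a)) := by field_simp; ring
    unfold gw
    rw [← sub_div, le_div_iff₀ hA]
    linarith
  · intro a b ha hab
    have h1 : 0 < 1 + A * a := by positivity
    have h2 : 0 < 1 + A * b := by nlinarith
    have := Real.log_le_sub_one_of_pos (x := (1 + A * b)/(1 + A * a)) (by positivity)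
    rw [Real.log_div (by positivity) (by positivity)] at this
    have e : (1 + A * b)/(1 + A * a) - 1 = A * (1 / (1 + A * a) * (b - a)) := by field_simp; ring
    unfold gw
    rw [← sub_div, div_le_iff₀ hA]
    linarith

lemma K_gw2 {A : ℝ} (hA : 0 < A) : (∀ a b : ℝ, 0 ≤ a → a ≤ b → gw A b ^ 2 * (b - a) ≤ b / (1 + A * b) - a / (1 + A * a)) ∧
    (∀ a b : ℝ, 0 ≤ a → a ≤ b → b / (1 + A * b) - a / (1 + A * a) ≤ gw A a ^ 2 * (b - a)) := by
  have key : ∀ a b : ℝ, 0 ≤ a → a ≤ b → b / (1 + A * b) - a / (1 + A * a) = gw A a * gw A b * (b - a) := by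
    intro a b ha hab
    have h1 : 0 < 1 + A * a := by positivity
    have h2 : 0 < 1 + A * b := by nlinarith
    unfold gw
    rw [div_sub_div _ _ h2.ne' h1.ne', one_div_mul_one_div, one_div_mul_eq_div, div_eq_div_iff (by positivity) (by positivity)]; ring
  constructor
  · intro a b ha hab
    rw [key a b ha hab]
    have h1 := gw_anti hA.le ha hab
    have h2 := gw_nonneg hA.le (ha.trans hab)
    refine mul_le_mul_of_nonneg_right ?_ (by linarith)
    nlinarith
  · intro a b ha hab
    rw [key a b ha hab]
    have h1 := gw_anti hA.le ha hab
    have h2 := gw_nonneg hA.le ha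
    refine mul_le_mul_of_nonneg_right ?_ (by linarith)
    nlinarith
end GPY

namespace GPY

lemma sum_inv_sq_le (s : Finset ℕ) {w : ℕ} (hw : 2 ≤ w) (hs : ∀ n ∈ s, w < n) :
    ∑ n ∈ s, 1 / ((n:ℝ) - 1) ^ 2 ≤ 1 / ((w:ℝ) - 1) := by
  have hw' : (2:ℝ) ≤ w := by exact_mod_cast hw
  have key : ∀ Y, w ≤ Y → ∑ n ∈ Ioc w Y, 1 / ((n:ℝ) - 1) ^ 2 ≤ 1 / ((w:ℝ) - 1) - 1 / ((Y:ℝ) - 1) := by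
    intro Y hY
    induction Y, hY using Nat.le_induction with
    | base => simp
    | succ n hn ih =>
      rw [sum_Ioc_succ_top (by omega)]
      have hn' : (2:ℝ) ≤ n := by exact_mod_cast hw.trans hn
      have : 1 / (((n+1:ℕ):ℝ) - 1) ^ 2 ≤ 1 / ((n:ℝ) - 1) - 1 / (((n+1:ℕ):ℝ) - 1) := by
        push_cast
        rw [add_sub_cancel_right, div_sub_div _ _ (by linarith) (by linarith)]
        rw [div_le_div_iff₀ (by positivity) (by nlinarith)]
        nlinarith
      linarith
  obtain ⟨Y, hY⟩ := s.bddAbove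
  have h1 : s ⊆ Ioc w (max w Y) := fun n hn => by
    rw [mem_Ioc]; exact ⟨hs n hn, le_max_of_le_right (hY hn)⟩
  have h2 := key (max w Y) (le_max_left _ _)
  have h3 : (0:ℝ) ≤ 1 / (((max w Y : ℕ):ℝ) - 1) := by
    have : (w:ℝ) ≤ ((max w Y : ℕ):ℝ) := by exact_mod_cast le_max_left _ _
    exact one_div_nonneg.mpr (by linarith)
  have h4 := sum_le_sum_of_subset_of_nonneg h1 (f := fun n : ℕ => 1 / ((n:ℝ) - 1) ^ 2) fun n _ _ => by positivity
  linarith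

/-- Primes exceeding `w` that divide a nonzero number of size at most `X`. -/
lemma primes_dvd_card (s : Finset ℕ) (hs : ∀ p ∈ s, p.Prime) {w : ℕ} (hw : 1 ≤ w) (hsw : ∀ p ∈ s, w < p) {D : ℕ} (hD : 0 < D)
    (hd : ∀ p ∈ s, p ∣ D) {X : ℝ} (hX : (D:ℝ) ≤ X) : (s.card : ℝ) * Real.log w ≤ Real.log X := by
  have h1 : ∏ p ∈ s, p ∣ D := Finset.prod_primes_dvd D (fun p hp => (hs p hp).prime) hd
  have h2 : w ^ s.card ≤ ∏ p ∈ s, p := by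
    rw [← prod_const]; exact prod_le_prod' fun p hp => (hsw p hp).le
  have h3 : ((w:ℝ)) ^ s.card ≤ X := le_trans (by exact_mod_cast h2.trans (Nat.le_of_dvd hD h1)) hX
  have hw' : (1:ℝ) ≤ w := by exact_mod_cast hw
  have h4 := Real.log_le_log (by positivity) h3
  rwa [Real.log_pow] at h4

/-- the sieving primes attached to the tuple `U`. -/
def PU (w R : ℕ) (U : Finset ℕ) : Finset ℕ :=
  (Ioc w R).filter (fun p => p.Prime ∧ ∀ u ∈ U, ∀ u' ∈ U, u ≡ u' [MOD p] → u = u')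

lemma PU_prime {w R : ℕ} {U : Finset ℕ} : ∀ p ∈ PU w R U, p.Prime := fun p hp => (mem_filter.mp hp).2.1
lemma PU_inj {w R : ℕ} {U : Finset ℕ} : ∀ p ∈ PU w R U, ∀ u ∈ U, ∀ u' ∈ U, u ≡ u' [MOD p] → u = u' := fun p hp => (mem_filter.mp hp).2.2
lemma PU_gt {w R : ℕ} {U : Finset ℕ} : ∀ p ∈ PU w R U, w < p := fun p hp => (mem_Ioc.mp (mem_filter.mp hp).1).1
lemma PU_le {w R : ℕ} {U : Finset ℕ} : ∀ p ∈ PU w R U, p ≤ R := fun p hp => (mem_Ioc.mp (mem_filter.mp hp).1).2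

lemma PU_cop {w R : ℕ} {U : Finset ℕ} : ∀ p ∈ PU w R U, Nat.Coprime (primorial w) p := by
  intro p hp
  unfold primorial
  refine Nat.Coprime.prod_left fun q hq => ?_
  simp only [mem_filter, mem_range] at hq
  refine (Nat.coprime_primes hq.2 (PU_prime p hp)).mpr ?_
  have := PU_gt p hp
  omega

/-- bad primes -/
def BU (w R : ℕ) (U : Finset ℕ) : Finset ℕ :=
  (Ioc w R).filter (fun p => p.Prime ∧ ¬ ∀ u ∈ U, ∀ u' ∈ U, u ≡ u' [MOD p] → u = u')

lemma BU_sum {w R : ℕ} (hw : 1 ≤ w) {U : Finset ℕ} {X : ℝ} (hX1 : 1 ≤ X) (hX : ∀ u ∈ U, (u:ℝ) ≤ X) {σ : ℝ}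
    (hσ : (U.card:ℝ)^2 * Real.log X ≤ σ * (w * Real.log w)) (hlw : 0 < Real.log w) :
    ∑ p ∈ BU w R U, 1 / (p:ℝ) ≤ σ := by
  have hw' : (1:ℝ) ≤ w := by exact_mod_cast hw
  set F : ℕ × ℕ → Finset ℕ := fun z => (Ioc w R).filter (fun p => p.Prime ∧ z.2 < z.1 ∧ p ∣ z.1 - z.2) with hF
  have h1 : BU w R U ⊆ (U ×ˢ U).biUnion F := by
    intro p hp
    simp only [BU, mem_filter] at hp
    obtain ⟨hp0, hp1, hp2⟩ := hp
    push Not at hp2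
    obtain ⟨u, hu, u', hu', h, hne⟩ := hp2
    rw [mem_biUnion]
    rcases lt_or_gt_of_ne hne with hlt | hlt
    · refine ⟨(u', u), mem_product.mpr ⟨hu', hu⟩, ?_⟩
      simp only [hF, mem_filter]
      exact ⟨hp0, hp1, hlt, (Nat.modEq_iff_dvd' hlt.le).mp h⟩
    · refine ⟨(u, u'), mem_product.mpr ⟨hu, hu'⟩, ?_⟩
      simp only [hF, mem_filter]
      exact ⟨hp0, hp1, hlt, (Nat.modEq_iff_dvd' hlt.le).mp h.symm⟩
  have hFc : ∀ z ∈ U ×ˢ U, ((F z).card : ℝ) * Real.log w ≤ max (Real.log X) 0 := by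
    intro z hz
    by_cases hzz : z.2 < z.1
    · refine (primes_dvd_card (F z) (fun p hp => (mem_filter.mp hp).2.1) hw (fun p hp => (mem_Ioc.mp (mem_filter.mp hp).1).1)
        (Nat.sub_pos_of_lt hzz) (fun p hp => (mem_filter.mp hp).2.2.2) (X := X) ?_).trans (le_max_left _ _)
      refine le_trans ?_ (hX z.1 (mem_product.mp hz).1)
      exact_mod_cast Nat.sub_le _ _
    · have : F z = ∅ := by
        simp only [hF]; exact filter_eq_empty_iff.mpr fun p _ h => hzz h.2.1
      rw [this]; simp
  have hc : ((BU w R U).card : ℝ) * Real.log w ≤ (U.card:ℝ)^2 * Real.log X := by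
    have h2 : ((BU w R U).card : ℝ) ≤ ∑ z ∈ U ×ˢ U, ((F z).card : ℝ) := by
      exact_mod_cast (card_le_card h1).trans card_biUnion_le
    calc _ ≤ (∑ z ∈ U ×ˢ U, ((F z).card : ℝ)) * Real.log w := mul_le_mul_of_nonneg_right h2 hlw.le
      _ ≤ ∑ z ∈ U ×ˢ U, Real.log X := by
        rw [sum_mul]
        refine sum_le_sum fun z hz => (hFc z hz).trans (max_le le_rfl (Real.log_nonneg hX1))
      _ = _ := by rw [sum_const, card_product, nsmul_eq_mul]; push_cast; ring
  have h3 : ∑ p ∈ BU w R U, 1 / (p:ℝ) ≤ (BU w R U).card * (1 / (w:ℝ)) := by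
    rw [← nsmul_eq_mul]
    refine sum_le_card_nsmul _ _ _ fun p hp => ?_
    have : w < p := (mem_Ioc.mp (mem_filter.mp hp).1).1
    have : (w:ℝ) ≤ p := by exact_mod_cast this.le
    exact one_div_le_one_div_of_le (by linarith) this
  refine h3.trans ?_
  rw [mul_one_div, div_le_iff₀ (by linarith)]
  have h4 : ((BU w R U).card : ℝ) * Real.log w ≤ (σ * w) * Real.log w := by linarith
  exact le_of_mul_le_mul_right h4 hlw

/-- the standard parameters -/
noncomputable def xx (P : Finset ℕ) (L : ℝ) : P → ℝ := fun p => Real.log p / L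
noncomputable def vv (P : Finset ℕ) : P → ℝ := fun p => 1 / ((p:ℝ) - 1)
noncomputable def EW (W : ℕ) : ℝ := 2 + Real.log (W + 1)

section Est
variable {w R : ℕ} {U : Finset ℕ} {L : ℝ}

lemma pu_real {w R : ℕ} {U : Finset ℕ} (p : PU w R U) (hw : 2 ≤ w) : (3:ℝ) ≤ p := by
  have := PU_gt p.1 p.2
  exact_mod_cast (by omega : 3 ≤ p.1)

lemma xx_nonneg {P : Finset ℕ} (hL : 0 < L) : ∀ p, 0 ≤ xx P L p := fun p => div_nonneg (Real.log_natCast_nonneg _) hL.le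

lemma vv_nonneg (hw : 2 ≤ w) : ∀ p, 0 ≤ vv (PU w R U) p := fun p => by
  have := pu_real p hw
  exact one_div_nonneg.mpr (by linarith)

lemma vv_sq (hw : 2 ≤ w) : ∑ p, vv (PU w R U) p ^ 2 ≤ 1 / ((w:ℝ) - 1) := by
  refine le_trans (le_of_eq ?_) (sum_inv_sq_le (PU w R U) hw PU_gt)
  rw [← sum_coe_sort (PU w R U) (fun n => 1 / ((n:ℝ) - 1) ^ 2)]
  refine sum_congr rfl fun p _ => ?_
  unfold vv; rw [div_pow, one_pow]

lemma Est_up (hw : 3 ≤ w) (hL : 0 < L) {G K : ℝ → ℝ} (hG : ∀ t, 0 ≤ t → 0 ≤ G t) (hGa : ∀ s t, 0 ≤ s → s ≤ t → G t ≤ G s)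
    (hK1 : ∀ a b, 0 ≤ a → a ≤ b → G b * (b - a) ≤ K b - K a) (hG0 : G 0 = 1) {t : ℝ} (ht : 0 ≤ t) :
    Vs (xx (PU w R U) L) (vv (PU w R U)) t G ≤
      2 * ((Nat.totient (primorial w) : ℝ) / primorial w * L * (K t - K 0) + EW (primorial w)) := by
  set P := PU w R U with hP
  have hw2 : 2 ≤ w := by omega
  have hw3 : (3:ℝ) ≤ w := by exact_mod_cast hw
  set u : P → ℝ := fun p => 1 / (p:ℝ) with hu
  have hp3 : ∀ p : P, (3:ℝ) ≤ p := fun p => pu_real p hw2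
  have hu0 : ∀ p, 0 ≤ u p := fun p => by have := hp3 p; exact one_div_nonneg.mpr (by linarith)
  have h1 := Vs_le_mul (t := t) hu0 (vv_nonneg (R := R) (U := U) hw2) (xx_nonneg hL) (fun p => by
    have := hp3 p
    simp only [hu, vv]
    have h' : (p:ℝ) - 1 ≠ 0 := by linarith
    field_simp
    ring) hG hGa
  have h2 := Vs_le_Cop (P := P) PU_prime PU_cop hL (x := xx P L) (u := u) (fun p => rfl) (fun p => rfl) t hG
  have h3 := Cop_le hL hG hGa hK1 (primorial_pos w) ht hG0
  have h4 : ∏ p, (1 + u p * vv P p) ≤ 2 := by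
    have h5 : ∏ p, (1 + u p * vv P p) ≤ Real.exp (∑ p, u p * vv P p) := by
      rw [Real.exp_sum]
      refine prod_le_prod (fun p _ => by have := mul_nonneg (hu0 p) (vv_nonneg (R := R) (U := U) hw2 p); linarith) fun p _ => ?_
      rw [add_comm]; exact Real.add_one_le_exp _
    have h6 : ∑ p, u p * vv P p ≤ 1 / 2 := by
      calc _ ≤ ∑ p, vv P p ^ 2 := by
            refine sum_le_sum fun p _ => ?_
            rw [sq]
            refine mul_le_mul_of_nonneg_right ?_ (vv_nonneg (R := R) (U := U) hw2 p)
            have := hp3 p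
            exact one_div_le_one_div_of_le (by linarith) (by linarith)
        _ ≤ 1 / ((w:ℝ) - 1) := vv_sq hw2
        _ ≤ 1 / 2 := one_div_le_one_div_of_le (by norm_num) (by linarith)
    refine h5.trans ((Real.exp_le_exp.mpr h6).trans ?_)
    have := Real.exp_bound_div_one_sub_of_interval (x := 1/2) (by norm_num) (by norm_num)
    norm_num at this ⊢
    linarith
  have h0 : 0 ≤ Vs (xx P L) u t G := Vs_nonneg hu0 (xx_nonneg hL) hG
  calc _ ≤ _ := h1
    _ ≤ 2 * Vs (xx P L) u t G := mul_le_mul_of_nonneg_right h4 h0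
    _ ≤ _ := mul_le_mul_of_nonneg_left (h2.trans h3) (by norm_num)

lemma Est_lo (hw : 5 ≤ w) (hL : 0 < L) (hR : Real.exp L < R + 1) {X : ℝ} (hX1 : 1 ≤ X) (hX : ∀ u ∈ U, (u:ℝ) ≤ X)
    (hσ : (U.card:ℝ)^2 * Real.log X ≤ 1/4 * (w * Real.log w))
    {G K : ℝ → ℝ} (hG : ∀ t, 0 ≤ t → 0 ≤ G t) (hGa : ∀ s t, 0 ≤ s → s ≤ t → G t ≤ G s)
    (hK1 : ∀ a b, 0 ≤ a → a ≤ b → G b * (b - a) ≤ K b - K a)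
    (hK2 : ∀ a b, 0 ≤ a → a ≤ b → K b - K a ≤ G a * (b - a)) (hG0 : G 0 = 1) {t : ℝ} (ht : 0 ≤ t) (ht1 : t ≤ 1) :
    1/2 * ((Nat.totient (primorial w) : ℝ) / primorial w * L * (K t - K 0) - EW (primorial w)) ≤
    Vs (xx (PU w R U) L) (vv (PU w R U)) t G := by
  set P := PU w R U with hP
  have hw2 : 2 ≤ w := by omega
  have hw5 : (5:ℝ) ≤ w := by exact_mod_cast hw
  set u : P → ℝ := fun p => 1 / (p:ℝ) with hu
  have hp3 : ∀ p : P, (3:ℝ) ≤ p := fun p => pu_real p hw2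
  have hu0 : ∀ p, 0 ≤ u p := fun p => by have := hp3 p; exact one_div_nonneg.mpr (by linarith)
  have h0 := Vs_mono_v (v := vv P) (t := t) hu0 (fun p => by
    have := hp3 p
    exact one_div_le_one_div_of_le (by linarith) (by linarith)) (xx_nonneg hL) hG
  have h1 := Vs_ge_Cop (P := P) (W := primorial w) PU_prime hL (x := xx P L) (u := u) (fun p => rfl) (fun p => rfl) (t := t) hG hGa
    ((Ioc w R).filter Nat.Prime) (BU w R U) (fun p hp => (mem_filter.mp hp).2) (fun p hp => (mem_filter.mp hp).2.1)
    (fun p hp hpW hpe => by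
      have hwp : w < p := by
        by_contra hle
        push Not at hle
        have := (Nat.Prime.dvd_primorial_iff hp).mpr hle
        exact hp.one_lt.ne' (Nat.Coprime.eq_one_of_dvd hpW this)
      have hpR : p ≤ R := by
        have : (p:ℝ) < R + 1 := lt_of_le_of_lt (hpe.trans (Real.exp_le_exp.mpr (by nlinarith))) hR
        exact Nat.lt_succ_iff.mp (by exact_mod_cast this)
      refine ⟨mem_filter.mpr ⟨mem_Ioc.mpr ⟨hwp, hpR⟩, hp⟩, ?_⟩
      by_cases h : ∀ u ∈ U, ∀ u' ∈ U, u ≡ u' [MOD p] → u = u'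
      · exact Or.inl (mem_filter.mpr ⟨mem_Ioc.mpr ⟨hwp, hpR⟩, hp, h⟩)
      · exact Or.inr (mem_filter.mpr ⟨mem_Ioc.mpr ⟨hwp, hpR⟩, hp, h⟩))
    (τ := 1/4) (σ := 1/4) (by
      calc _ ≤ ∑ p ∈ (Ioc w R).filter Nat.Prime, 1 / ((p:ℝ) - 1)^2 := by
            refine sum_le_sum fun p hp => ?_
            have : 2 ≤ p := (mem_filter.mp hp).2.two_le
            have : (2:ℝ) ≤ p := by exact_mod_cast this
            have h1 : 0 < (p:ℝ) - 1 := by linarith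
            exact one_div_le_one_div_of_le (by positivity) (by nlinarith)
        _ ≤ 1 / ((w:ℝ) - 1) := sum_inv_sq_le _ hw2 fun p hp => (mem_Ioc.mp (mem_filter.mp hp).1).1
        _ ≤ 1 / 4 := one_div_le_one_div_of_le (by norm_num) (by linarith))
    (BU_sum (by omega) hX1 hX hσ (Real.log_pos (by linarith)))
  have h3 := Cop_ge hL hG hGa hK1 hK2 (primorial_pos w) ht hG0
  calc _ ≤ 1/2 * Cop (primorial w) L t G := mul_le_mul_of_nonneg_left h3 (by norm_num)
    _ = (1 - 1/4 - 1/4) * Cop (primorial w) L t G := by norm_num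
    _ ≤ _ := h1.trans h0

lemma PC_le (hw : 3 ≤ w) {κ : Type*} [Fintype κ] (hk : (Fintype.card κ : ℝ) ≤ 1/2 * ((w:ℝ) - 1)) :
    PC κ (fun p : PU w R U => ((p:ℕ):ℝ)) ≤ 2 := by
  have hw2 : 2 ≤ w := by omega
  have hw3 : (3:ℝ) ≤ w := by exact_mod_cast hw
  have hp3 : ∀ p : PU w R U, (3:ℝ) ≤ p := fun p => pu_real p hw2
  unfold PC
  have h5 : ∏ p : PU w R U, (1 + (Fintype.card κ : ℝ) / ((p:ℝ) * ((p:ℝ) - 1))) ≤ Real.exp (∑ p : PU w R U, (Fintype.card κ : ℝ) / ((p:ℝ) * ((p:ℝ) - 1))) := by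
    rw [Real.exp_sum]
    refine prod_le_prod (fun p _ => ?_) fun p _ => ?_
    · have := hp3 p
      have : 0 ≤ (Fintype.card κ : ℝ) / ((p:ℝ) * ((p:ℝ) - 1)) := div_nonneg (Nat.cast_nonneg _) (mul_nonneg (by linarith) (by linarith))
      linarith
    · rw [add_comm]; exact Real.add_one_le_exp _
  have h6 : ∑ p : PU w R U, (Fintype.card κ : ℝ) / ((p:ℝ) * ((p:ℝ) - 1)) ≤ 1 / 2 := by
    calc _ ≤ ∑ p : PU w R U, (Fintype.card κ : ℝ) * vv (PU w R U) p ^ 2 := by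
          refine sum_le_sum fun p _ => ?_
          have h7 := hp3 p
          rw [div_eq_mul_one_div]
          refine mul_le_mul_of_nonneg_left ?_ (Nat.cast_nonneg _)
          unfold vv
          rw [div_pow, one_pow]
          have h8 : 0 < (p:ℝ) - 1 := by linarith
          exact one_div_le_one_div_of_le (by positivity) (by nlinarith)
      _ ≤ (Fintype.card κ : ℝ) * (1 / ((w:ℝ) - 1)) := by
          rw [← mul_sum]; exact mul_le_mul_of_nonneg_left (vv_sq hw2) (Nat.cast_nonneg _)
      _ ≤ 1 / 2 := by
          rw [mul_one_div, div_le_iff₀ (by linarith)]; exact hk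
  refine h5.trans ((Real.exp_le_exp.mpr h6).trans ?_)
  have := Real.exp_bound_div_one_sub_of_interval (x := 1/2) (by norm_num) (by norm_num)
  norm_num at this ⊢
  linarith
end Est

end GPY

namespace GPY

lemma pow_dvd_fact (p m : ℕ) (hp : 0 < p) : p ^ m ∣ (p * m).factorial := by
  have h := Nat.prod_factorial_dvd_factorial_sum (range m) (fun _ => p)
  simp only [prod_const, card_range, sum_const, smul_eq_mul] at h
  rw [mul_comm p m]
  exact (pow_dvd_pow_of_dvd (Nat.dvd_factorial hp le_rfl) m).trans h

/-- Mertens upper bound. -/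
lemma mertens_le (n : ℕ) (hn : 1 ≤ n) :
    ∑ p ∈ Ioc 0 n with p.Prime, Real.log p / p ≤ Real.log n + Real.log 4 := by
  have hn' : (1:ℝ) ≤ n := by exact_mod_cast hn
  set S := (Ioc 0 n).filter Nat.Prime with hS
  have hSp : ∀ p ∈ S, p.Prime := fun p hp => (mem_filter.mp hp).2
  have h1 : ∏ p ∈ S, p ^ (n / p) ∣ n.factorial := by
    refine Finset.prod_dvd_of_isRelPrime ?_ ?_
    · intro p hp q hq hpq
      exact Nat.coprime_iff_isRelPrime.mp (Nat.Coprime.pow _ _ ((Nat.coprime_primes (hSp p hp) (hSp q hq)).mpr hpq))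
    · intro p hp
      exact (pow_dvd_fact p (n/p) (hSp p hp).pos).trans (Nat.factorial_dvd_factorial (Nat.mul_div_le n p))
  have h2 : ∏ p ∈ S, p ^ (n / p) ≤ n ^ n :=
    (Nat.le_of_dvd (Nat.factorial_pos n) h1).trans (Nat.factorial_le_pow n)
  have h3 : ∑ p ∈ S, ((n/p : ℕ):ℝ) * Real.log p ≤ n * Real.log n := by
    have h4 : ((∏ p ∈ S, p ^ (n / p) : ℕ) : ℝ) ≤ (n:ℝ) ^ n := by exact_mod_cast h2
    have h5 := Real.log_le_log (by exact_mod_cast prod_pos fun p hp => pow_pos (hSp p hp).pos _) h4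
    rw [Real.log_pow] at h5
    push_cast at h5
    rw [Real.log_prod (fun p hp => by have := (hSp p hp).pos; positivity)] at h5
    simpa only [Real.log_pow] using h5
  have h6 : ∑ p ∈ S, Real.log p ≤ Real.log 4 * n := by
    have := Chebyshev.theta_le_log4_mul_x (x := n) (by linarith)
    unfold Chebyshev.theta at this
    simpa [hS] using this
  have h7 : ∑ p ∈ S, ((n:ℝ) * (Real.log p / p) - Real.log p) ≤ ∑ p ∈ S, ((n/p : ℕ):ℝ) * Real.log p := by
    refine sum_le_sum fun p hp => ?_
    have hp0 : (0:ℝ) < p := by exact_mod_cast (hSp p hp).pos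
    have : (n:ℝ) / p ≤ ((n/p : ℕ):ℝ) + 1 := by
      rw [div_le_iff₀ hp0]
      have := Nat.lt_div_mul_add (a := n) (hSp p hp).pos
      have h' : (n:ℝ) ≤ ((n / p : ℕ):ℝ) * p + p := by exact_mod_cast this.le
      linarith
    have hl : 0 ≤ Real.log (p:ℝ) := Real.log_natCast_nonneg p
    have := mul_le_mul_of_nonneg_right this hl
    have e : (n:ℝ) * (Real.log p / p) = (n:ℝ)/p * Real.log p := by ring
    rw [e]; linarith
  rw [sum_sub_distrib, ← mul_sum] at h7
  have h8 : (n:ℝ) * ∑ p ∈ S, Real.log p / p ≤ n * (Real.log n + Real.log 4) := by linarith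
  exact le_of_mul_le_mul_left h8 (by linarith)

/-- The sum controlling the small prime factors. -/
lemma bad_sum {w R : ℕ} {U : Finset ℕ} (hw : 3 ≤ w) {L A k δ : ℝ} (hL : 0 < L) (hA : 0 ≤ A) (hk : 0 ≤ k) (hδ : 0 ≤ δ) :
    ∑ p : PU w R U, (if ((p:ℕ):ℝ) ≤ Real.exp (δ * L) then 1 / (p:ℝ) * ((1 + A) * xx (PU w R U) L p + k * vv (PU w R U) p)^2 else 0)
      ≤ 2 * (1 + A)^2 * (δ * (δ + Real.log 4 / L)) + 2 * k^2 * (1 / ((w:ℝ) - 1)) := by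
  have hw2 : 2 ≤ w := by omega
  have hp3 : ∀ p : PU w R U, (3:ℝ) ≤ p := fun p => pu_real p hw2
  have hpt : ∀ p : PU w R U, (if ((p:ℕ):ℝ) ≤ Real.exp (δ * L) then 1 / (p:ℝ) * ((1 + A) * xx (PU w R U) L p + k * vv (PU w R U) p)^2 else 0)
      ≤ 2 * (1+A)^2 * (δ / L) * (if ((p:ℕ):ℝ) ≤ Real.exp (δ * L) then Real.log p / p else 0) + 2 * k^2 * vv (PU w R U) p ^ 2 := by
    intro p
    have h3 := hp3 p
    split_ifs with h
    · have hlog : Real.log (p:ℝ) ≤ δ * L := by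
        rw [Real.log_le_iff_le_exp (by linarith)]; exact h
      have hl0 : 0 ≤ Real.log (p:ℝ) := Real.log_natCast_nonneg _
      have e1 : ((1 + A) * xx (PU w R U) L p + k * vv (PU w R U) p)^2 ≤ 2 * (1+A)^2 * xx (PU w R U) L p^2 + 2 * k^2 * vv (PU w R U) p^2 := by
        nlinarith [sq_nonneg ((1 + A) * xx (PU w R U) L p - k * vv (PU w R U) p)]
      have e2 : 1 / (p:ℝ) * xx (PU w R U) L p ^ 2 ≤ δ / L * (Real.log p / p) := by
        unfold xx
        have : 1 / (p:ℝ) * (Real.log p / L)^2 = (Real.log p * (1 / L^2 * (1/p))) * Real.log p := by field_simp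
        rw [this]
        have : δ / L * (Real.log (p:ℝ) / p) = (Real.log p * (1 / L^2 * (1/p))) * (δ * L) := by field_simp
        rw [this]
        exact mul_le_mul_of_nonneg_left hlog (by positivity)
      have e3 : 1 / (p:ℝ) ≤ 1 := by rw [div_le_one (by linarith)]; linarith
      have e4 : 0 ≤ 1 / (p:ℝ) := by positivity
      have e5 := mul_le_mul_of_nonneg_left e1 e4
      have e6 := mul_le_mul_of_nonneg_left e2 (show 0 ≤ 2 * (1+A)^2 by positivity)
      have e7 := mul_le_mul_of_nonneg_right e3 (show 0 ≤ 2 * k^2 * vv (PU w R U) p^2 by positivity)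
      nlinarith
    · positivity
  refine (sum_le_sum fun p _ => hpt p).trans ?_
  rw [sum_add_distrib, ← mul_sum, ← mul_sum]
  refine add_le_add ?_ (mul_le_mul_of_nonneg_left (vv_sq hw2) (by positivity))
  set z := ⌊Real.exp (δ * L)⌋₊ with hz
  have hexp : 1 ≤ Real.exp (δ * L) := Real.one_le_exp (by positivity)
  have hz1 : 1 ≤ z := Nat.le_floor (by simpa using hexp)
  have hzlog : Real.log z ≤ δ * L := by
    rw [Real.log_le_iff_le_exp (by exact_mod_cast hz1)]; exact Nat.floor_le (by linarith)
  have hm := mertens_le z hz1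
  have hs : ∑ p : PU w R U, (if ((p:ℕ):ℝ) ≤ Real.exp (δ * L) then Real.log (p:ℝ) / p else 0) ≤ δ * L + Real.log 4 := by
    rw [sum_coe_sort (PU w R U) (fun p : ℕ => if (p:ℝ) ≤ Real.exp (δ * L) then Real.log (p:ℝ) / p else 0), ← sum_filter]
    refine (sum_le_sum_of_subset_of_nonneg (t := (Ioc 0 z).filter Nat.Prime) ?_ fun p _ _ => div_nonneg (Real.log_natCast_nonneg _) (Nat.cast_nonneg _)).trans (by linarith)
    intro p hp
    rw [mem_filter] at hp
    rw [mem_filter, mem_Ioc]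
    exact ⟨⟨(PU_prime p hp.1).pos, Nat.le_floor hp.2⟩, PU_prime p hp.1⟩
  calc _ ≤ 2 * (1 + A)^2 * (δ / L) * (δ * L + Real.log 4) := mul_le_mul_of_nonneg_left hs (by positivity)
    _ = _ := by field_simp
end GPY

namespace GPY

/-- no sieving prime up to `z` divides any `n+u`. -/
def AP (w z : ℕ) (U : Finset ℕ) (n : ℕ) : Prop := ∀ p ∈ PU w z U, ∀ u ∈ U, ¬ p ∣ n + u

instance (w z : ℕ) (U : Finset ℕ) (n : ℕ) : Decidable (AP w z U n) := by unfold AP; infer_instance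

/-- at least two primes in the tuple -/
def Two (U : Finset ℕ) (n : ℕ) : Prop := ∃ u ∈ U, ∃ u' ∈ U, u ≠ u' ∧ (n+u).Prime ∧ (n+u').Prime

instance (U : Finset ℕ) (n : ℕ) : Decidable (Two U n) := by unfold Two; infer_instance

def SS (N M W b : ℕ) : Finset ℕ := (Ioc N (N+M)).filter (fun n => n ≡ b [MOD W])
def GS (N M W b w z : ℕ) (U : Finset ℕ) : Finset ℕ := (SS N M W b).filter (fun n => AP w z U n ∧ Two U n)

lemma theta_le {N n : ℕ} {l : ℝ} (hl : Real.log (3*N) ≤ l) (hl0 : 0 ≤ l) (hn : n ≤ 3*N) : theta n ≤ l := by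
  unfold theta
  split_ifs with h
  · refine (Real.log_le_log (by exact_mod_cast h.pos) ?_).trans hl
    exact_mod_cast hn
  · exact hl0

lemma bracket_le {N n w R z : ℕ} {U : Finset ℕ} {l : ℝ} (hl : Real.log (3*N) ≤ l) (hl0 : 0 ≤ l) (hn : ∀ u ∈ U, n + u ≤ 3*N)
    (hz : z ≤ R) (F : ℝ) (hF : 0 ≤ F) :
    F * ((∑ u : U, theta (n + u)) - l - U.card * l * ∑ p : PU w R U, ∑ i : U, (if (p:ℕ) ≤ z ∧ (p:ℕ) ∣ n + i then (1:ℝ) else 0))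
      ≤ if AP w z U n ∧ Two U n then F * (U.card * l) else 0 := by
  have hs : (∑ u : U, theta (n + u)) ≤ U.card * l := by
    refine (sum_le_card_nsmul (univ : Finset U) (fun u : U => theta (n + u)) l fun (u : U) _ => theta_le hl hl0 (hn u u.2)).trans ?_
    rw [card_univ, Fintype.card_coe, nsmul_eq_mul]
  have hb0 : ∀ (p : PU w R U) (i : U), (0:ℝ) ≤ (if (p:ℕ) ≤ z ∧ (p:ℕ) ∣ n + i then (1:ℝ) else 0) := fun p i => by split_ifs <;> norm_num
  have hB0 : 0 ≤ ∑ p : PU w R U, ∑ i : U, (if (p:ℕ) ≤ z ∧ (p:ℕ) ∣ n + i then (1:ℝ) else 0) :=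
    sum_nonneg fun p _ => sum_nonneg fun i _ => hb0 p i
  have hUl : (0:ℝ) ≤ U.card * l := by positivity
  by_cases hAP : AP w z U n
  · by_cases hT : Two U n
    · rw [if_pos ⟨hAP, hT⟩]
      refine mul_le_mul_of_nonneg_left ?_ hF
      have := mul_nonneg hUl hB0
      linarith
    · rw [if_neg (fun h => hT h.2)]
      have h1 : (∑ u : U, theta (n + u)) ≤ l := by
        by_cases hex : ∃ u : U, (n + (u:ℕ)).Prime
        · obtain ⟨u, hu⟩ := hex
          rw [sum_eq_single u]
          · exact theta_le hl hl0 (hn u u.2)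
          · intro u' _ hne
            unfold theta
            rw [if_neg]
            intro hp
            exact hT ⟨u, u.2, u', u'.2, fun h => hne (Subtype.ext h.symm), hu, hp⟩
          · simp
        · push Not at hex
          rw [sum_eq_zero fun u _ => by unfold theta; rw [if_neg (hex u)]]
          exact hl0
      have := mul_nonneg hUl hB0
      exact mul_nonpos_of_nonneg_of_nonpos hF (by linarith)
  · rw [if_neg (fun h => hAP h.1)]
    unfold AP at hAP
    push Not at hAP
    obtain ⟨p, hp, u, hu, hd⟩ := hAP
    have hpR : p ∈ PU w R U := by
      unfold PU at hp ⊢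
      rw [mem_filter, mem_Ioc] at hp ⊢
      exact ⟨⟨hp.1.1, hp.1.2.trans hz⟩, hp.2⟩
    have h1 : (1:ℝ) ≤ ∑ p : PU w R U, ∑ i : U, (if (p:ℕ) ≤ z ∧ (p:ℕ) ∣ n + i then (1:ℝ) else 0) := by
      refine le_trans ?_ (single_le_sum (f := fun p : PU w R U => ∑ i : U, (if (p:ℕ) ≤ z ∧ (p:ℕ) ∣ n + i then (1:ℝ) else 0)) (fun p _ => sum_nonneg fun i _ => hb0 p i) (mem_univ (⟨p, hpR⟩ : PU w R U)))
      refine le_trans ?_ (single_le_sum (f := fun i : U => (if p ≤ z ∧ p ∣ n + i then (1:ℝ) else 0)) (fun i _ => hb0 ⟨p, hpR⟩ i) (mem_univ (⟨u, hu⟩ : U)))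
      simp only
      rw [if_pos ⟨PU_le p hp, hd⟩]
    have := mul_le_mul_of_nonneg_left h1 hUl
    exact mul_nonpos_of_nonneg_of_nonpos hF (by linarith)

/-- upper bound for the detecting sum -/
lemma Q_upper {N M W b w R z : ℕ} {U : Finset ℕ} {l : ℝ} (hl : Real.log (3*N) ≤ l) (hl0 : 0 ≤ l)
    (hn : ∀ u ∈ U, N + M + u ≤ 3*N) (hz : z ≤ R) (f : ℕ → ℝ) {F : ℝ} (hF : ∀ n ∈ SS N M W b, AP w z U n → f n ^ 2 ≤ F) :
    (∑ u : U, ∑ n ∈ SS N M W b, theta (n + u) * f n ^ 2) - l * ∑ n ∈ SS N M W b, f n ^ 2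
      - U.card * l * ∑ p : PU w R U, ∑ i : U, (if (p:ℕ) ≤ z then
          ∑ n ∈ Ioc N (N+M) with (n ≡ b [MOD W] ∧ (p:ℕ) ∣ n + i), f n ^ 2 else 0) ≤ (GS N M W b w z U).card * (F * (U.card * l)) := by
  have e1 : (∑ u : U, ∑ n ∈ SS N M W b, theta (n + u) * f n ^ 2) = ∑ n ∈ SS N M W b, f n ^ 2 * ∑ u : U, theta (n + u) := by
    rw [sum_comm]
    refine sum_congr rfl fun n _ => ?_
    rw [mul_sum]
    exact sum_congr rfl fun u _ => mul_comm _ _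
  have e2 : ∑ p : PU w R U, ∑ i : U, (if (p:ℕ) ≤ z then ∑ n ∈ Ioc N (N+M) with (n ≡ b [MOD W] ∧ (p:ℕ) ∣ n + i), f n ^ 2 else 0)
      = ∑ n ∈ SS N M W b, f n ^ 2 * ∑ p : PU w R U, ∑ i : U, (if (p:ℕ) ≤ z ∧ (p:ℕ) ∣ n + i then (1:ℝ) else 0) := by
    simp_rw [mul_sum]
    symm
    rw [sum_comm]
    refine sum_congr rfl fun p _ => ?_
    rw [sum_comm]
    refine sum_congr rfl fun i _ => ?_
    symm
    split_ifs with h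
    · rw [← filter_filter, sum_filter]
      refine sum_congr rfl fun n _ => ?_
      by_cases hd : (p:ℕ) ∣ n + i <;> simp [h, hd]
    · symm
      refine sum_eq_zero fun n _ => by simp [h]
  rw [e1, e2]
  have e3 : (∑ n ∈ SS N M W b, f n ^ 2 * ∑ u : U, theta (n + u)) - l * ∑ n ∈ SS N M W b, f n ^ 2 - U.card * l * ∑ n ∈ SS N M W b, f n ^ 2 * ∑ p : PU w R U, ∑ i : U, (if (p:ℕ) ≤ z ∧ (p:ℕ) ∣ n + i then (1:ℝ) else 0)
      = ∑ n ∈ SS N M W b, f n ^ 2 * ((∑ u : U, theta (n + u)) - l - U.card * l * ∑ p : PU w R U, ∑ i : U, (if (p:ℕ) ≤ z ∧ (p:ℕ) ∣ n + i then (1:ℝ) else 0)) := by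
    rw [mul_sum, mul_sum, ← sum_sub_distrib, ← sum_sub_distrib]
    exact sum_congr rfl fun n _ => by ring
  rw [e3]
  calc _ ≤ ∑ n ∈ SS N M W b, if AP w z U n ∧ Two U n then f n ^ 2 * (U.card * l) else 0 := by
        refine sum_le_sum fun n hnS => bracket_le hl hl0 (fun u hu => ?_) hz _ (sq_nonneg _)
        have h1 := (mem_Ioc.mp (mem_filter.mp hnS).1).2
        have h2 := hn u hu
        omega
    _ = ∑ n ∈ GS N M W b w z U, f n ^ 2 * (U.card * l) := by rw [← sum_filter]; rfl
    _ ≤ ∑ n ∈ GS N M W b w z U, F * (U.card * l) := by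
        refine sum_le_sum fun n hn => ?_
        have := mem_filter.mp hn
        exact mul_le_mul_of_nonneg_right (hF n this.1 this.2.1) (by positivity)
    _ = _ := by rw [sum_const, nsmul_eq_mul]

/-- pointwise bound when there is no small prime factor -/
lemma Dn_card {N n w R z : ℕ} {U : Finset ℕ} {y l : ℝ} {s : ℕ} (hl : Real.log (3*N) ≤ l) (hy : 0 < y) (hs : l ≤ s * y)
    (hz : Real.exp y < z + 1) (hAP : AP w z U n) (i : U) (hn0 : 0 < n) (hn : n + i ≤ 3*N) : (Dn (PU w R U) U n i).card ≤ s := by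
  set D := (Dn (PU w R U) U n i).map (Function.Embedding.subtype _) with hD
  have hDm : ∀ p ∈ D, p ∈ PU w R U ∧ p ∣ n + i := by
    intro p hp
    rw [hD, mem_map] at hp
    obtain ⟨q, hq, rfl⟩ := hp
    exact ⟨q.2, (mem_filter.mp hq).2⟩
  have hgt : ∀ p ∈ D, z < p := by
    intro p hp
    by_contra hle
    push Not at hle
    obtain ⟨h1, h2⟩ := hDm p hp
    refine hAP p ?_ i i.2 h2
    unfold PU at h1 ⊢
    rw [mem_filter, mem_Ioc] at h1 ⊢
    exact ⟨⟨h1.1.1, hle⟩, h1.2⟩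
  have h3 := Finset.prod_primes_dvd (n + i) (fun p hp => (PU_prime p (hDm p hp).1).prime) (fun p hp => (hDm p hp).2)
  have h4 : (Real.exp y) ^ D.card ≤ ((∏ p ∈ D, p : ℕ) : ℝ) := by
    push_cast
    rw [← prod_const]
    refine prod_le_prod (fun _ _ => (Real.exp_pos _).le) fun p hp => ?_
    have : z + 1 ≤ p := hgt p hp
    have : ((z:ℝ) + 1) ≤ p := by exact_mod_cast this
    linarith
  have h5 : (Real.exp y) ^ D.card ≤ 3 * N := h4.trans (by exact_mod_cast (Nat.le_of_dvd (by omega) h3).trans hn)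
  have h6 := Real.log_le_log (by positivity) h5
  rw [Real.log_pow, Real.log_exp] at h6
  have h7 : (D.card:ℝ) * y ≤ s * y := by linarith
  have h8 : (D.card:ℝ) ≤ s := le_of_mul_le_mul_right h7 hy
  have : D.card = (Dn (PU w R U) U n i).card := card_map _
  rw [← this]
  exact_mod_cast h8
end GPY

namespace GPY

noncomputable def be (w : ℕ) : ℝ := (Nat.totient (primorial w) : ℝ) / primorial w

lemma be_pos (w : ℕ) : 0 < be w := by
  have h1 := primorial_pos w
  have h2 := Nat.totient_pos.mpr h1
  unfold be; positivity

lemma be_le (w : ℕ) : be w ≤ 1 := by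
  have h1 : (0:ℝ) < primorial w := by exact_mod_cast primorial_pos w
  unfold be
  rw [div_le_one h1]; exact_mod_cast Nat.totient_le _

structure Env (k : ℕ) (ε : ℝ) (N w : ℕ) (L : ℝ) : Prop where
  hN : 3 ≤ N
  hw : 5 ≤ w
  hwε : 1/((w:ℝ)-1) ≤ ε
  hσ : (k:ℝ)^2 * Real.log (Real.log N) ≤ 1/4*(w*Real.log w)
  hL : 1 ≤ L
  hlog : Real.log (3*N) ≤ 9*L
  hE : EW (primorial w) ≤ ε*(be w*L)
  hL4 : Real.log 4/L ≤ ε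
  hX : primorial w * Real.exp (L*2) ≤ (N:ℝ)^(1/2:ℝ)
  hexpN : Real.exp L ≤ N

lemma EW_ge (W : ℕ) : 2 ≤ EW W := by
  unfold EW
  have : 0 ≤ Real.log ((W:ℝ)+1) := Real.log_nonneg (by linarith [Nat.cast_nonneg (α := ℝ) W])
  linarith

lemma Env.logN {k : ℕ} {ε : ℝ} {N w : ℕ} {L : ℝ} (e : Env k ε N w L) : 1 ≤ Real.log N := by
  have : (3:ℝ) ≤ N := by exact_mod_cast e.hN
  rw [Real.le_log_iff_exp_le (by linarith)]
  linarith [Real.exp_one_lt_d9]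

lemma Vs_smul {ι : Type*} [Fintype ι] [DecidableEq ι] {x v : ι → ℝ} (t c : ℝ) (G : ℝ → ℝ) :
    Vs x v t (fun s => c * G s) = c * Vs x v t G := by
  unfold Vs
  rw [mul_sum]
  refine sum_congr rfl fun S _ => ?_
  unfold cut; split_ifs
  · ring
  · simp

section
variable {k : ℕ} {ε : ℝ} {N w : ℕ} {L : ℝ} {U : Finset ℕ} {A : ℝ} {R : ℕ}

lemma gw_zero (A : ℝ) : gw A 0 = 1 := by simp [gw]
lemma gw2_zero (A : ℝ) : gw A 0 ^ 2 = 1 := by simp [gw]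

lemma gw2_anti (hA : 0 ≤ A) : ∀ s t, 0 ≤ s → s ≤ t → gw A t ^ 2 ≤ gw A s ^ 2 := fun s t hs hst =>
  pow_le_pow_left₀ (gw_nonneg hA (hs.trans hst)) (gw_anti hA hs hst) 2

lemma Env.V1 (e : Env k ε N w L) (hε : ε ≤ 1) : Vs (xx (PU w R U) L) (vv (PU w R U)) 1 (fun _ => 1) ≤ 4 * (be w * L) := by
  have h := Est_up (w := w) (R := R) (U := U) (by have := e.hw; omega) (by linarith [e.hL]) (G := fun _ => 1) (K := fun t => t) (L := L)
    (fun _ _ => zero_le_one) (fun _ _ _ _ => le_rfl) K_one.1 rfl (t := 1) zero_le_one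
  have h2 := e.hE
  have hb : 0 ≤ be w * L := mul_nonneg (be_pos w).le (by linarith [e.hL])
  change _ ≤ 2 * (be w * L * _ + _) at h
  have := mul_le_mul_of_nonneg_right hε hb
  simp only [sub_zero, mul_one] at h
  linarith

lemma Env.V2 (e : Env k ε N w L) (hε : ε ≤ 1) : Vs (xx (PU w R U) L) (vv (PU w R U)) 2 (fun _ => 1) ≤ 8 * L := by
  have h := Est_up (w := w) (R := R) (U := U) (by have := e.hw; omega) (by linarith [e.hL]) (G := fun _ => 1) (K := fun t => t) (L := L)
    (fun _ _ => zero_le_one) (fun _ _ _ _ => le_rfl) K_one.1 rfl (t := 2) zero_le_two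
  have h2 := e.hE
  have hL0 : 0 ≤ L := by linarith [e.hL]
  have hb : 0 ≤ be w * L := mul_nonneg (be_pos w).le (by linarith [e.hL])
  have hb1 : be w * L ≤ L := by nlinarith [be_le w]
  change _ ≤ 2 * (be w * L * _ + _) at h
  have := mul_le_mul_of_nonneg_right hε hb
  simp only [sub_zero] at h
  linarith

lemma Env.I2up (e : Env k ε N w L) (hA : 1 ≤ A) (hε : ε ≤ 1 / (4*(1+A))) :
    Vs (xx (PU w R U) L) (vv (PU w R U)) 1 (fun t => gw A t ^ 2) ≤ 4 * (be w * L) / A := by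
  have hA0 : 0 < A := by linarith
  have h := Est_up (w := w) (R := R) (U := U) (by have := e.hw; omega) (by linarith [e.hL]) (G := fun t => gw A t^2) (K := fun t => t/(1+A*t)) (L := L)
    (fun _ _ => sq_nonneg _) (gw2_anti hA0.le) (K_gw2 hA0).1 (gw2_zero A) (t := 1) zero_le_one
  have h2 := e.hE
  have hb : 0 ≤ be w * L := mul_nonneg (be_pos w).le (by linarith [e.hL])
  change _ ≤ 2 * (be w * L * _ + _) at h
  have h3 := mul_le_mul_of_nonneg_right hε hb
  simp only [mul_one, zero_div, sub_zero] at h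
  have h4 : 1 / (1 + A) ≤ 1 / A := one_div_le_one_div_of_le hA0 (by linarith)
  have h5 : 1 / (4 * (1 + A)) ≤ 1 / A := one_div_le_one_div_of_le hA0 (by linarith)
  have h6 := mul_le_mul_of_nonneg_left h4 hb
  have h7 := mul_le_mul_of_nonneg_right h5 hb
  have : 4 * (be w * L) / A = 2 * (be w * L * (1 / A) + (1/A) * (be w * L)) := by ring
  rw [this]
  linarith

lemma Env.J (e : Env k ε N w L) (hA : 1 ≤ A) (hε : ε ≤ Real.log (1 + A/4) / (2 * A)) :
    Vs (xx (PU w R U) L) (vv (PU w R U)) 1 (fun t => t * gw A t ^ 2) ≤ 4 * (be w * L) * Real.log (1 + A) / A^2 := by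
  have hA0 : 0 < A := by linarith
  have hL0 : 0 < L := by linarith [e.hL]
  have h := Est_up (w := w) (R := R) (U := U) (by have := e.hw; omega) (by linarith [e.hL]) (G := gw A) (K := fun t => Real.log (1 + A * t) / A) (L := L)
    (fun _ ht => gw_nonneg hA0.le ht) (fun s t hs hst => gw_anti hA0.le hs hst) (K_gw hA0).1 (gw_zero A) (t := 1) zero_le_one
  have hm : Vs (xx (PU w R U) L) (vv (PU w R U)) 1 (fun t => t * gw A t ^ 2) ≤ Vs (xx (PU w R U) L) (vv (PU w R U)) 1 (fun t => 1/A * gw A t) := by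
    refine Vs_mono_G (vv_nonneg (by have := e.hw; omega)) (xx_nonneg hL0) fun t ht => ?_
    have h1 := gw_nonneg hA0.le ht
    have : t * gw A t ≤ 1 / A := by
      unfold gw
      rw [mul_one_div, div_le_div_iff₀ (by positivity) hA0]; linarith
    nlinarith
  rw [Vs_smul] at hm
  have h2 := e.hE
  have hb : 0 ≤ be w * L := mul_nonneg (be_pos w).le (by linarith [e.hL])
  change _ ≤ 2 * (be w * L * _ + _) at h
  have h3 := mul_le_mul_of_nonneg_right hε hb
  simp only [mul_one, mul_zero, add_zero, Real.log_one, zero_div, sub_zero] at h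
  have hlog : Real.log (1 + A/4) ≤ Real.log (1 + A) := Real.log_le_log (by linarith) (by linarith)
  have hlog0 : 0 ≤ Real.log (1 + A/4) := Real.log_nonneg (by linarith)
  have h4 : Real.log (1 + A/4) / (2 * A) ≤ Real.log (1 + A) / A := by
    rw [div_le_div_iff₀ (by positivity) hA0]; nlinarith
  have h5 := mul_le_mul_of_nonneg_right h4 hb
  have h6 : Vs (xx (PU w R U) L) (vv (PU w R U)) 1 (gw A) ≤ 4 * (be w * L) * (Real.log (1 + A) / A) := by linarith
  calc _ ≤ _ := hm
    _ ≤ 1/A * (4 * (be w * L) * (Real.log (1 + A) / A)) := mul_le_mul_of_nonneg_left h6 (by positivity)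
    _ = _ := by field_simp

lemma Env.I2lo (e : Env k ε N w L) (hUk : U.card ≤ k) (hUX : ∀ u ∈ U, (u:ℝ) ≤ Real.log N) (hR : Real.exp L < R + 1) (hA : 1 ≤ A) (hε : ε ≤ 1 / (4*(1+A))) :
    be w * L / (4 * (1+A)) ≤ Vs (xx (PU w R U) L) (vv (PU w R U)) 1 (fun t => gw A t ^ 2) := by
  have hA0 : 0 < A := by linarith
  have h := Est_lo (w := w) (R := R) (U := U) e.hw (by linarith [e.hL]) hR e.logN hUX (by
      refine le_trans (mul_le_mul_of_nonneg_right ?_ (Real.log_nonneg e.logN)) e.hσ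
      have : (U.card:ℝ) ≤ k := by exact_mod_cast hUk
      exact pow_le_pow_left₀ (Nat.cast_nonneg _) this 2)
    (G := fun t => gw A t^2) (K := fun t => t/(1+A*t)) (L := L)
    (fun _ _ => sq_nonneg _) (gw2_anti hA0.le) (K_gw2 hA0).1 (K_gw2 hA0).2 (gw2_zero A) (t := 1) zero_le_one le_rfl
  have h2 := e.hE
  have hb : 0 ≤ be w * L := mul_nonneg (be_pos w).le (by linarith [e.hL])
  change 1/2 * (be w * L * _ - _) ≤ _ at h
  have h3 := mul_le_mul_of_nonneg_right hε hb
  simp only [mul_one, zero_div, sub_zero] at h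
  have e1 : 1/2 * (be w * L * (1 / (1 + A)) - 1 / (4*(1+A)) * (be w * L)) = 3/8 * (be w * L / (1+A)) := by field_simp; ring
  have e2 : be w * L / (4 * (1+A)) = 1/4 * (be w * L / (1+A)) := by field_simp
  have e3 : 0 ≤ be w * L / (1+A) := div_nonneg hb (by linarith)
  rw [e2]
  linarith

lemma Env.I1 (e : Env k ε N w L) (hUk : U.card ≤ k) (hUX : ∀ u ∈ U, (u:ℝ) ≤ Real.log N) (hR : Real.exp L < R + 1) (hA : 1 ≤ A)
    (hε : ε ≤ Real.log (1 + A/4) / (2 * A)) :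
    1/4 * (be w * L) * (Real.log (1 + A/4) / A) ≤ Vs (xx (PU w R U) L) (vv (PU w R U)) (1/4) (gw A) := by
  have hA0 : 0 < A := by linarith
  have h := Est_lo (w := w) (R := R) (U := U) e.hw (by linarith [e.hL]) hR e.logN hUX (by
      refine le_trans (mul_le_mul_of_nonneg_right ?_ (Real.log_nonneg e.logN)) e.hσ
      have : (U.card:ℝ) ≤ k := by exact_mod_cast hUk
      exact pow_le_pow_left₀ (Nat.cast_nonneg _) this 2)
    (G := gw A) (K := fun t => Real.log (1 + A * t) / A) (L := L)
    (fun _ ht => gw_nonneg hA0.le ht) (fun s t hs hst => gw_anti hA0.le hs hst) (K_gw hA0).1 (K_gw hA0).2 (gw_zero A) (t := 1/4) (by norm_num) (by norm_num)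
  have h2 := e.hE
  have hb : 0 ≤ be w * L := mul_nonneg (be_pos w).le (by linarith [e.hL])
  change 1/2 * (be w * L * _ - _) ≤ _ at h
  have h3 := mul_le_mul_of_nonneg_right hε hb
  simp only [mul_one, mul_zero, add_zero, Real.log_one, zero_div, sub_zero, mul_one_div] at h
  have e1 : 1/2 * (be w * L * (Real.log (1 + A/4) / A) - Real.log (1 + A/4) / (2 * A) * (be w * L)) = 1/4 * (be w * L) * (Real.log (1 + A/4) / A) := by field_simp; ring
  linarith
end
end GPY

namespace GPY

structure Num (k : ℕ) (A δ ε : ℝ) (s : ℕ) : Prop where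
  hk : 1 ≤ k
  hA : 1 ≤ A
  hδ : 0 < δ
  hδ1 : δ ≤ 1
  hε0 : 0 < ε
  hε1 : ε ≤ 1 / (4*(1+A))
  hε2 : ε ≤ Real.log (1 + A/4) / (2 * A)
  hk1 : k * (64*(1+A)*Real.log (1+A)/A^2) ≤ 1/4
  hk2 : 5*(k:ℝ)^2*ε ≤ 1/4
  hk3 : 51200*A ≤ k*Real.log (1+A/4)^2
  hbad : 18*k*(16*(1+A))^k*(k*(2*(1+A)^2*(δ*(δ+ε))+2*(k:ℝ)^2*ε)) ≤ 1
  hs : 9 ≤ s*δ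

lemma Num.ε1 {k : ℕ} {A δ ε : ℝ} {s : ℕ} (n : Num k A δ ε s) : ε ≤ 1 := by
  have h1 := n.hε1
  have h2 : 1 / (4*(1+A)) ≤ 1 := by
    rw [div_le_one (by linarith [n.hA])]; linarith [n.hA]
  linarith

lemma cw_bound {ι κ : Type*} [Fintype ι] [DecidableEq ι] [Fintype κ] [DecidableEq κ] {x : ι → ℝ} {A : ℝ} (hA : 0 ≤ A)
    (hx : ∀ p, 0 ≤ x p) (s : ι → Option κ) : |cw A x s| ≤ if tot x s ≤ 1 then 1 else 0 := by
  unfold cw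
  rw [abs_mul, abs_mu, one_mul, abs_of_nonneg (Fw_nonneg hA hx s)]
  exact Fw_le_ind hA hx s

noncomputable def lamc (w R : ℕ) (U : Finset ℕ) (L A : ℝ) : ((PU w R U) → Option U) → ℝ :=
  tr (fun p : PU w R U => lT ((p:ℕ):ℝ)) (cw A (xx (PU w R U) L))

noncomputable def err1 (k : ℕ) (L : ℝ) : ℝ := (Real.exp L * ((4*L)^k)^2)^2
noncomputable def err2 (k j N : ℕ) (L T B C : ℝ) : ℝ :=
  ((4*L)^k)^2 * (T*(6*C*N/(Real.log N)^B) + (18*N*Real.log (3*N))/T * (8*L)^(2^j))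

section
variable {k : ℕ} {ε : ℝ} {N w : ℕ} {L : ℝ} {U : Finset ℕ} {A δ : ℝ} {R s : ℕ}

lemma Env.kw (e : Env k ε N w L) (n : Num k A δ ε s) : (k:ℝ) ≤ 1/20*((w:ℝ)-1) := by
  have h1 := e.hwε
  have h2 := n.hk2
  have hw : (5:ℝ) ≤ w := by exact_mod_cast e.hw
  have hk : (1:ℝ) ≤ k := by exact_mod_cast n.hk
  rw [div_le_iff₀ (by linarith)] at h1
  have h3 : 5*(k:ℝ)^2 ≤ 1/4*((w:ℝ)-1) := by
    have := mul_le_mul_of_nonneg_right h2 (show (0:ℝ) ≤ (w:ℝ)-1 by linarith)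
    have h4 : 5*(k:ℝ)^2*1 ≤ 5*(k:ℝ)^2*(ε*((w:ℝ)-1)) := mul_le_mul_of_nonneg_left h1 (by positivity)
    linarith
  nlinarith

lemma Env.Y (e : Env k ε N w L) (hε : ε ≤ 1) (hU : U.card = k) : Ys U (xx (PU w R U) L) (vv (PU w R U)) 1 ≤ (4*(be w*L))^k := by
  have hL0 : 0 < L := by linarith [e.hL]
  have hw2 : 2 ≤ w := by have := e.hw; omega
  refine (Ys_le (vv_nonneg hw2) (xx_nonneg hL0)).trans ?_
  rw [Fintype.card_coe, hU]
  exact pow_le_pow_left₀ (Vs_nonneg (vv_nonneg hw2) (xx_nonneg hL0) (fun _ _ => zero_le_one)) (e.V1 hε) k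

lemma Env.Y' (e : Env k ε N w L) (hε : ε ≤ 1) (hU : U.card = k) : Ys U (xx (PU w R U) L) (vv (PU w R U)) 1 ≤ (4*L)^k := by
  have hL0 : 0 < L := by linarith [e.hL]
  refine (e.Y hε hU).trans (pow_le_pow_left₀ ?_ ?_ k)
  · have := be_pos w; positivity
  · nlinarith [be_le w]

lemma q2 (hw : 5 ≤ w) : ∀ p : PU w R U, (2:ℝ) ≤ ((p:ℕ):ℝ) := fun p => by
  have := pu_real p (by omega : 2 ≤ w); linarith

lemma Env.kq (e : Env k ε N w L) (n : Num k A δ ε s) (hU : U.card = k) : ∀ p : PU w R U, (Fintype.card U : ℝ) ≤ ((p:ℕ):ℝ) - 1 := fun p => by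
  rw [Fintype.card_coe, hU]
  have h1 := e.kw n
  have h2 : (w:ℝ) < ((p:ℕ):ℝ) := by exact_mod_cast PU_gt p p.2
  have hw : (5:ℝ) ≤ w := by exact_mod_cast e.hw
  linarith

lemma Env.PC2 (e : Env k ε N w L) (n : Num k A δ ε s) (hU : U.card = k) : PC U (fun p : PU w R U => ((p:ℕ):ℝ)) ≤ 2 := by
  refine PC_le (by have := e.hw; omega) ?_
  rw [Fintype.card_coe, hU]
  have h1 := e.kw n
  have hw : (5:ℝ) ≤ w := by exact_mod_cast e.hw
  linarith

lemma vvq : ∀ p : PU w R U, vv (PU w R U) p = 1 / (((p:ℕ):ℝ) - 1) := fun p => rfl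

lemma Env.lam1 (e : Env k ε N w L) (n : Num k A δ ε s) (hU : U.card = k) :
    (∑ d, |lamc w R U L A d|)^2 ≤ err1 k L := by
  have hL0 : 0 < L := by linarith [e.hL]
  have hw2 : 2 ≤ w := by have := e.hw; omega
  have h := sum_lam_le (κ := U) (xx_nonneg hL0) (q2 (R := R) (U := U) e.hw) vvq hL0 (fun p => rfl)
    (cw_bound (by linarith [n.hA] : 0 ≤ A) (xx_nonneg (P := PU w R U) hL0))
  unfold err1
  refine pow_le_pow_left₀ (sum_nonneg fun _ _ => abs_nonneg _) (h.trans ?_) 2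
  refine mul_le_mul_of_nonneg_left ?_ (Real.exp_pos _).le
  refine pow_le_pow_left₀ ?_ (e.Y' n.ε1 hU) 2
  have := one_le_Ys (κ := U) (vv_nonneg (R := R) (U := U) hw2) (xx_nonneg hL0) (t := 1) zero_le_one
  exact le_trans zero_le_one this

lemma Env.S1 (e : Env k ε N w L) (n : Num k A δ ε s) (hU : U.card = k) (M b : ℕ) :
    ∑ n ∈ SS N M (primorial w) b, fval (lamc w R U L A) (Dn (PU w R U) U n) ^ 2 ≤
     (M:ℝ) / primorial w * (2 * Vs (xx (PU w R U) L) (vv (PU w R U)) 1 (fun t => gw A t ^ 2)^k) + err1 k L := by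
  have hL0 : 0 < L := by linarith [e.hL]
  have hw2 : 2 ≤ w := by have := e.hw; omega
  have hA0 : 0 ≤ A := by linarith [n.hA]
  refine (moment_S1 PU_prime (primorial_pos w) b PU_cop PU_inj N M (lamc w R U L A)).trans ?_
  refine add_le_add (mul_le_mul_of_nonneg_left ?_ (by positivity)) (e.lam1 n hU)
  refine (S1_qf (q2 e.hw) (fun p => by linarith [e.kq (R := R) n hU p]) _).trans ?_
  refine (S1_main hA0 (xx_nonneg hL0) (q2 e.hw) vvq).trans ?_
  rw [Fintype.card_coe, hU]
  exact mul_le_mul_of_nonneg_right (e.PC2 n hU) (pow_nonneg (Vs_nonneg (vv_nonneg hw2) (xx_nonneg hL0) fun _ _ => sq_nonneg _) k)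

lemma Env.Bad (e : Env k ε N w L) (n : Num k A δ ε s) (hU : U.card = k) (M b : ℕ) (p : PU w R U) (i : U) :
    ∑ n ∈ Ioc N (N+M) with (n ≡ b [MOD primorial w] ∧ (p:ℕ) ∣ n + i), fval (lamc w R U L A) (Dn (PU w R U) U n) ^ 2 ≤
     (M:ℝ) / primorial w * (2 * (4*(be w*L))^k) * (1 / (p:ℝ) * ((1 + A) * xx (PU w R U) L p + k * vv (PU w R U) p)^2) + err1 k L := by
  have hL0 : 0 < L := by linarith [e.hL]
  have hw2 : 2 ≤ w := by have := e.hw; omega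
  have hA0 : 0 ≤ A := by linarith [n.hA]
  refine (moment_bad PU_prime (primorial_pos w) b PU_cop PU_inj N M (lamc w R U L A) p i).trans ?_
  refine add_le_add ?_ (e.lam1 n hU)
  rw [mul_assoc]
  refine mul_le_mul_of_nonneg_left ?_ (by positivity)
  refine (Bad_main hA0 (xx_nonneg hL0) (q2 e.hw) vvq (fun p => by linarith [e.kq (R := R) n hU p]) p i).trans ?_
  rw [Fintype.card_coe, hU, mul_comm]
  refine mul_le_mul_of_nonneg_right ?_ (by positivity)
  have hY := e.Y (R := R) n.ε1 hU
  have hY1 := one_le_Ys (κ := U) (vv_nonneg (R := R) (U := U) hw2) (xx_nonneg hL0) (t := 1) zero_le_one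
  exact mul_le_mul (e.PC2 n hU) hY (by linarith) (by norm_num)

lemma Env.S2 (e : Env k ε N w L) (n : Num k A δ ε s) (hU : U.card = k) (hUX : ∀ u ∈ U, (u:ℝ) ≤ Real.log N) (hR : Real.exp L < R + 1)
    (hRN : R ≤ N) (M b : ℕ) (hM : M ≤ N) (m : U) (hbm : Nat.Coprime (b + m) (primorial w))
    {B C T : ℝ} (hB : 0 < B) (hC : 0 < C)
    (hlev : ∀ X : ℕ, 2 ≤ X → ∑ q ∈ Icc 1 ⌊(X:ℝ) ^ (1/2:ℝ)⌋₊, EE X q ≤ C * X / (Real.log X) ^ B)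
    (hT : 0 < T) {j : ℕ} (hj : ((k + 1) ^ 4 : ℝ) ≤ 2 ^ j) :
    (M:ℝ) / primorial w * (L * (1/1280 * Real.log (1+A/4)^2/A) * Vs (xx (PU w R U) L) (vv (PU w R U)) 1 (fun t => gw A t ^ 2)^k)
      - err2 k j N L T B C ≤
    ∑ n ∈ SS N M (primorial w) b, theta (n + m) * fval (lamc w R U L A) (Dn (PU w R U) U n) ^ 2 := by
  have hL0 : 0 < L := by linarith [e.hL]
  have hw2 : 2 ≤ w := by have := e.hw; omega
  have hA0 : 0 < A := by linarith [n.hA]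
  have hx := xx_nonneg (P := PU w R U) hL0
  have hv := vv_nonneg (R := R) (U := U) hw2
  have hmN : (m:ℕ) ≤ N := by
    have h1 := hUX m m.2
    have h2 : Real.log N ≤ N := Real.log_le_self (Nat.cast_nonneg N)
    exact_mod_cast h1.trans h2
  refine le_trans ?_ (moment_S2 PU_prime (primorial_pos w) b PU_cop PU_inj m hbm N M (fun p hp => (PU_le p hp).trans hRN) EE EE_nonneg
    (fun X q a => EE_bound X q a) (lamc w R U L A))
  refine sub_le_sub ?_ ?_
  · set I2 := Vs (xx (PU w R U) L) (vv (PU w R U)) 1 (fun t => gw A t ^ 2) with hI2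
    have hI0 : 1 ≤ I2 := one_le_Vs hv hx zero_le_one (fun _ _ => sq_nonneg _) (gw2_zero A)
    have hbe := be_pos w
    have hq : 1/20 * Vs (xx (PU w R U) L) (vv (PU w R U)) (1/4) (gw A)^2 * I2^(k-1) ≤ qf (fun (p : PU w R U) => lg2 (p:ℝ) m) (lamc w R U L A) := by
      refine le_trans ?_ (S2_qf (q2 e.hw) (e.kq n hU) m _)
      have h := S2_main (κ := U) hA0.le hx (q2 e.hw) vvq (e.kq n hU) m (64*(1+A)*Real.log (1+A)/A^2)
        (by have := Real.log_nonneg (show (1:ℝ) ≤ 1 + A by linarith); positivity) ?_ ?_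
      · rw [Fintype.card_coe, hU] at h
        exact h
      · have h1 := e.J (U := U) (R := R) n.hA n.hε2
        have h2 := e.I2lo hU.le hUX hR n.hA n.hε1
        have h0 : 0 ≤ 64*(1+A)*Real.log (1+A)/A^2 := by have := Real.log_nonneg (show (1:ℝ) ≤ 1 + A by linarith); positivity
        have h3 := mul_le_mul_of_nonneg_left h2 h0
        have h4 : 64*(1+A)*Real.log (1+A)/A^2 * (be w * L / (4*(1+A))) = 4 * (4 * (be w * L) * Real.log (1 + A) / A^2) := by
          field_simp; ring
        linarith
      · rw [Fintype.card_coe, hU]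
        have h1 : ∑ p, vv (PU w R U) p ^ 2 ≤ ε := (vv_sq hw2).trans e.hwε
        have h2 := n.hk1
        have h3 := n.hk2
        have h4 := mul_le_mul_of_nonneg_left h1 (show 0 ≤ 5 * (k:ℝ)^2 by positivity)
        nlinarith
    have h1 : 1/64 * L * I2 * (Real.log (1+A/4)^2/A) * be w ≤ Vs (xx (PU w R U) L) (vv (PU w R U)) (1/4) (gw A)^2 := by
      have g1 := e.I1 hU.le hUX hR n.hA n.hε2
      have g2 := e.I2up (U := U) (R := R) n.hA n.hε1
      have hl0 : 0 ≤ Real.log (1+A/4) := Real.log_nonneg (by linarith)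
      have g3 := pow_le_pow_left₀ (by positivity) g1 2
      refine le_trans ?_ g3
      have g4 := mul_le_mul_of_nonneg_left g2 (show 0 ≤ 1/64 * L * (Real.log (1+A/4)^2/A) * be w by positivity)
      calc _ = 1/64 * L * (Real.log (1+A/4)^2/A) * be w * I2 := by ring
        _ ≤ _ := g4
        _ = _ := by field_simp; ring
    have hkk : I2^k = I2 * I2^(k-1) := by
      rw [← pow_succ']; congr 1; have := n.hk; omega
    have hW : (0:ℝ) < primorial w := by exact_mod_cast primorial_pos w
    have hφ : (0:ℝ) < Nat.totient (primorial w) := by exact_mod_cast Nat.totient_pos.mpr (primorial_pos w)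
    have h2 : (M:ℝ) / primorial w = M / Nat.totient (primorial w) * be w := by unfold be; field_simp
    rw [h2, mul_assoc]
    refine mul_le_mul_of_nonneg_left (le_trans ?_ hq) (by positivity)
    have h3 := mul_le_mul_of_nonneg_right h1 (show 0 ≤ 1/20 * I2^(k-1) by positivity)
    rw [hkk]
    calc _ = 1/64 * L * I2 * (Real.log (1+A/4)^2/A) * be w * (1/20 * I2^(k-1)) := by ring
      _ ≤ _ := h3
      _ = _ := by ring
  · have hY1 := one_le_Ys (κ := U) hv hx (t := 1) zero_le_one
    refine (S2_err (U := U) PU_prime (primorial_pos w) PU_cop hL0 (x := xx (PU w R U) L) (v := vv (PU w R U)) (fun p => rfl) (fun p => rfl)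
      e.hN (by omega) (by omega) (by omega) (by omega) e.hX (Y := Ys U (xx (PU w R U) L) (vv (PU w R U)) 1) (by linarith)
      (lam_bound hx (q2 e.hw) vvq (cw_bound hA0.le hx)) hB hC hlev hT (j := j) (by rw [Fintype.card_coe, hU]; exact hj)).trans ?_
    unfold err2
    have hlN : 0 ≤ Real.log N := by linarith [e.logN]
    have hl3 : 0 ≤ Real.log (3*N) := Real.log_nonneg (by have : (3:ℝ) ≤ N := by exact_mod_cast e.hN
                                                         linarith)
    have hV := Vs_nonneg hv hx (t := 2) (G := fun _ => 1) (fun _ _ => zero_le_one)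
    refine mul_le_mul (pow_le_pow_left₀ (by linarith) (e.Y' n.ε1 hU) 2) ?_ (by positivity) (by positivity)
    refine add_le_add le_rfl (mul_le_mul_of_nonneg_left ?_ (by positivity))
    exact pow_le_pow_left₀ hV (e.V2 n.ε1) _
end
end GPY

namespace GPY

section
variable {k : ℕ} {ε : ℝ} {N w : ℕ} {L : ℝ} {U : Finset ℕ} {A δ : ℝ} {R s : ℕ}

lemma Env.BadSum (e : Env k ε N w L) (n : Num k A δ ε s) (hU : U.card = k) (M b z : ℕ) (hz : z = ⌊Real.exp (δ*L)⌋₊) :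
    ∑ p : PU w R U, ∑ i : U, (if (p:ℕ) ≤ z then
          ∑ n ∈ Ioc N (N+M) with (n ≡ b [MOD primorial w] ∧ (p:ℕ) ∣ n + i), fval (lamc w R U L A) (Dn (PU w R U) U n) ^ 2 else 0) ≤
      (M:ℝ) / primorial w * (2 * (4*(be w*L))^k) * (k * (2*(1+A)^2*(δ*(δ+ε))+2*(k:ℝ)^2*ε)) + k * Real.exp (δ*L) * err1 k L := by
  have hL0 : 0 < L := by linarith [e.hL]
  have hbe := be_pos w
  have hA0 : 0 < A := by linarith [n.hA]
  have hδ := n.hδ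
  have he1 : 0 ≤ err1 k L := by unfold err1; positivity
  have hpz : ∀ p : PU w R U, (p:ℕ) ≤ z ↔ ((p:ℕ):ℝ) ≤ Real.exp (δ*L) := fun p => by
    rw [hz, Nat.le_floor_iff (Real.exp_pos _).le]
  set Q := (M:ℝ) / primorial w * (2 * (4*(be w*L))^k) with hQ
  have hQ0 : 0 ≤ Q := by positivity
  calc _ ≤ ∑ p : PU w R U, ∑ i : U, (Q * (if ((p:ℕ):ℝ) ≤ Real.exp (δ * L) then 1 / (p:ℝ) * ((1 + A) * xx (PU w R U) L p + k * vv (PU w R U) p)^2 else 0)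
        + (if (p:ℕ) ≤ z then err1 k L else 0)) := by
        refine sum_le_sum fun p _ => sum_le_sum fun i _ => ?_
        by_cases hp : (p:ℕ) ≤ z
        · rw [if_pos hp, if_pos ((hpz p).mp hp), if_pos hp]
          exact e.Bad n hU M b p i
        · rw [if_neg hp, if_neg (fun h => hp ((hpz p).mpr h)), if_neg hp]; simp
    _ = k * (Q * ∑ p : PU w R U, (if ((p:ℕ):ℝ) ≤ Real.exp (δ * L) then 1 / (p:ℝ) * ((1 + A) * xx (PU w R U) L p + k * vv (PU w R U) p)^2 else 0)
        + ∑ p : PU w R U, (if (p:ℕ) ≤ z then err1 k L else 0)) := by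
        simp only [sum_const, card_univ, Fintype.card_coe, hU, nsmul_eq_mul]
        rw [← mul_sum, sum_add_distrib, mul_sum]
    _ ≤ k * (Q * (2*(1+A)^2*(δ*(δ+ε))+2*(k:ℝ)^2*ε) + Real.exp (δ*L) * err1 k L) := by
        refine mul_le_mul_of_nonneg_left (add_le_add (mul_le_mul_of_nonneg_left ?_ hQ0) ?_) (by positivity)
        · refine (bad_sum (by have := e.hw; omega) hL0 hA0.le (Nat.cast_nonneg k) hδ.le).trans ?_
          have := e.hL4
          have := e.hwε
          gcongr
        · rw [← sum_filter, sum_const, nsmul_eq_mul]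
          refine mul_le_mul_of_nonneg_right ?_ he1
          have h1 : (univ.filter (fun p : PU w R U => (p:ℕ) ≤ z)).card ≤ z := by
            have h2 : ((univ.filter (fun p : PU w R U => (p:ℕ) ≤ z)).map (Function.Embedding.subtype _)) ⊆ Ioc 0 z := by
              intro q hq
              rw [mem_map] at hq
              obtain ⟨p, hp, rfl⟩ := hq
              rw [mem_Ioc]
              exact ⟨(PU_prime p p.2).pos, (mem_filter.mp hp).2⟩
            have h3 := card_le_card h2
            rw [card_map, Nat.card_Ioc] at h3
            omega
          have h4 : (z:ℝ) ≤ Real.exp (δ*L) := by rw [hz]; exact Nat.floor_le (Real.exp_pos _).le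
          exact le_trans (by exact_mod_cast h1) h4
    _ = _ := by ring

set_option maxHeartbeats 1000000 in
theorem prop2 (e : Env k ε N w L) (n : Num k A δ ε s) (hU : U.card = k) (hUX : ∀ u ∈ U, (u:ℝ) ≤ Real.log N)
    (M b : ℕ) (hM : M ≤ N) (h2N : Real.log N ≤ N) (hbm : ∀ u ∈ U, Nat.Coprime (b + u) (primorial w))
    {B C T : ℝ} (hB : 0 < B) (hC : 0 < C)
    (hlev : ∀ X : ℕ, 2 ≤ X → ∑ q ∈ Icc 1 ⌊(X:ℝ) ^ (1/2:ℝ)⌋₊, EE X q ≤ C * X / (Real.log X) ^ B)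
    (hT : 0 < T) {j : ℕ} (hj : ((k + 1) ^ 4 : ℝ) ≤ 2 ^ j)
    (herr : k * err2 k j N L T B C + 9*L*err1 k L + k*(9*L)*(k*Real.exp (δ*L)*err1 k L) ≤ (M:ℝ)/primorial w * L) :
    (M:ℝ)/primorial w * L * (be w*L/(4*(1+A)))^k ≤
      (GS N M (primorial w) b w ⌊Real.exp (δ*L)⌋₊ U).card * (((2^s*(4*(be w*L)))^k)^2*(k*(9*L))) := by
  set R := ⌊Real.exp L⌋₊ with hRd
  have hL0 : 0 < L := by linarith [e.hL]
  have hw2 : 2 ≤ w := by have := e.hw; omega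
  have hA0 : 0 < A := by linarith [n.hA]
  have hbe := be_pos w
  have hR : Real.exp L < R + 1 := Nat.lt_floor_add_one _
  have hRN : R ≤ N := by
    have h1 : (R:ℝ) ≤ N := (Nat.floor_le (Real.exp_pos _).le).trans e.hexpN
    exact_mod_cast h1
  set z := ⌊Real.exp (δ*L)⌋₊ with hz
  have hzR : z ≤ R := Nat.floor_le_floor (Real.exp_le_exp.mpr (by nlinarith [n.hδ1]))
  have hx := xx_nonneg (P := PU w R U) hL0
  have hv := vv_nonneg (R := R) (U := U) hw2
  set I2 := Vs (xx (PU w R U) L) (vv (PU w R U)) 1 (fun t => gw A t ^ 2) with hI2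
  have hI1 : 1 ≤ I2 := one_le_Vs hv hx zero_le_one (fun _ _ => sq_nonneg _) (gw2_zero A)
  have hIlo := e.I2lo hU.le hUX hR n.hA n.hε1
  have huN : ∀ u ∈ U, u ≤ N := fun u hu => by exact_mod_cast (hUX u hu).trans h2N
  have hQ := Q_upper (N := N) (M := M) (W := primorial w) (b := b) (w := w) (R := R) (z := z) (U := U) (l := 9*L) e.hlog (by linarith)
    (fun u hu => by have := huN u hu; omega) hzR (fun n => fval (lamc w R U L A) (Dn (PU w R U) U n)) (F := ((2^s*(4*(be w*L)))^k)^2) (by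
      intro m hm hAP
      have hb := fval_bound (κ := U) hx (q2 e.hw) vvq (cw_bound hA0.le hx) (Dn (PU w R U) U m)
      rw [← sq_abs]
      refine pow_le_pow_left₀ (abs_nonneg _) (hb.trans ?_) 2
      have hm0 := (mem_Ioc.mp (mem_filter.mp hm).1)
      refine (prod_le_prod (fun i _ => mul_nonneg (by positivity) (Vs_nonneg hv hx (fun _ _ => zero_le_one))) (fun (i : U) _ =>
        mul_le_mul (pow_le_pow_right₀ one_le_two (Dn_card (y := δ*L) (l := 9*L) (s := s) e.hlog (mul_pos n.hδ hL0) (by nlinarith [n.hs])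
          (Nat.lt_floor_add_one _) hAP i (by omega) (by have := huN i i.2; omega))) (e.V1 n.ε1) (Vs_nonneg hv hx (fun _ _ => zero_le_one)) (by positivity))).trans ?_
      rw [prod_const, card_univ, Fintype.card_coe, hU])
  refine le_trans ?_ (hQ.trans (le_of_eq (by rw [hU])))
  have hS1 := e.S1 (R := R) n hU M b
  have hBd := e.BadSum (R := R) n hU M b z hz
  have hS2 : ∑ u : U, ((M:ℝ) / primorial w * (L * (1/1280 * Real.log (1+A/4)^2/A) * I2^k) - err2 k j N L T B C) ≤
     ∑ u : U, ∑ n ∈ SS N M (primorial w) b, theta (n + u) * fval (lamc w R U L A) (Dn (PU w R U) U n) ^ 2 :=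
    sum_le_sum fun u _ => e.S2 n hU hUX hR hRN M b hM u (hbm u u.2) hB hC hlev hT hj
  rw [sum_const, card_univ, Fintype.card_coe, hU, nsmul_eq_mul] at hS2
  rw [hU]
  set Q := (M:ℝ)/primorial w with hQd
  have hQ0 : 0 ≤ Q := by positivity
  have hIk : 1 ≤ I2^k := one_le_pow₀ hI1
  have g1 : 40 ≤ k * (1/1280 * Real.log (1+A/4)^2/A) := by
    have := n.hk3
    rw [← mul_div_assoc, le_div_iff₀ hA0]; linarith
  have g2 := mul_le_mul_of_nonneg_left g1 (show 0 ≤ Q*L*I2^k by positivity)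
  have g3 : (4*(be w*L))^k ≤ (16*(1+A))^k * I2^k := by
    rw [← mul_pow]
    refine pow_le_pow_left₀ (by positivity) ?_ k
    rw [div_le_iff₀ (by positivity)] at hIlo
    linarith
  have g4 : 9*k*(2*(4*(be w*L))^k) * (k * (2*(1+A)^2*(δ*(δ+ε))+2*(k:ℝ)^2*ε)) ≤ I2^k := by
    have h0 : 0 ≤ k * (2*(1+A)^2*(δ*(δ+ε))+2*(k:ℝ)^2*ε) := by have := n.hδ; have := n.hε0; positivity
    calc _ = 18*k*(k * (2*(1+A)^2*(δ*(δ+ε))+2*(k:ℝ)^2*ε)) * (4*(be w*L))^k := by ring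
      _ ≤ 18*k*(k * (2*(1+A)^2*(δ*(δ+ε))+2*(k:ℝ)^2*ε)) * ((16*(1+A))^k * I2^k) := mul_le_mul_of_nonneg_left g3 (by positivity)
      _ = (18*k*(16*(1+A))^k*(k*(2*(1+A)^2*(δ*(δ+ε))+2*(k:ℝ)^2*ε))) * I2^k := by ring
      _ ≤ 1 * I2^k := mul_le_mul_of_nonneg_right n.hbad (by positivity)
      _ = _ := one_mul _
  have g5 := mul_le_mul_of_nonneg_left g4 (show 0 ≤ Q*L by positivity)
  have g6 := mul_le_mul_of_nonneg_left hS1 (show 0 ≤ 9*L by positivity)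
  have g7 := mul_le_mul_of_nonneg_left hBd (show 0 ≤ k*(9*L) by positivity)
  have g8 : Q*L ≤ Q*L*I2^k := le_mul_of_one_le_right (by positivity) hIk
  have g9 : Q * L * (be w*L/(4*(1+A)))^k ≤ Q*L*I2^k := mul_le_mul_of_nonneg_left (pow_le_pow_left₀ (by positivity) hIlo k) (by positivity)
  have E1 : k * (Q * (L * (1/1280 * Real.log (1+A/4)^2/A) * I2^k) - err2 k j N L T B C) = Q*L*I2^k*(k*(1/1280 * Real.log (1+A/4)^2/A)) - k*err2 k j N L T B C := by ring
  have E2 : 9*L*(Q*(2*I2^k)+err1 k L) = 18*(Q*L*I2^k) + 9*L*err1 k L := by ring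
  have E3 : k*(9*L)*(Q*(2 * (4*(be w*L))^k) * (k * (2*(1+A)^2*(δ*(δ+ε))+2*(k:ℝ)^2*ε)) + k * Real.exp (δ*L) * err1 k L) =
     Q*L*(9*k*(2*(4*(be w*L))^k) * (k * (2*(1+A)^2*(δ*(δ+ε))+2*(k:ℝ)^2*ε))) + k*(9*L)*(k*Real.exp (δ*L)*err1 k L) := by ring
  rw [E1] at hS2
  rw [E2] at g6
  rw [E3] at g7
  refine le_trans ?_ (sub_le_sub (sub_le_sub hS2 g6) g7)
  have g10 : 0 ≤ Q*L*I2^k := (mul_nonneg hQ0 hL0.le).trans g8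
  linarith
end
end GPY

namespace GPY

section
variable {K : ℕ} {ε : ℝ} {N w : ℕ} {L : ℝ} {U : Finset ℕ} {δ : ℝ}

theorem prop1 (e : Env K ε N w L) (hK : 1 ≤ K) (hδ : 0 < δ) (hδ1 : δ ≤ 1) (hε1 : ε ≤ 1) (hεK : (K:ℝ)^2*ε ≤ 1/2) (hεδ : ε ≤ δ/(2*K))
    (hU : U.card ≤ K) (hUX : ∀ u ∈ U, (u:ℝ) ≤ Real.log N) (M b : ℕ)
    (herr : Real.exp (2*(δ*L)) * ((4*L)^K)^3 ≤ (M:ℝ)/primorial w) :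
    (((SS N M (primorial w) b).filter (fun n => AP w ⌊Real.exp (δ*L)⌋₊ U n)).card : ℝ) ≤ 6 * ((M:ℝ)/primorial w) * (4*K/(δ*(be w*L)))^U.card := by
  classical
  set z := ⌊Real.exp (δ*L)⌋₊ with hz
  have hL0 : 0 < L := by linarith [e.hL]
  set L' := δ*L with hL'
  have hL'0 : 0 < L' := mul_pos hδ hL0
  have hw2 : 2 ≤ w := by have := e.hw; omega
  have hw5 : (5:ℝ) ≤ w := by exact_mod_cast e.hw
  have hbe := be_pos w
  have hKr : (1:ℝ) ≤ K := by exact_mod_cast hK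
  have hUr : (U.card:ℝ) ≤ K := by exact_mod_cast hU
  set x := xx (PU w z U) L' with hxd
  set v := vv (PU w z U) with hvd
  have hx : ∀ p, 0 ≤ x p := xx_nonneg hL'0
  have hv : ∀ p, 0 ≤ v p := vv_nonneg hw2
  have hKw : (K:ℝ) ≤ 1/2*((w:ℝ)-1) := by
    have h1 := e.hwε
    rw [div_le_iff₀ (by linarith)] at h1
    have h2 : (K:ℝ)^2*1 ≤ (K:ℝ)^2*(ε*((w:ℝ)-1)) := mul_le_mul_of_nonneg_left h1 (by positivity)
    have h3 := mul_le_mul_of_nonneg_right hεK (show (0:ℝ) ≤ (w:ℝ)-1 by linarith)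
    nlinarith
  have hkq : ∀ p : PU w z U, (Fintype.card U : ℝ) ≤ ((p:ℕ):ℝ) := fun p => by
    rw [Fintype.card_coe]
    have h2 : (w:ℝ) < ((p:ℕ):ℝ) := by exact_mod_cast PU_gt p p.2
    linarith
  set Y := Ys U x v 1 with hY
  have hY1 : 1 ≤ Y := one_le_Ys hv hx zero_le_one
  -- lower bound
  have hEW := e.hE
  have hbL : 0 < be w * L := mul_pos hbe hL0
  have hYlo : 1/2 * (δ*(be w*L)/(4*K))^U.card ≤ Y := by
    have h1 := Ys_ge (κ := U) hv hx (t := 1) (u := 1/K) (by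
      rw [Fintype.card_coe, mul_one_div, div_le_one (by linarith)]; exact hUr) (by
      rw [Fintype.card_coe]
      have h1 : ∑ p, v p ^ 2 ≤ ε := (vv_sq hw2).trans e.hwε
      refine le_trans ?_ hεK
      exact mul_le_mul (pow_le_pow_left₀ (by positivity) hUr 2) h1 (sum_nonneg fun _ _ => sq_nonneg _) (by positivity))
    rw [Fintype.card_coe] at h1
    refine le_trans (mul_le_mul_of_nonneg_left (pow_le_pow_left₀ (by positivity) ?_ _) (by norm_num)) h1
    have h := Est_lo (w := w) (R := z) (U := U) e.hw hL'0 (Nat.lt_floor_add_one _) e.logN hUX (by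
      refine le_trans (mul_le_mul_of_nonneg_right ?_ (Real.log_nonneg e.logN)) e.hσ
      exact pow_le_pow_left₀ (Nat.cast_nonneg _) hUr 2)
      (G := fun _ => 1) (K := fun t => t) (fun _ _ => zero_le_one) (fun _ _ _ _ => le_rfl) K_one.1 K_one.2 rfl (t := 1/K) (by positivity)
      (by rw [div_le_one (by linarith)]; exact hKr)
    refine le_trans ?_ h
    change _ ≤ 1/2 * (be w * L' * _ - _)
    have h3 := mul_le_mul_of_nonneg_right hεδ hbL.le
    have h4 : 1/2 * (be w * L' * (1/K - 0) - δ/(2*K)*(be w*L)) = δ*(be w*L)/(4*K) := by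
      rw [hL']; field_simp; ring
    linarith
  have hYup : Y ≤ (4*L)^K := by
    have h := Est_up (w := w) (R := z) (U := U) (by have := e.hw; omega) hL'0 (G := fun _ => 1) (K := fun t => t)
      (fun _ _ => zero_le_one) (fun _ _ _ _ => le_rfl) K_one.1 rfl (t := 1) zero_le_one
    change _ ≤ 2 * (be w * L' * _ + _) at h
    simp only [sub_zero, mul_one] at h
    have h2 : be w * L ≤ L := by nlinarith [be_le w]
    have h3 : be w * L' ≤ be w * L := by rw [hL']; nlinarith
    have h4 := mul_le_mul_of_nonneg_right hε1 hbL.le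
    refine (Ys_le hv hx).trans ?_
    rw [Fintype.card_coe]
    refine (pow_le_pow_left₀ (Vs_nonneg hv hx (fun _ _ => zero_le_one)) (h.trans (show _ ≤ 4*L by linarith)) _).trans ?_
    exact pow_le_pow_right₀ (by linarith [e.hL]) hU
  set c : (PU w z U → Option U) → ℝ := fun σ => mu σ * if tot x σ ≤ 1 then 1 else 0 with hc
  set lam := tr (fun p : PU w z U => lT ((p:ℕ):ℝ)) c with hlam
  have hcb : ∀ s, |c s| ≤ if tot x s ≤ 1 then 1 else 0 := fun s => by
    simp only [hc]
    rw [abs_mul, abs_mu, one_mul]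
    split_ifs <;> simp
  have hqf : qf (fun (p : PU w z U) => lg1 (p:ℝ)) lam ≤ 2 * Y := by
    refine (S1_qf (q2 e.hw) hkq c).trans ?_
    calc _ ≤ ∑ σ : PU w z U → Option U, PC U (fun p : PU w z U => ((p:ℕ):ℝ)) * (if tot x σ ≤ 1 then ∏ i, vs v (lab σ i) else 0) := by
          refine sum_le_sum fun σ _ => ?_
          have hp := prod_lD1_le (κ := U) (v := v) (q2 (R := z) (U := U) e.hw) vvq σ
          simp only [hc]
          rw [mul_pow, mu_sq, one_mul]
          split_ifs
          · simpa using hp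
          · simp
      _ = PC U (fun p : PU w z U => ((p:ℕ):ℝ)) * Y := by rw [← mul_sum]; rfl
      _ ≤ _ := mul_le_mul_of_nonneg_right (PC_le (by have := e.hw; omega) (by rw [Fintype.card_coe]; linarith)) (by linarith)
  have hm := moment_S1 (U := U) PU_prime (primorial_pos w) b PU_cop PU_inj N M lam
  have hsl : ∑ d, |lam d| ≤ Real.exp L' * Y^2 := sum_lam_le hx (q2 e.hw) vvq hL'0 (fun p => rfl) hcb
  have hW : (0:ℝ) < primorial w := by exact_mod_cast primorial_pos w
  set Q := (M:ℝ)/primorial w with hQ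
  have hQ0 : 0 ≤ Q := by positivity
  have hlow : ((((SS N M (primorial w) b).filter (fun n => AP w z U n)).card : ℕ) : ℝ) * Y^2 ≤
      ∑ n ∈ Ioc N (N+M) with (n ≡ b [MOD primorial w]), fval lam (Dn (PU w z U) U n) ^ 2 := by
    refine le_trans ?_ (sum_le_sum_of_subset_of_nonneg (filter_subset (fun n => AP w z U n) (SS N M (primorial w) b)) (fun _ _ _ => sq_nonneg _))
    rw [← nsmul_eq_mul, ← sum_const]
    refine sum_le_sum fun n hn => ?_
    have hAP := (mem_filter.mp hn).2
    have : Dn (PU w z U) U n = fun _ => ∅ := by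
      funext u
      unfold Dn
      rw [filter_eq_empty_iff]
      intro p _
      exact hAP p p.2 u u.2
    rw [this, hlam, fval_empty vvq]
  set a : ℝ := ((((SS N M (primorial w) b).filter (fun n => AP w z U n)).card : ℕ) : ℝ) with ha
  have h1 : a * Y^2 ≤ Q * (2*Y) + (Real.exp L' * Y^2)^2 := by
    refine hlow.trans (hm.trans (add_le_add (mul_le_mul_of_nonneg_left hqf hQ0) ?_))
    exact pow_le_pow_left₀ (sum_nonneg fun _ _ => abs_nonneg _) hsl 2
  have h2 : (Real.exp L' * Y^2)^2 ≤ Q * Y := by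
    have h3 : Y^3 ≤ ((4*L)^K)^3 := pow_le_pow_left₀ (by linarith) hYup 3
    have h4 : Real.exp (2*L') * Y^3 ≤ Q := (mul_le_mul_of_nonneg_left h3 (Real.exp_pos _).le).trans herr
    calc _ = (Real.exp (2*L') * Y^3) * Y := by rw [two_mul, Real.exp_add]; ring
      _ ≤ _ := mul_le_mul_of_nonneg_right h4 (by linarith)
  have h3 : a * Y ≤ 3 * Q := by
    have : a * Y * Y ≤ 3*Q*Y := by nlinarith
    exact le_of_mul_le_mul_right this (by linarith)
  have ha0 : 0 ≤ a := Nat.cast_nonneg _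
  have h4 := (mul_le_mul_of_nonneg_left hYlo ha0).trans h3
  set X := (δ*(be w*L)/(4*K)) with hX
  have hX0 : 0 < X := by positivity
  have h5 : 4*K/(δ*(be w*L)) = X⁻¹ := by rw [hX, inv_div]
  rw [h5, inv_pow, ← div_eq_mul_inv, le_div_iff₀ (by positivity)]
  linarith
end
end GPY

namespace GPY

lemma num_exists : ∃ (k : ℕ) (A δ ε : ℝ) (s : ℕ), Num k A δ ε s ∧ ((2*k:ℕ):ℝ)^2*ε ≤ 1/2 ∧ ε ≤ δ/(2*((2*k:ℕ):ℝ)) := by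
  set Λ : ℝ := 134217728 with hΛ
  set A : ℝ := 4*(Real.exp Λ - 1) with hA
  have hΛ0 : (0:ℝ) < Λ := by norm_num [hΛ]
  have hq := Real.quadratic_le_exp_of_nonneg hΛ0.le
  have hA2 : 2*Λ^2 ≤ A := by rw [hA]; nlinarith
  have hA1 : 1 ≤ A := by rw [hΛ] at hA2; norm_num at hA2; linarith
  have hA0 : 0 < A := by linarith
  have hl1 : Real.log (1+A/4) = Λ := by
    have : 1 + A/4 = Real.exp Λ := by rw [hA]; ring
    rw [this, Real.log_exp]
  have hl2 : Real.log (1+A) ≤ 2*Λ := by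
    rw [Real.log_le_iff_le_exp (by linarith), two_mul, Real.exp_add]
    have h1 : (4:ℝ) ≤ Real.exp Λ := by
      have h : Λ + 1 ≤ Real.exp Λ := Real.add_one_le_exp Λ
      have h' : (4:ℝ) ≤ Λ + 1 := by rw [hΛ]; norm_num
      linarith
    have h2 : 1 + A ≤ 4*Real.exp Λ := by rw [hA]; linarith
    nlinarith
  have hl20 : 0 ≤ Real.log (1+A) := Real.log_nonneg (by linarith)
  set k := ⌊A/(1024*Λ)⌋₊ with hk
  have hy : 2 ≤ A/(1024*Λ) := by
    rw [le_div_iff₀ (by positivity)]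
    have : 2*(1024*Λ) ≤ 2*Λ^2 := by rw [hΛ]; norm_num
    linarith
  have hk_up : (k:ℝ) ≤ A/(1024*Λ) := Nat.floor_le (by linarith)
  have hk_lo : A/(2048*Λ) ≤ k := by
    have h1 : A/(1024*Λ) < k + 1 := Nat.lt_floor_add_one _
    have h2 : A/(2048*Λ) = A/(1024*Λ)/2 := by field_simp; norm_num
    linarith
  have hk1 : 1 ≤ k := by
    have : (1:ℝ) ≤ k := by
      have h1 : A/(1024*Λ) < k + 1 := Nat.lt_floor_add_one _
      linarith
    exact_mod_cast this
  have hkr : (1:ℝ) ≤ k := by exact_mod_cast hk1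
  set D : ℝ := 18*k*(16*(1+A))^k*(k*(4*(1+A)^2+2*(k:ℝ)^2)) with hD
  have hD0 : 0 < D := by positivity
  set δ : ℝ := 1/(1+D) with hδ
  have hδ0 : 0 < δ := by positivity
  have hδ1 : δ ≤ 1 := by rw [hδ, div_le_one (by linarith)]; linarith
  have hDδ : D*δ ≤ 1 := by rw [hδ, mul_one_div, div_le_one (by linarith)]; linarith
  clear_value A Λ k D δ
  obtain ⟨ε, hε0, h1, h2, h3, h4, h5, h6⟩ : ∃ ε : ℝ, 0 < ε ∧ ε ≤ 1/(4*(1+A)) ∧ ε ≤ Λ/(2*A) ∧ ε ≤ 1/(20*(k:ℝ)^2) ∧ ε ≤ δ^2 ∧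
      ε ≤ 1/(8*(k:ℝ)^2) ∧ ε ≤ δ/(2*((2*k:ℕ):ℝ)) := by
    refine ⟨min (1/(4*(1+A))) (min (Λ/(2*A)) (min (1/(20*(k:ℝ)^2)) (min (δ^2) (min (1/(8*(k:ℝ)^2)) (δ/(2*((2*k:ℕ):ℝ))))))), ?_, ?_⟩
    · push_cast; positivity
    · simp only [min_le_iff, le_refl, true_or, or_true, and_self]
  refine ⟨k, A, δ, ε, ⌈9/δ⌉₊, ⟨hk1, hA1, hδ0, hδ1, hε0, h1, by rw [hl1]; exact h2, ?_, ?_, ?_, ?_, ?_⟩, ?_, h6⟩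
  · have h7 : 64*(1+A)*Real.log (1+A)/A^2 ≤ 256*Λ/A := by
      rw [div_le_div_iff₀ (by positivity) hA0]
      have : (1+A)*Real.log (1+A) ≤ (2*A)*(2*Λ) := mul_le_mul (by linarith) hl2 hl20 (by linarith)
      nlinarith
    calc _ ≤ A/(1024*Λ) * (256*Λ/A) := mul_le_mul hk_up h7 (by positivity) (by positivity)
      _ = 1/4 := by field_simp; norm_num
  · have := mul_le_mul_of_nonneg_left h3 (show 0 ≤ 5*(k:ℝ)^2 by positivity)
    calc _ ≤ _ := this
      _ = 1/4 := by field_simp; norm_num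
  · rw [hl1]
    have := mul_le_mul_of_nonneg_right hk_lo (show 0 ≤ Λ^2 by positivity)
    refine le_trans ?_ this
    have : A/(2048*Λ)*Λ^2 = A*(Λ/2048) := by field_simp
    rw [this, hΛ]; norm_num; linarith
  · have h7 : 2*(1+A)^2*(δ*(δ+ε))+2*(k:ℝ)^2*ε ≤ (4*(1+A)^2+2*(k:ℝ)^2)*δ^2 := by
      have h8 : δ^2 ≤ δ := by nlinarith
      have h9 : δ*(δ+ε) ≤ 2*δ^2 := by nlinarith
      have h10 := mul_le_mul_of_nonneg_left h9 (show 0 ≤ 2*(1+A)^2 by positivity)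
      have h11 := mul_le_mul_of_nonneg_left h4 (show 0 ≤ 2*(k:ℝ)^2 by positivity)
      linarith
    calc _ ≤ 18*k*(16*(1+A))^k*(k*((4*(1+A)^2+2*(k:ℝ)^2)*δ^2)) := by gcongr
      _ = D*δ*δ := by rw [hD]; ring
      _ ≤ 1*1 := mul_le_mul hDδ hδ1 hδ0.le zero_le_one
      _ = 1 := one_mul 1
  · have := Nat.le_ceil (9/δ)
    rwa [div_le_iff₀ hδ0] at this
  · push_cast
    have := mul_le_mul_of_nonneg_left h5 (show 0 ≤ (2*(k:ℝ))^2 by positivity)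
    calc _ ≤ _ := this
      _ = 1/2 := by field_simp; norm_num
end GPY

namespace GPY

open Filter

noncomputable def ww (N : ℕ) : ℕ := ⌊Real.log (Real.log N)/4⌋₊

lemma tl : Tendsto (fun N : ℕ => Real.log N) atTop atTop := Real.tendsto_log_atTop.comp tendsto_natCast_atTop_atTop
lemma tll : Tendsto (fun N : ℕ => Real.log (Real.log N)) atTop atTop := Real.tendsto_log_atTop.comp tl
lemma tww : Tendsto ww atTop atTop := tendsto_nat_floor_atTop.comp (tll.atTop_div_const (by norm_num))

lemma W_le {N : ℕ} (h : 1 ≤ Real.log N) : (primorial (ww N) : ℝ) ≤ (Real.log N)^(1/2:ℝ) := by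
  have h0 : 0 ≤ Real.log (Real.log N) := Real.log_nonneg h
  calc (primorial (ww N) : ℝ) ≤ ((4^(ww N) : ℕ):ℝ) := by exact_mod_cast primorial_le_four_pow _
    _ = (4:ℝ)^(ww N) := by push_cast; rfl
    _ = Real.exp (ww N * Real.log 4) := by rw [mul_comm, Real.exp_mul, Real.exp_log (by norm_num), Real.rpow_natCast]
    _ ≤ Real.exp (Real.log (Real.log N) * (1/2)) := by
        refine Real.exp_le_exp.mpr ?_
        have h1 : (ww N : ℝ) ≤ Real.log (Real.log N)/4 := Nat.floor_le (by linarith)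
        have h2 : Real.log 4 ≤ 2 := by
          have : (4:ℝ) = 2^2 := by norm_num
          rw [this, Real.log_pow]; push_cast
          linarith [Real.log_two_lt_d9]
        have h3 : 0 ≤ Real.log 4 := Real.log_nonneg (by norm_num)
        calc _ ≤ Real.log (Real.log N)/4 * 2 := mul_le_mul h1 h2 h3 (by linarith)
          _ = _ := by ring
    _ = _ := by rw [Real.rpow_def_of_pos (by linarith)]

lemma polyexp (C : ℝ) (n : ℕ) {c : ℝ} (hc : 0 < c) : ∀ᶠ x : ℝ in atTop, C * x^n ≤ Real.exp (c*x) := by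
  have h := (isLittleO_pow_exp_pos_mul_atTop (k := n) hc).const_mul_left C
  filter_upwards [h.bound (show (0:ℝ) < 1 by norm_num)] with x hx
  rw [one_mul, Real.norm_eq_abs, Real.norm_eq_abs, abs_of_pos (Real.exp_pos _)] at hx
  exact (le_abs_self _).trans hx

lemma ev_env (K : ℕ) {ε : ℝ} (hε : 0 < ε) : ∀ᶠ N : ℕ in atTop, Env K ε N (ww N) (Real.log N/8) := by
  have e1 : ∀ᶠ x : ℝ in atTop, 2 + Real.log 2 + x ≤ ε * Real.exp (x/2)/8 := by
    have h := polyexp (8/ε*(3 + Real.log 2)) 1 (show (0:ℝ) < 1/2 by norm_num)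
    filter_upwards [h, eventually_ge_atTop 1] with x hx h1
    have h2 : 0 ≤ Real.log 2 := Real.log_nonneg (by norm_num)
    have h3 : 2 + Real.log 2 + x ≤ (3 + Real.log 2)*x := by nlinarith
    rw [pow_one] at hx
    have h4 := mul_le_mul_of_nonneg_left hx (show 0 ≤ ε/8 by positivity)
    calc _ ≤ _ := h3
      _ = ε/8*(8/ε*(3 + Real.log 2)*x) := by field_simp
      _ ≤ _ := h4
      _ = _ := by rw [show (1/2*x) = x/2 by ring]; ring
  have e2 : ∀ᶠ x : ℝ in atTop, x ≤ Real.exp (1/4*x) := by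
    have h := polyexp 1 1 (show (0:ℝ) < 1/4 by norm_num)
    simpa using h
  have hwr : Tendsto (fun N => ((ww N : ℕ):ℝ)) atTop atTop := tendsto_natCast_atTop_atTop.comp tww
  filter_upwards [eventually_ge_atTop 3, tww.eventually_ge_atTop 5, hwr.eventually_ge_atTop (1 + 1/ε),
    (Real.tendsto_log_atTop.comp hwr).eventually_ge_atTop (32*(K:ℝ)^2), tll.eventually_ge_atTop 8,
    tl.eventually_ge_atTop 8, tl.eventually_ge_atTop (8*Real.log 3), tl.eventually_ge_atTop (8*Real.log 4/ε), tll.eventually e1, tl.eventually e2]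
    with N h3 hw5 hwe hwl hll hl8 hl3 hl4 he1 he2
  set w := ww N with hw
  set l := Real.log N with hl
  set y := Real.log l with hy
  have hN0 : (0:ℝ) < N := by have : 0 < N := by omega
                             exact_mod_cast this
  have hNe : (N:ℝ) = Real.exp l := (Real.exp_log hN0).symm
  have hW := W_le (N := N) (by linarith)
  rw [← hw, ← hl] at hW
  have hW1 : (1:ℝ) ≤ primorial w := by exact_mod_cast primorial_pos w
  have hly : l = Real.exp y := (Real.exp_log (by linarith)).symm
  have hlh : l^(1/2:ℝ) = Real.exp (y/2) := by rw [Real.rpow_def_of_pos (by linarith)]; congr 1; ring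
  have hw5r : (5:ℝ) ≤ w := by exact_mod_cast hw5
  refine ⟨h3, hw5, ?_, ?_, by linarith, ?_, ?_, ?_, ?_, ?_⟩
  · rw [div_le_iff₀ (by linarith)]
    have : 1/ε ≤ (w:ℝ) - 1 := by linarith
    rw [div_le_iff₀ hε] at this
    linarith
  · have h1 : y/4 < w + 1 := Nat.lt_floor_add_one _
    have h2 : y/8 ≤ w := by linarith
    have h4 : y/8*(32*(K:ℝ)^2) ≤ w * Real.log w := mul_le_mul h2 hwl (by positivity) (by positivity)
    linarith
  · rw [Real.log_mul (by norm_num) hN0.ne']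
    linarith
  · have hb : Real.exp (y/2)/8 ≤ be w * (l/8) := by
      have h1 : 1/(primorial w:ℝ) ≤ be w := by
        unfold be
        refine div_le_div_of_nonneg_right ?_ (by linarith)
        exact_mod_cast Nat.totient_pos.mpr (primorial_pos w)
      have h2 : 1/Real.exp (y/2) ≤ be w := le_trans (one_div_le_one_div_of_le (by linarith) (by rw [← hlh]; exact hW)) h1
      have h5 := mul_le_mul_of_nonneg_right h2 (show 0 ≤ l/8 by linarith)
      refine le_trans (le_of_eq ?_) h5
      have h6 : l = Real.exp (y/2) * Real.exp (y/2) := by rw [← Real.exp_add, add_halves]; exact hly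
      rw [h6]; field_simp
    have h7 : EW (primorial w) ≤ 2 + Real.log 2 + y := by
      unfold EW
      have h8 : Real.log ((primorial w:ℝ)+1) ≤ Real.log (2*Real.exp (y/2)) := Real.log_le_log (by linarith) (by rw [← hlh]; linarith)
      rw [Real.log_mul (by norm_num) (Real.exp_pos _).ne', Real.log_exp] at h8
      linarith
    have := mul_le_mul_of_nonneg_left hb hε.le
    linarith
  · rw [div_le_iff₀ (by linarith)]
    rw [div_le_iff₀ hε] at hl4
    linarith
  · have h1 : (primorial w : ℝ) ≤ Real.exp (1/4*l) := by
      refine hW.trans (le_trans ?_ he2)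
      calc l^(1/2:ℝ) ≤ l^(1:ℝ) := Real.rpow_le_rpow_of_exponent_le (by linarith) (by norm_num)
        _ = l := Real.rpow_one l
    rw [Real.rpow_def_of_pos hN0, ← hl]
    calc _ ≤ Real.exp (1/4*l) * Real.exp (l/8*2) := mul_le_mul_of_nonneg_right h1 (Real.exp_pos _).le
      _ = _ := by rw [← Real.exp_add]; congr 1; ring
  · rw [hNe]; exact Real.exp_le_exp.mpr (by linarith)

lemma ev_Q : ∀ᶠ N : ℕ in atTop, Real.exp (Real.log N)/(3*Real.log N) ≤ ((N/2:ℕ):ℝ)/primorial (ww N) := by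
  filter_upwards [eventually_ge_atTop 4, tl.eventually_ge_atTop 1] with N h4 hl1
  have hN0 : (4:ℝ) ≤ N := by exact_mod_cast h4
  rw [Real.exp_log (by linarith)]
  have h1 : (N:ℝ)/3 ≤ ((N/2:ℕ):ℝ) := by
    rw [div_le_iff₀ (by norm_num)]
    have : N ≤ N/2*3 := by omega
    exact_mod_cast this
  have hW := W_le hl1
  have hW1 : (1:ℝ) ≤ primorial (ww N) := by exact_mod_cast primorial_pos _
  have hW2 : (primorial (ww N):ℝ) ≤ Real.log N := hW.trans (by
    calc (Real.log N)^(1/2:ℝ) ≤ (Real.log N)^(1:ℝ) := Real.rpow_le_rpow_of_exponent_le (by linarith) (by norm_num)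
        _ = _ := Real.rpow_one _)
  calc (N:ℝ)/(3*Real.log N) = (N:ℝ)/3/Real.log N := by rw [div_div]
    _ ≤ _ := div_le_div₀ (by positivity) h1 (by linarith) hW2

lemma ev_err1 (K : ℕ) {δ : ℝ} (hδ1 : δ ≤ 1) : ∀ᶠ N : ℕ in atTop,
    Real.exp (2*(δ*(Real.log N/8))) * ((4*(Real.log N/8))^K)^3 ≤ ((N/2:ℕ):ℝ)/primorial (ww N) := by
  have e1 := polyexp 3 (3*K+1) (show (0:ℝ) < 3/4 by norm_num)
  filter_upwards [ev_Q, tl.eventually e1, tl.eventually_ge_atTop 1] with N hQ h1 hl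
  refine le_trans ?_ hQ
  set l := Real.log N
  rw [le_div_iff₀ (by linarith)]
  have h2 : ((4*(l/8))^K)^3 ≤ l^(3*K) := by
    rw [← pow_mul, mul_comm K 3]
    exact pow_le_pow_left₀ (by linarith) (by linarith) _
  have h3 : Real.exp (2*(δ*(l/8))) ≤ Real.exp (1/4*l) := Real.exp_le_exp.mpr (by nlinarith)
  calc _ ≤ Real.exp (1/4*l) * l^(3*K) * (3*l) := by gcongr
    _ = Real.exp (1/4*l) * (3*l^(3*K+1)) := by ring
    _ ≤ Real.exp (1/4*l) * Real.exp (3/4*l) := by gcongr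
    _ = Real.exp l := by rw [← Real.exp_add]; congr 1; ring

lemma ev_err2 (k j : ℕ) {δ C B : ℝ} (hδ1 : δ ≤ 1) (hC : 0 < C) (hB : B = ((2*k+2^j+2+2*k+1:ℕ):ℝ)) : ∀ᶠ N : ℕ in atTop,
    k * err2 k j N (Real.log N/8) ((Real.log N)^(2*k+2^j+2)) B C + 9*(Real.log N/8)*err1 k (Real.log N/8)
      + k*(9*(Real.log N/8))*(k*Real.exp (δ*(Real.log N/8))*err1 k (Real.log N/8)) ≤ ((N/2:ℕ):ℝ)/primorial (ww N) * (Real.log N/8) := by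
  have e1 := polyexp (96*(1+(k:ℝ)^2)) (4*k+1) (show (0:ℝ) < 5/8 by norm_num)
  filter_upwards [ev_Q, tl.eventually e1, tl.eventually_ge_atTop 2, tl.eventually_ge_atTop (48*(k*(6*C+36))), eventually_ge_atTop 3] with N hQ h1 hl hl2 hN
  have hN0 : (0:ℝ) < N := by have : 0 < N := by omega
                             exact_mod_cast this
  have hlog3 : Real.log (3*N) ≤ 2*Real.log N := by
    rw [Real.log_mul (by norm_num) hN0.ne']
    have : Real.log 3 ≤ Real.log N := Real.log_le_log (by norm_num) (by exact_mod_cast hN)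
    linarith
  have hlog30 : 0 ≤ Real.log (3*N) := Real.log_nonneg (by have : (3:ℝ) ≤ N := by exact_mod_cast hN
                                                          linarith)
  set l := Real.log N with hld
  have hNe : (N:ℝ) = Real.exp l := (Real.exp_log hN0).symm
  have hl0 : 0 < l := by linarith
  have hR : (N:ℝ)/24 ≤ ((N/2:ℕ):ℝ)/primorial (ww N) * (l/8) := by
    have := mul_le_mul_of_nonneg_right hQ (show 0 ≤ l/8 by linarith)
    refine le_trans (le_of_eq ?_) this
    rw [hNe]; field_simp; norm_num
  refine le_trans ?_ hR
  have hE2 : k * err2 k j N (l/8) (l^(2*k+2^j+2)) B C ≤ N/48 := by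
    have h3 : err2 k j N (l/8) (l^(2*k+2^j+2)) B C ≤ (6*C+36)*N/l := by
      unfold err2
      rw [← hld, hB, Real.rpow_natCast]
      have h4 : ((4*(l/8))^k)^2 ≤ l^(2*k) := by
        rw [← pow_mul, mul_comm k 2]
        exact pow_le_pow_left₀ (by linarith) (by linarith) _
      have h5 : l^(2*k+2^j+2)*(6*C*N/l^(2*k+2^j+2+2*k+1)) = 6*C*N/(l^(2*k)*l) := by
        rw [show 2*k+2^j+2+2*k+1 = (2*k+2^j+2)+(2*k)+1 by ring, pow_add _ ((2*k+2^j+2)+2*k), pow_add _ (2*k+2^j+2)]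
        field_simp
      have h6 : 18*N*Real.log (3*N)/l^(2*k+2^j+2)*(8*(l/8))^(2^j) ≤ 36*N/(l^(2*k)*l) := by
        rw [show 8*(l/8) = l by ring]
        calc _ ≤ 18*N*(2*l)/l^(2*k+2^j+2)*l^(2^j) := by gcongr
          _ = _ := by rw [pow_add, pow_add]; field_simp; norm_num
      rw [h5]
      calc _ ≤ l^(2*k) * (6*C*N/(l^(2*k)*l) + 36*N/(l^(2*k)*l)) := by gcongr
        _ = _ := by field_simp
    calc _ ≤ k * ((6*C+36)*N/l) := by gcongr
      _ = k*(6*C+36)/l * N := by ring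
      _ ≤ 1/48 * N := by
        refine mul_le_mul_of_nonneg_right ?_ hN0.le
        rw [div_le_iff₀ hl0]; linarith
      _ = _ := by ring
  have hE1 : err1 k (l/8) ≤ Real.exp (1/4*l) * l^(4*k) := by
    unfold err1
    have h4 : ((4*(l/8))^k)^2 ≤ l^(2*k) := by
      rw [← pow_mul, mul_comm k 2]
      exact pow_le_pow_left₀ (by linarith) (by linarith) _
    calc _ ≤ (Real.exp (l/8) * l^(2*k))^2 := by gcongr
      _ = Real.exp (l/8+l/8) * l^(4*k) := by rw [Real.exp_add]; ring
      _ = _ := by congr 2; ring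
  have hE10 : 0 ≤ err1 k (l/8) := by unfold err1; positivity
  have hδe : Real.exp (δ*(l/8)) ≤ Real.exp (1/8*l) := Real.exp_le_exp.mpr (by nlinarith)
  have h7 : 9*(l/8)*err1 k (l/8) + k*(9*(l/8))*(k*Real.exp (δ*(l/8))*err1 k (l/8)) ≤ N/48 := by
    have h8 : (1:ℝ) ≤ Real.exp (1/8*l) := Real.one_le_exp (by linarith)
    calc _ = 9*(l/8)*err1 k (l/8) * (1 + (k:ℝ)^2*Real.exp (δ*(l/8))) := by ring
      _ ≤ 9*(l/8)*(Real.exp (1/4*l) * l^(4*k)) * (Real.exp (1/8*l) + (k:ℝ)^2*Real.exp (1/8*l)) := by gcongr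
      _ = 9/8*(1+(k:ℝ)^2)*l^(4*k+1)*Real.exp (1/4*l + 1/8*l) := by rw [Real.exp_add]; ring
      _ ≤ 2*(1+(k:ℝ)^2)*l^(4*k+1)*Real.exp (1/4*l + 1/8*l) := by gcongr; norm_num
      _ = 1/48*((96*(1+(k:ℝ)^2)*l^(4*k+1))*Real.exp (1/4*l + 1/8*l)) := by ring
      _ ≤ 1/48*(Real.exp (5/8*l)*Real.exp (1/4*l + 1/8*l)) := by gcongr
      _ = N/48 := by rw [← Real.exp_add, hNe, show 5/8*l+(1/4*l+1/8*l) = l by ring]; ring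
  linarith
end GPY

namespace GPY

lemma union_sum (Ls : Finset ℕ) (k : ℕ) {y : ℝ} (hy : 0 ≤ y) :
    ∑ x ∈ powersetCard k Ls ×ˢ powersetCard k Ls, y ^ (x.1 ∪ x.2).card ≤ ∑ m ∈ Icc k (2*k), (4*y*Ls.card)^m := by
  classical
  have hmap : ∀ x ∈ powersetCard k Ls ×ˢ powersetCard k Ls, x.1 ∪ x.2 ∈ Ls.powerset.filter (fun V => V.card ∈ Icc k (2*k)) := by
    intro x hx
    rw [mem_product, mem_powersetCard, mem_powersetCard] at hx
    rw [mem_filter, mem_powerset, mem_Icc]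
    refine ⟨union_subset hx.1.1 hx.2.1, ?_, ?_⟩
    · rw [← hx.1.2]; exact card_le_card subset_union_left
    · have := card_union_le x.1 x.2
      omega
  rw [← sum_fiberwise_of_maps_to hmap]
  calc _ ≤ ∑ V ∈ Ls.powerset.filter (fun V => V.card ∈ Icc k (2*k)), (4*y)^V.card := by
        refine sum_le_sum fun V _ => ?_
        have h1 : ∀ x ∈ (powersetCard k Ls ×ˢ powersetCard k Ls).filter (fun x => x.1 ∪ x.2 = V), y ^ (x.1 ∪ x.2).card = y ^ V.card := by
          intro x hx; rw [(mem_filter.mp hx).2]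
        rw [sum_congr rfl h1, sum_const, nsmul_eq_mul, mul_pow]
        refine mul_le_mul_of_nonneg_right ?_ (by positivity)
        have h2 : (powersetCard k Ls ×ˢ powersetCard k Ls).filter (fun x => x.1 ∪ x.2 = V) ⊆ V.powerset ×ˢ V.powerset := by
          intro x hx
          have h3 := (mem_filter.mp hx).2
          rw [mem_product, mem_powerset, mem_powerset, ← h3]
          exact ⟨subset_union_left, subset_union_right⟩
        have h3 := card_le_card h2
        rw [card_product, card_powerset, ← mul_pow] at h3
        exact_mod_cast h3
    _ = ∑ m ∈ Icc k (2*k), ∑ V ∈ (Ls.powerset.filter (fun V => V.card ∈ Icc k (2*k))).filter (fun V => V.card = m), (4*y)^V.card := by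
        rw [sum_fiberwise_of_maps_to]
        intro V hV
        exact (mem_filter.mp hV).2
    _ ≤ _ := by
        refine sum_le_sum fun m _ => ?_
        have h1 : ∀ V ∈ (Ls.powerset.filter (fun V => V.card ∈ Icc k (2*k))).filter (fun V => V.card = m), (4*y)^V.card = (4*y)^m := by
          intro V hV; rw [(mem_filter.mp hV).2]
        rw [sum_congr rfl h1, sum_const, nsmul_eq_mul, mul_pow (4*y), mul_comm]
        refine mul_le_mul_of_nonneg_left ?_ (by positivity)
        have h2 : (Ls.powerset.filter (fun V => V.card ∈ Icc k (2*k))).filter (fun V => V.card = m) ⊆ powersetCard m Ls := by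
          intro V hV
          rw [mem_filter, mem_filter, mem_powerset] at hV
          rw [mem_powersetCard]
          exact ⟨hV.1.1, hV.2⟩
        have h3 := card_le_card h2
        rw [card_powersetCard] at h3
        have h4 := h3.trans (Nat.choose_le_pow _ _)
        exact_mod_cast h4

lemma cauchy_union (Ls : Finset ℕ) (k : ℕ) (G : Finset ℕ → Finset ℕ) {g q y : ℝ} (hg0 : 0 ≤ g) (hq : 0 ≤ q) (hy : 0 ≤ y)
    (hg : ∀ H ∈ powersetCard k Ls, g ≤ (G H).card)
    (hGG : ∀ H ∈ powersetCard k Ls, ∀ H' ∈ powersetCard k Ls, ((G H ∩ G H').card : ℝ) ≤ q * y^(H ∪ H').card) :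
    ((Ls.card.choose k : ℕ) * g)^2 ≤ (((powersetCard k Ls).biUnion G).card : ℝ) * (q * ∑ m ∈ Icc k (2*k), (4*y*Ls.card)^m) := by
  classical
  set PS := powersetCard k Ls with hPS
  set Bu := PS.biUnion G with hBu
  set r : ℕ → ℝ := fun n => ∑ H ∈ PS, if n ∈ G H then 1 else 0 with hr
  have hsub : ∀ H ∈ PS, G H ⊆ Bu := fun H hH => subset_biUnion_of_mem G hH
  have h1 : ∑ n ∈ Bu, r n = ∑ H ∈ PS, ((G H).card : ℝ) := by
    rw [hr, sum_comm]
    refine sum_congr rfl fun H hH => ?_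
    rw [← sum_filter, sum_const, nsmul_eq_mul, mul_one]
    congr 2
    rw [filter_mem_eq_inter, inter_eq_right.mpr (hsub H hH)]
  have h2 : ∑ n ∈ Bu, r n ^ 2 = ∑ x ∈ PS ×ˢ PS, ((G x.1 ∩ G x.2).card : ℝ) := by
    have e1 : ∀ n, r n ^ 2 = ∑ x ∈ PS ×ˢ PS, if n ∈ G x.1 ∩ G x.2 then (1:ℝ) else 0 := by
      intro n
      rw [sq, hr, sum_mul_sum, sum_product]
      refine sum_congr rfl fun H _ => sum_congr rfl fun H' _ => ?_
      simp only [mem_inter]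
      by_cases a : n ∈ G H <;> by_cases b : n ∈ G H' <;> simp [a, b]
    rw [sum_congr rfl fun n _ => e1 n, sum_comm]
    refine sum_congr rfl fun x hx => ?_
    rw [← sum_filter, sum_const, nsmul_eq_mul, mul_one]
    congr 2
    rw [filter_mem_eq_inter, inter_eq_right.mpr (inter_subset_left.trans (hsub x.1 (mem_product.mp hx).1))]
  have h3 := sq_sum_le_card_mul_sum_sq (s := Bu) (f := r)
  have h4 : (Ls.card.choose k : ℕ) * g ≤ ∑ n ∈ Bu, r n := by
    rw [h1, ← card_powersetCard, ← nsmul_eq_mul, ← sum_const]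
    exact sum_le_sum hg
  have h5 : ∑ n ∈ Bu, r n ^ 2 ≤ q * ∑ m ∈ Icc k (2*k), (4*y*Ls.card)^m := by
    rw [h2]
    calc _ ≤ ∑ x ∈ PS ×ˢ PS, q * y^(x.1 ∪ x.2).card := sum_le_sum fun x hx => hGG _ (mem_product.mp hx).1 _ (mem_product.mp hx).2
      _ = q * ∑ x ∈ PS ×ˢ PS, y^(x.1 ∪ x.2).card := by rw [mul_sum]
      _ ≤ _ := mul_le_mul_of_nonneg_left (union_sum Ls k hy) hq
  exact (pow_le_pow_left₀ (by positivity) h4 2).trans (h3.trans (mul_le_mul_of_nonneg_left h5 (Nat.cast_nonneg _)))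
end GPY

namespace GPY

noncomputable def c1 (k s : ℕ) (A : ℝ) : ℝ := 1/((4*(1+A))^k*(((2^s*4)^k)^2*(k*9)))
noncomputable def D3 (k : ℕ) (δ : ℝ) : ℝ := ∑ m ∈ Icc k (2*k), (512*k/δ)^m
noncomputable def c4 (k s : ℕ) (A δ : ℝ) : ℝ := (c1 k s A / k.factorial)^2/(6*D3 k δ)

lemma c1_pos {k s : ℕ} {A : ℝ} (hk : 1 ≤ k) (hA : 1 ≤ A) : 0 < c1 k s A := by
  have : (0:ℝ) < k := by exact_mod_cast hk
  unfold c1; positivity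

lemma D3_pos {k : ℕ} {δ : ℝ} (hk : 1 ≤ k) (hδ : 0 < δ) : 0 < D3 k δ := by
  have : (0:ℝ) < k := by exact_mod_cast hk
  unfold D3
  exact sum_pos (fun m _ => by positivity) ⟨k, by rw [mem_Icc]; omega⟩

lemma c4_pos {k s : ℕ} {A δ : ℝ} (hk : 1 ≤ k) (hA : 1 ≤ A) (hδ : 0 < δ) : 0 < c4 k s A δ := by
  have := c1_pos (s := s) hk hA
  have := D3_pos hk hδ
  have := k.factorial_pos
  unfold c4; positivity

lemma c1_alg {k s : ℕ} {A X L Q c : ℝ} (hk : 1 ≤ k) (hA : 1 ≤ A) (hX : 0 < X) (hL : 0 < L)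
    (h : Q * L * (X/(4*(1+A)))^k ≤ c * (((2^s*(4*X))^k)^2*(k*(9*L)))) : c1 k s A * Q / X^k ≤ c := by
  have hk0 : (0:ℝ) < k := by exact_mod_cast hk
  have hpos : 0 < (((2^s*(4*X))^k)^2*(k*(9*L))) := by positivity
  refine le_of_mul_le_mul_right (le_trans (le_of_eq ?_) h) hpos
  unfold c1
  rw [div_pow, show ((2:ℝ)^s*(4*X))^k = (2^s*4)^k*X^k by rw [← mul_pow]; ring]
  have : (0:ℝ) < (4*(1+A))^k := by positivity
  field_simp

lemma AP_union {w z : ℕ} {H H' : Finset ℕ} {n : ℕ} (h : AP w z H n) (h' : AP w z H' n) : AP w z (H ∪ H') n := by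
  intro p hp u hu
  unfold PU at hp
  rw [mem_filter] at hp
  obtain ⟨a, b, c⟩ := hp
  rcases mem_union.mp hu with hu | hu
  · exact h p (mem_filter.mpr ⟨a, b, fun x hx y hy => c x (mem_union_left _ hx) y (mem_union_left _ hy)⟩) u hu
  · exact h' p (mem_filter.mpr ⟨a, b, fun x hx y hy => c x (mem_union_right _ hx) y (mem_union_right _ hy)⟩) u hu

lemma per_b {k : ℕ} {A δ ε : ℝ} {s N w : ℕ} {L : ℝ} (e : Env (2*k) ε N w L) (n : Num k A δ ε s)
    (hn1 : ((2*k:ℕ):ℝ)^2*ε ≤ 1/2) (hn2 : ε ≤ δ/(2*((2*k:ℕ):ℝ)))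
    (M b : ℕ) (hM : M ≤ N) (h2N : Real.log N ≤ N) 
    {B C T : ℝ} (hB : 0 < B) (hC : 0 < C)
    (hlev : ∀ X : ℕ, 2 ≤ X → ∑ q ∈ Icc 1 ⌊(X:ℝ) ^ (1/2:ℝ)⌋₊, EE X q ≤ C * X / (Real.log X) ^ B)
    (hT : 0 < T) {j : ℕ} (hj : ((k + 1) ^ 4 : ℝ) ≤ 2 ^ j)
    (herr : k * err2 k j N L T B C + 9*L*err1 k L + k*(9*L)*(k*Real.exp (δ*L)*err1 k L) ≤ (M:ℝ)/primorial w * L)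
    (herr1 : Real.exp (2*(δ*L)) * ((4*L)^(2*k))^3 ≤ (M:ℝ)/primorial w)
    (Ls : Finset ℕ) (hLl : ∀ u ∈ Ls, (u:ℝ) ≤ Real.log N) (hLc : ∀ u ∈ Ls, Nat.Coprime (b + u) (primorial w))
    {η : ℝ} (hη : 0 < η) (hη1 : η ≤ 1) (hlo : 2*η*(be w*L) ≤ Ls.card) (hk2 : 2*k ≤ Ls.card) (hhi : (Ls.card:ℝ) ≤ 16*η*(be w*L)) :
    c4 k s A δ * η^k * ((M:ℝ)/primorial w) ≤
      (((powersetCard k Ls).biUnion (fun H => GS N M (primorial w) b w ⌊Real.exp (δ*L)⌋₊ H)).card : ℝ) := by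
  classical
  have hL0 : 0 < L := by linarith [e.hL]
  have hk := n.hk
  have hk0 : (0:ℝ) < k := by exact_mod_cast hk
  have hX : 0 < be w * L := mul_pos (be_pos w) hL0
  set X := be w * L with hXd
  set Q := (M:ℝ)/primorial w with hQd
  have hQ0 : 0 < Q := lt_of_lt_of_le (by positivity) herr1
  have hδ := n.hδ
  have hc1 := c1_pos (s := s) hk n.hA
  have hD3 := D3_pos hk hδ
  have hσ' : (k:ℝ)^2 * Real.log (Real.log N) ≤ 1/4*(w*Real.log w) := by
    refine le_trans (mul_le_mul_of_nonneg_right ?_ (Real.log_nonneg e.logN)) e.hσ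
    push_cast
    nlinarith
  have ek : Env k ε N w L := { e with hσ := hσ' }
  have hc := cauchy_union Ls k (fun H => GS N M (primorial w) b w ⌊Real.exp (δ*L)⌋₊ H)
    (g := c1 k s A * Q / X^k) (q := 6*Q) (y := 4*((2*k:ℕ):ℝ)/(δ*X)) (by positivity) (by positivity) (by positivity)
    (by
      intro H hH
      obtain ⟨hs, hcard⟩ := mem_powersetCard.mp hH
      exact c1_alg hk n.hA hX hL0 (prop2 ek n hcard (fun u hu => hLl u (hs hu)) M b hM h2N (fun u hu => hLc u (hs hu)) hB hC hlev hT hj herr))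
    (by
      intro H hH H' hH'
      obtain ⟨hs, hcard⟩ := mem_powersetCard.mp hH
      obtain ⟨hs', hcard'⟩ := mem_powersetCard.mp hH'
      have h1 := prop1 e (U := H ∪ H') (by omega) hδ n.hδ1 n.ε1 hn1 hn2 ((card_union_le _ _).trans (by omega))
        (fun u hu => by
          rcases mem_union.mp hu with hu | hu
          · exact hLl u (hs hu)
          · exact hLl u (hs' hu)) M b herr1
      refine le_trans ?_ h1
      have : ∀ s t : Finset ℕ, s ⊆ t → (s.card:ℝ) ≤ t.card := fun s t h => by exact_mod_cast card_le_card h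
      refine this _ _ ?_
      intro m hm
      rw [mem_inter] at hm
      unfold GS at hm
      rw [mem_filter, mem_filter] at hm
      exact mem_filter.mpr ⟨hm.1.1, AP_union hm.1.2.1 hm.2.2.1⟩)
  set Bu : ℝ := (((powersetCard k Ls).biUnion (fun H => GS N M (primorial w) b w ⌊Real.exp (δ*L)⌋₊ H)).card : ℝ) with hBu
  have hf0 : (0:ℝ) < k.factorial := by exact_mod_cast k.factorial_pos
  have hch : (η*X)^k ≤ k.factorial * (Ls.card.choose k : ℝ) := by
    have h1 := Nat.pow_sub_le_descFactorial Ls.card k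
    rw [Nat.descFactorial_eq_factorial_mul_choose] at h1
    have h2 : η*X ≤ ((Ls.card + 1 - k : ℕ):ℝ) := by
      have h3 : (Ls.card:ℝ) ≤ 2*((Ls.card + 1 - k : ℕ):ℝ) := by
        have : Ls.card ≤ 2*(Ls.card + 1 - k) := by omega
        exact_mod_cast this
      nlinarith
    calc (η*X)^k ≤ ((Ls.card + 1 - k : ℕ):ℝ)^k := pow_le_pow_left₀ (by positivity) h2 k
      _ ≤ _ := by exact_mod_cast h1
  have hS : ∑ m ∈ Icc k (2*k), (4*(4*((2*k:ℕ):ℝ)/(δ*X))*Ls.card)^m ≤ η^k * D3 k δ := by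
    unfold D3
    rw [mul_sum]
    refine sum_le_sum fun m hm => ?_
    have hm1 := (mem_Icc.mp hm).1
    have h1 : 4*(4*((2*k:ℕ):ℝ)/(δ*X))*Ls.card ≤ η * (512*k/δ) := by
      calc 4*(4*((2*k:ℕ):ℝ)/(δ*X))*Ls.card ≤ 4*(4*((2*k:ℕ):ℝ)/(δ*X))*(16*η*X) := mul_le_mul_of_nonneg_left hhi (by positivity)
        _ = _ := by push_cast; field_simp; norm_num
    calc _ ≤ (η * (512*k/δ))^m := pow_le_pow_left₀ (by positivity) h1 m
      _ = η^m * (512*k/δ)^m := mul_pow _ _ _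
      _ ≤ _ := mul_le_mul_of_nonneg_right (pow_le_pow_of_le_one hη.le hη1 hm1) (by positivity)
  have h6 : η^k * (c1 k s A / k.factorial) * Q ≤ (Ls.card.choose k : ℕ) * (c1 k s A * Q / X^k) := by
    calc η^k * (c1 k s A / k.factorial) * Q = (η*X)^k/k.factorial * (c1 k s A * Q / X^k) := by
          rw [mul_pow]; field_simp
      _ ≤ _ := mul_le_mul_of_nonneg_right (by rw [div_le_iff₀ hf0]; linarith) (by positivity)
  have hB0 : 0 ≤ Bu := Nat.cast_nonneg _
  have h7 : (η^k * (c1 k s A / k.factorial) * Q)^2 ≤ Bu * (6*Q*(η^k * D3 k δ)) :=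
    (pow_le_pow_left₀ (by positivity) h6 2).trans (hc.trans (mul_le_mul_of_nonneg_left (mul_le_mul_of_nonneg_left hS (by positivity)) hB0))
  have hp : 0 < 6*Q*(η^k * D3 k δ) := by positivity
  refine le_of_mul_le_mul_right (le_trans (le_of_eq ?_) h7) hp
  unfold c4
  field_simp
end GPY

namespace GPY

lemma blocks (W b m : ℕ) : ((Ico 1 (1+m*W)).filter (fun u => Nat.Coprime (b+u) W)).card = m * Nat.totient W := by
  induction m with
  | zero => simp
  | succ m ih =>
    have h1 : Ico 1 (1+(m+1)*W) = Ico 1 (1+m*W) ∪ Ico (1+m*W) (1+m*W+W) := by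
      rw [Ico_union_Ico_eq_Ico (by omega) (by omega)]
      congr 1; ring
    have h2 : ((Ico (1+m*W) (1+m*W+W)).filter (fun u => Nat.Coprime (b+u) W)).card = Nat.totient W := by
      rw [← cop_window W (b+(1+m*W))]
      refine card_bij (fun u _ => b+u) ?_ ?_ ?_
      · intro u hu
        rw [mem_filter, mem_Ico] at hu ⊢
        exact ⟨by omega, hu.2⟩
      · intro u _ v _ h
        omega
      · intro r hr
        rw [mem_filter, mem_Ico] at hr
        refine ⟨r-b, ?_, by omega⟩
        rw [mem_filter, mem_Ico, show b+(r-b) = r by omega]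
        exact ⟨by omega, hr.2⟩
    rw [h1, filter_union, card_union_of_disjoint, ih, h2]
    · ring
    · exact disjoint_filter_filter (Ico_disjoint_Ico_consecutive _ _ _)

lemma Lcard (w b h : ℕ) (hh : primorial w ≤ h) :
    be w * h / 2 ≤ ((Ioc 0 h).filter (fun u => Nat.Coprime (b+u) (primorial w))).card ∧
    (((Ioc 0 h).filter (fun u => Nat.Coprime (b+u) (primorial w))).card : ℝ) ≤ 2 * (be w * h) := by
  have hW := primorial_pos w
  set W := primorial w with hWd
  set m := h / W with hm
  have hm1 : 1 ≤ m := (Nat.one_le_div_iff hW).mpr hh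
  have h1 : m * W ≤ h := Nat.div_mul_le_self h W
  have h2 : h < (m+1)*W := by
    have := Nat.lt_div_mul_add hW (a := h)
    rw [← hm] at this
    linarith
  have hW0 : (0:ℝ) < W := by exact_mod_cast hW
  have hφ : (0:ℝ) ≤ (Nat.totient W:ℝ) := Nat.cast_nonneg _
  have h1' : (m:ℝ)*W ≤ h := by exact_mod_cast h1
  have h2' : (h:ℝ) ≤ (m+1)*W := by exact_mod_cast h2.le
  have hm1' : (1:ℝ) ≤ m := by exact_mod_cast hm1
  unfold be
  rw [← hWd]
  constructor
  · have h3 : m * Nat.totient W ≤ ((Ioc 0 h).filter (fun u => Nat.Coprime (b+u) W)).card := by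
      rw [← blocks W b m]
      refine card_le_card (filter_subset_filter _ ?_)
      intro u hu
      rw [mem_Ico] at hu
      rw [mem_Ioc]
      omega
    have h3' : (m:ℝ) * Nat.totient W ≤ ((Ioc 0 h).filter (fun u => Nat.Coprime (b+u) W)).card := by exact_mod_cast h3
    refine le_trans ?_ h3'
    calc (Nat.totient W:ℝ)/W*h/2 ≤ (Nat.totient W:ℝ)/W*(2*m*W)/2 := by
          gcongr; nlinarith
      _ = _ := by field_simp
  · have h3 : ((Ioc 0 h).filter (fun u => Nat.Coprime (b+u) W)).card ≤ (m+1) * Nat.totient W := by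
      rw [← blocks W b (m+1)]
      refine card_le_card (filter_subset_filter _ ?_)
      intro u hu
      rw [mem_Ioc] at hu
      rw [mem_Ico]
      omega
    have h3' : (((Ioc 0 h).filter (fun u => Nat.Coprime (b+u) W)).card:ℝ) ≤ ((m:ℝ)+1) * Nat.totient W := by exact_mod_cast h3
    refine h3'.trans ?_
    calc ((m:ℝ)+1) * Nat.totient W = 2*((Nat.totient W:ℝ)/W*((m+1)/2*W)) := by field_simp
      _ ≤ _ := by gcongr; nlinarith

lemma gap_comb (N M h : ℕ) (H : ℝ) (hN : N + M + h ≤ 2*N) (hh : (h:ℝ) ≤ H) (Bs : Finset ℕ) (hBs : Bs ⊆ Ioc N (N+M))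
    (hp : ∀ n ∈ Bs, ∃ u u' : ℕ, 0 < u ∧ u < u' ∧ u' ≤ h ∧ (n+u).Prime ∧ (n+u').Prime) : Bs.card ≤ h * gapCount N H := by
  have key : ∀ n ∈ Bs, n < nthPrime (Nat.count Nat.Prime (n+1)) ∧ nthPrime (Nat.count Nat.Prime (n+1)) ≤ n + h ∧
      nthPrime (Nat.count Nat.Prime (n+1) + 1) ≤ n + h := by
    intro n hn
    obtain ⟨u, u', h0, h1, h2, p1, p2⟩ := hp n hn
    have i1 : Nat.count Nat.Prime (n+1) ≤ Nat.count Nat.Prime (n+u) := Nat.count_monotone _ (by omega)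
    have i2 : Nat.count Nat.Prime (n+u) + 1 ≤ Nat.count Nat.Prime (n+u') := by
      rw [← Nat.count_succ_eq_succ_count_iff.mpr p1]
      exact Nat.count_monotone _ (by omega)
    have mono : Monotone nthPrime := (Nat.nth_strictMono Nat.infinite_setOf_prime).monotone
    refine ⟨Nat.le_nth_count Nat.infinite_setOf_prime (n+1), ?_, ?_⟩
    · refine (mono i1).trans ?_
      unfold nthPrime
      rw [Nat.nth_count p1]
      omega
    · refine (mono (show _ ≤ Nat.count Nat.Prime (n+u') by omega)).trans ?_
      unfold nthPrime
      rw [Nat.nth_count p2]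
      omega
  unfold gapCount
  refine card_le_mul_card_image_of_maps_to (f := fun n => Nat.count Nat.Prime (n+1)) ?_ h ?_
  · intro n hn
    obtain ⟨k1, k2, k3⟩ := key n hn
    have hnN := mem_Ioc.mp (hBs hn)
    rw [mem_filter, mem_range]
    refine ⟨?_, by omega, by omega, ?_⟩
    · have := Nat.count_le (p := Nat.Prime) (n := n+1)
      by_contra hcon
      have : n + 1 ≤ 2*N := by omega
      omega
    · have a1 : (nthPrime (Nat.count Nat.Prime (n+1) + 1) : ℝ) ≤ n + h := by exact_mod_cast k3
      have a2 : (n:ℝ) ≤ nthPrime (Nat.count Nat.Prime (n+1)) := by exact_mod_cast k1.le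
      linarith
  · intro j _
    have : (Bs.filter (fun n => Nat.count Nat.Prime (n+1) = j)) ⊆ Ico (nthPrime j - h) (nthPrime j) := by
      intro n hn
      rw [mem_filter] at hn
      obtain ⟨k1, k2, k3⟩ := key n hn.1
      rw [hn.2] at k1 k2
      rw [mem_Ico]
      omega
    refine (card_le_card this).trans ?_
    rw [Nat.card_Ico]
    omega
end GPY

namespace GPY
open Filter

lemma total {k : ℕ} {A δ ε : ℝ} {s N w : ℕ} {L : ℝ} (e : Env (2*k) ε N w L) (n : Num k A δ ε s)
    (hn1 : ((2*k:ℕ):ℝ)^2*ε ≤ 1/2) (hn2 : ε ≤ δ/(2*((2*k:ℕ):ℝ)))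
    (M : ℕ) (hM : M ≤ N) (h2N : Real.log N ≤ N)
    {B C T : ℝ} (hB : 0 < B) (hC : 0 < C)
    (hlev : ∀ X : ℕ, 2 ≤ X → ∑ q ∈ Icc 1 ⌊(X:ℝ) ^ (1/2:ℝ)⌋₊, EE X q ≤ C * X / (Real.log X) ^ B)
    (hT : 0 < T) {j : ℕ} (hj : ((k + 1) ^ 4 : ℝ) ≤ 2 ^ j)
    (herr : k * err2 k j N L T B C + 9*L*err1 k L + k*(9*L)*(k*Real.exp (δ*L)*err1 k L) ≤ (M:ℝ)/primorial w * L)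
    (herr1 : Real.exp (2*(δ*L)) * ((4*L)^(2*k))^3 ≤ (M:ℝ)/primorial w)
    {η : ℝ} (hη : 0 < η) (hη1 : η ≤ 1) (hl : Real.log N = 8*L) (h : ℕ) (hWh : primorial w ≤ h)
    (hh1 : (h:ℝ) ≤ η*Real.log N) (hh2 : η*Real.log N/2 ≤ h) (h2k : ((2*k:ℕ):ℝ) ≤ 2*η*(be w*L)) (hN : N + M + h ≤ 2*N) :
    c4 k s A δ * η^k * M ≤ h * gapCount N (η*Real.log N) := by
  classical
  set W := primorial w with hWd
  have hW := primorial_pos w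
  rw [← hWd] at hW
  have hW0 : (0:ℝ) < W := by exact_mod_cast hW
  have hL0 : 0 < L := by linarith [e.hL]
  have hbe := be_pos w
  set Lb : ℕ → Finset ℕ := fun b => (Ioc 0 h).filter (fun u => Nat.Coprime (b+u) W) with hLb
  set Bb : ℕ → Finset ℕ := fun b => (powersetCard k (Lb b)).biUnion (fun H => GS N M W b w ⌊Real.exp (δ*L)⌋₊ H) with hBb
  have hmem : ∀ b, ∀ m ∈ Bb b, m ∈ Ioc N (N+M) ∧ m ≡ b [MOD W] ∧ ∃ u u' : ℕ, 0 < u ∧ u < u' ∧ u' ≤ h ∧ (m+u).Prime ∧ (m+u').Prime := by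
    intro b m hm
    obtain ⟨H, hH, hm⟩ := mem_biUnion.mp hm
    have hHs := (mem_powersetCard.mp hH).1
    unfold GS SS at hm
    rw [mem_filter, mem_filter] at hm
    obtain ⟨⟨a1, a2⟩, a3, u, hu, u', hu', hne, p1, p2⟩ := hm
    have q1 := mem_Ioc.mp (mem_filter.mp (hHs hu)).1
    have q2 := mem_Ioc.mp (mem_filter.mp (hHs hu')).1
    refine ⟨a1, a2, ?_⟩
    rcases Nat.lt_or_gt_of_ne hne with hlt | hlt
    · exact ⟨u, u', q1.1, hlt, q2.2, p1, p2⟩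
    · exact ⟨u', u, q2.1, hlt, q1.2, p2, p1⟩
  have hb : ∀ b, c4 k s A δ * η^k * ((M:ℝ)/W) ≤ (Bb b).card := by
    intro b
    obtain ⟨l1, l2⟩ := Lcard w b h hWh
    have lo : 2*η*(be w*L) ≤ (Lb b).card := by
      refine le_trans ?_ l1
      have := mul_le_mul_of_nonneg_left hh2 hbe.le
      rw [hl] at this
      linarith
    refine per_b e n hn1 hn2 M b hM h2N hB hC hlev hT hj herr herr1 (Lb b) ?_ (fun u hu => (mem_filter.mp hu).2) hη hη1 lo ?_ ?_
    · intro u hu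
      have h1 := (mem_Ioc.mp (mem_filter.mp hu).1).2
      have h2 : (u:ℝ) ≤ h := by exact_mod_cast h1
      have h3 : 0 ≤ Real.log N := by linarith
      nlinarith
    · exact_mod_cast h2k.trans lo
    · refine l2.trans ?_
      have := mul_le_mul_of_nonneg_left hh1 hbe.le
      rw [hl] at this
      linarith
  have hdis : ((range W : Finset ℕ) : Set ℕ).PairwiseDisjoint Bb := by
    intro b hb b' hb' hne
    refine disjoint_left.mpr fun m hm hm' => hne ?_
    have h1 := (hmem b m hm).2.1
    have h2 := (hmem b' m hm').2.1
    exact Nat.ModEq.eq_of_lt_of_lt (h1.symm.trans h2) (mem_range.mp hb) (mem_range.mp hb')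
  have hg := gap_comb N M h (η*Real.log N) hN hh1 ((range W).biUnion Bb)
    (by
      intro m hm
      obtain ⟨b, _, hm⟩ := mem_biUnion.mp hm
      exact (hmem b m hm).1)
    (by
      intro m hm
      obtain ⟨b, _, hm⟩ := mem_biUnion.mp hm
      exact (hmem b m hm).2.2)
  rw [card_biUnion hdis] at hg
  have hg' : ∑ b ∈ range W, ((Bb b).card:ℝ) ≤ h * gapCount N (η*Real.log N) := by exact_mod_cast hg
  refine le_trans ?_ hg'
  calc c4 k s A δ * η^k * M = ∑ b ∈ range W, c4 k s A δ * η^k * ((M:ℝ)/W) := by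
        rw [sum_const, card_range, nsmul_eq_mul]; field_simp
    _ ≤ _ := sum_le_sum fun b _ => hb b

lemma final {k : ℕ} {A δ ε : ℝ} {s : ℕ} (n : Num k A δ ε s)
    (hn1 : ((2*k:ℕ):ℝ)^2*ε ≤ 1/2) (hn2 : ε ≤ δ/(2*((2*k:ℕ):ℝ))) {ϑ : ℝ} (hϑ : 1/2 < ϑ) (hlev : HasLevelOfDistribution ϑ)
    {η : ℝ} (hη : 0 < η) (hη1 : η ≤ 1) :
    ∀ᶠ N : ℕ in atTop, c4 k s A δ/3 * η^(k-1) * N / Real.log N ≤ gapCount N (η*Real.log N) := by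
  obtain ⟨j, hj⟩ := pow_unbounded_of_one_lt (((k:ℝ)+1)^4) (show (1:ℝ) < 2 by norm_num)
  obtain ⟨B, hBd⟩ : ∃ B : ℝ, B = ((2*k+2^j+2+2*k+1:ℕ):ℝ) := ⟨_, rfl⟩
  have hB : 0 < B := by rw [hBd]; positivity
  obtain ⟨C, hC, hE⟩ := EE_level hlev hϑ B hB
  have hr : Tendsto (fun N : ℕ => (Real.log N)^(1/2:ℝ)) atTop atTop := (tendsto_rpow_atTop (by norm_num)).comp tl
  have hpe := polyexp 4 1 (show (0:ℝ) < 1 by norm_num)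
  filter_upwards [ev_env (2*k) n.hε0, ev_err1 (2*k) n.hδ1, ev_err2 k j n.hδ1 hC hBd, hr.eventually_ge_atTop ((8*k+2)/η),
    hr.eventually_ge_atTop 1, tl.eventually hpe, eventually_ge_atTop 4] with N e e1 e2 hr1 hr2 hp hN4
  have hl1 := e.logN
  have hN0 : (4:ℝ) ≤ N := by exact_mod_cast hN4
  rw [one_mul, Real.exp_log (by linarith), pow_one] at hp
  set l := Real.log N with hl
  set r := l^(1/2:ℝ) with hrd
  have hrr : r*r = l := by
    rw [hrd, ← Real.rpow_add (by linarith)]; norm_num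
  have hηr : 8*k+2 ≤ η*r := by
    rw [div_le_iff₀ hη] at hr1; linarith
  have hk0 : (0:ℝ) ≤ k := Nat.cast_nonneg _
  have hηl : η*l = (η*r)*r := by rw [← hrr]; ring
  have h2r : 2*r ≤ η*l := by rw [hηl]; nlinarith
  set h := ⌊η*l⌋₊ with hh
  have hh1 : (h:ℝ) ≤ η*l := Nat.floor_le (by positivity)
  have hh3 : η*l < h+1 := Nat.lt_floor_add_one _
  have hWr := W_le hl1
  rw [← hrd] at hWr
  have hW0 : (0:ℝ) < primorial (ww N) := by exact_mod_cast primorial_pos _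
  have hb1 : 1 / (primorial (ww N):ℝ) ≤ be (ww N) := by
    unfold be
    have : (1:ℝ) ≤ Nat.totient (primorial (ww N)) := by exact_mod_cast Nat.totient_pos.mpr (primorial_pos _)
    gcongr
  have hbl : r ≤ be (ww N) * l := by
    calc r ≤ 1/(primorial (ww N):ℝ) * l := by
          rw [one_div_mul_eq_div, le_div_iff₀ hW0, ← hrr]; nlinarith
      _ ≤ _ := mul_le_mul_of_nonneg_right hb1 (by linarith)
  have hhN : N + N/2 + h ≤ 2*N := by
    have h1 : (h:ℝ) ≤ N/4 := by nlinarith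
    have h2 : 4*h ≤ N := by
      have : (4:ℝ)*h ≤ N := by linarith
      exact_mod_cast this
    omega
  have ht := total e n hn1 hn2 (N/2) (Nat.div_le_self _ _) (by linarith) hB hC hE (T := l^(2*k+2^j+2)) (by positivity) hj.le e2 e1 hη hη1 (by ring) h
    (by
      have : (primorial (ww N):ℝ) ≤ h := by linarith
      exact_mod_cast this) hh1 (by linarith) (by push_cast; nlinarith) hhN
  have hM : (N:ℝ)/3 ≤ ((N/2:ℕ):ℝ) := by
    rw [div_le_iff₀ (by norm_num)]
    have : N ≤ N/2*3 := by omega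
    exact_mod_cast this
  have hc := c4_pos (s := s) n.hk n.hA n.hδ
  set G : ℝ := (gapCount N (η*l) : ℝ) with hG
  have hG0 : 0 ≤ G := Nat.cast_nonneg _
  have hpow : η^k = η^(k-1)*η := by
    rw [← pow_succ, Nat.sub_add_cancel n.hk]
  have t1 : c4 k s A δ * η^k * (N/3) ≤ η*l*G :=
    (mul_le_mul_of_nonneg_left hM (by positivity)).trans (ht.trans (mul_le_mul_of_nonneg_right hh1 hG0))
  rw [div_le_iff₀ (by linarith)]
  refine le_of_mul_le_mul_left ?_ hη
  rw [hpow] at t1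
  linarith
end GPY

/-- **(5.12) of GPY IV.** For sufficiently small `ξ > 0`, if the primes have level of
distribution `ϑ` for some fixed `ϑ > 1/2 + ξ`, then there is `c₆(ξ) > 0` such that for every
fixed `η` with `0 < η ≤ ξ⁴/5`, as `N → ∞`,
`#{j : N < p_j ≤ 2N, p_{j+1} - p_j ≤ η log N}
  ≥ (1-o(1)) c₆(ξ) η^{4ξ^{-2}+14ξ^{-1}+11} N/log N`. -/
theorem small_gaps_slightly_beyond_half :
    ∃ ξ₀ : ℝ, 0 < ξ₀ ∧ ∀ ξ : ℝ, 0 < ξ → ξ < ξ₀ →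
      ∀ ϑ : ℝ, 1/2 + ξ < ϑ → HasLevelOfDistribution ϑ →
      ∃ c₆ : ℝ, 0 < c₆ ∧ ∀ η : ℝ, 0 < η → η ≤ ξ^4/5 →
        ∀ ε : ℝ, 0 < ε → ∃ N₀ : ℕ, ∀ N : ℕ, N₀ ≤ N →
          (1 - ε) * (c₆ * η ^ (4/ξ^2 + 14/ξ + 11) * N / Real.log N) ≤
            (gapCount N (η * Real.log N) : ℝ) := by
  obtain ⟨k, A, δ, ε', s, n, hn1, hn2⟩ := GPY.num_exists
  refine ⟨1/(k+1), by positivity, fun ξ hξ hξ0 ϑ hϑ hlev => ?_⟩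
  have hc := GPY.c4_pos (s := s) n.hk n.hA n.hδ
  refine ⟨GPY.c4 k s A δ/3, by positivity, fun η hη hηξ ε hε => ?_⟩
  have hk0 : (0:ℝ) ≤ k := Nat.cast_nonneg _
  have hξk : ξ*(k+1) < 1 := by rwa [lt_div_iff₀ (by positivity)] at hξ0
  have hξ1 : ξ ≤ 1 := by nlinarith
  have hη1 : η ≤ 1 := by
    have : ξ^4 ≤ 1 := pow_le_one₀ hξ.le hξ1
    linarith
  have hev := GPY.final n hn1 hn2 (by linarith) hlev hη hη1
  obtain ⟨N₀, hN₀⟩ := Filter.eventually_atTop.mp (hev.and (GPY.tl.eventually_ge_atTop 1))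
  refine ⟨N₀, fun N hN => ?_⟩
  obtain ⟨h1, h2⟩ := hN₀ N hN
  refine le_trans ?_ h1
  have hexp : η ^ (4/ξ^2 + 14/ξ + 11) ≤ η^(k-1) := by
    rw [← Real.rpow_natCast η (k-1)]
    refine Real.rpow_le_rpow_of_exponent_ge hη hη1 ?_
    have a1 : ((k-1:ℕ):ℝ) ≤ k := by exact_mod_cast Nat.sub_le _ _
    have a2 : (k:ℝ) ≤ 14/ξ := by rw [le_div_iff₀ hξ]; nlinarith
    have a3 : 0 ≤ 4/ξ^2 := by positivity
    linarith
  have hp : 0 < η ^ (4/ξ^2 + 14/ξ + 11) := Real.rpow_pos_of_pos hη _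
  have hl : 0 < Real.log N := by linarith
  have b1 : 0 ≤ GPY.c4 k s A δ/3 * η ^ (4/ξ^2 + 14/ξ + 11) * N / Real.log N := by positivity
  calc _ ≤ GPY.c4 k s A δ/3 * η ^ (4/ξ^2 + 14/ξ + 11) * N / Real.log N := by nlinarith
    _ ≤ _ := by gcongr
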